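/- There exists an integer r₀ such that for every integer r ≥ r₀ we have s(3,r) = binom(r+1,2) + 2(r−1). Concretely: (a) for every n and every matrix A ∈ ℤ^{r×n} of rank r all of whose r×r submatrices have determinant of absolute value at most 3 and whose columns are pairwise non-parallel, it holds that n ≤ binom(r+1,2) + 2(r−1); and (b) there exists a matrix A ∈ ℤ^{r×n} with n = binom(r+1,2) + 2(r−1), of rank r, with pairwise non-parallel columns, all of whose r×r submatrices have determinant of absolute value at most 3. -/

import Mathlib

/-- Two integer vectors are parallel if they are linearly dependent over `ℚ`. -/
def IntParallel {r : ℕ} (u v : Fin r → ℤ) : Prop :=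
  ¬ LinearIndependent ℚ ![(fun i => (u i : ℚ)), (fun i => (v i : ℚ))]

/-- A matrix with `r` rows is `Δ`-modular if every `r × r` submatrix has
determinant of absolute value at most `Δ`. -/
def DeltaModular {r n : ℕ} (A : Matrix (Fin r) (Fin n) ℤ) (Δ : ℤ) : Prop :=
  ∀ f : Fin r → Fin n, Function.Injective f → |(A.submatrix id f).det| ≤ Δ

namespace ModularForms

open Module Submodule Function

set_option linter.unusedSectionVars false

section

variable {V : Type*} [AddCommGroup V] [Module ℚ V]
variable {V' : Type*} [AddCommGroup V'] [Module ℚ V']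
variable {ι α β : Type*}

/-- All values of the form on vectors of `S` are integers of absolute value at most `Δ`. -/
def Bdd (ω : V [⋀^ι]→ₗ[ℚ] ℚ) (S : Set V) (Δ : ℤ) : Prop :=
  ∀ v : ι → V, (∀ i, v i ∈ S) → ∃ z : ℤ, ω v = z ∧ |z| ≤ Δ

/-- Some nonzero volume form takes only integer values of absolute value at most `Δ` on `S`. -/
def IsModular (Δ : ℤ) (S : Set V) : Prop :=
  ∃ ω : V [⋀^Fin (finrank ℚ V)]→ₗ[ℚ] ℚ, ω ≠ 0 ∧ Bdd ω S Δ

/-- Freeze the right block of arguments of a form. -/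
def freezeRight (ω : V [⋀^α ⊕ β]→ₗ[ℚ] ℚ) (b : β → V) : V [⋀^α]→ₗ[ℚ] ℚ where
  toFun d := ω (Sum.elim d b)
  map_update_add' := by
    classical
    intro inst m i x y
    rw [Subsingleton.elim inst (fun a b => Classical.propDecidable (a = b))]
    simp only [← Sum.update_elim_inl, AlternatingMap.map_update_add]
  map_update_smul' := by
    classical
    intro inst m i c x
    rw [Subsingleton.elim inst (fun a b => Classical.propDecidable (a = b))]
    simp only [← Sum.update_elim_inl, AlternatingMap.map_update_smul]
  map_eq_zero_of_eq' := by
    intro v i j h hij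
    exact ω.map_eq_zero_of_eq (i := Sum.inl i) (j := Sum.inl j) _ (by simpa using h)
      (by simpa using hij)

/-- Freeze the left block of arguments of a form. -/
def freezeLeft (ω : V [⋀^α ⊕ β]→ₗ[ℚ] ℚ) (a : α → V) : V [⋀^β]→ₗ[ℚ] ℚ :=
  freezeRight (ω.domDomCongr (Equiv.sumComm α β)) a

@[simp] lemma freezeRight_apply (ω : V [⋀^α ⊕ β]→ₗ[ℚ] ℚ) (a : α → V) (b : β → V) :
    freezeRight ω b a = ω (Sum.elim a b) := rfl

@[simp] lemma freezeLeft_apply (ω : V [⋀^α ⊕ β]→ₗ[ℚ] ℚ) (a : α → V) (b : β → V) :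
    freezeLeft ω a b = ω (Sum.elim a b) := by
  change (ω.domDomCongr (Equiv.sumComm α β)) (Sum.elim b a) = _
  rw [AlternatingMap.domDomCongr_apply]
  congr 1
  ext i
  cases i <;> rfl

lemma map_eq_of_sub_mem [Finite ι] (f : V [⋀^ι]→ₗ[ℚ] ℚ) (N : Submodule ℚ V)
    (hN : ∀ v i, v i ∈ N → f v = 0) {d d' : ι → V} (h : ∀ i, d i - d' i ∈ N) : f d = f d' := by
  classical
  cases nonempty_fintype ι
  have key : ∀ s : Finset ι, f (s.piecewise d' d) = f d := by
    intro s
    induction s using Finset.induction_on with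
    | empty => simp
    | insert a s ha ih =>
      rw [Finset.piecewise_insert]
      have h1 : s.piecewise d' d = update (s.piecewise d' d) a (d a) := by
        rw [eq_comm, Function.update_eq_self_iff]
        simp [ha]
      have h2 : d' a = d a - (d a - d' a) := by abel
      rw [h2, AlternatingMap.map_update_sub, ← h1, ih,
        hN (update (s.piecewise d' d) a (d a - d' a)) a (by simpa using h a), sub_zero]
  have := key Finset.univ
  simpa using this.symm

lemma not_linearIndependent_of_mem {K : Submodule ℚ V} [FiniteDimensional ℚ K] [Fintype ι]
    {v : ι → V} (h : ∀ i, v i ∈ K) (hc : finrank ℚ K < Fintype.card ι) :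
    ¬ LinearIndependent ℚ v := by
  intro hv
  have h1 : LinearIndependent ℚ (fun i => (⟨v i, h i⟩ : K)) :=
    LinearIndependent.of_comp K.subtype (by simpa [Function.comp_def] using hv)
  have := h1.fintype_card_le_finrank
  omega

variable [FiniteDimensional ℚ V] [FiniteDimensional ℚ V']

lemma map_elim_eq_left [Fintype α] [Fintype β] (ω : V [⋀^α ⊕ β]→ₗ[ℚ] ℚ) {d d' : α → V} {b : β → V}
    (h : ∀ i, d i - d' i ∈ span ℚ (Set.range b)) :
    ω (Sum.elim d b) = ω (Sum.elim d' b) := by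
  refine map_eq_of_sub_mem (freezeRight ω b) (span ℚ (Set.range b)) ?_ h
  intro v i hi
  refine ω.map_linearDependent _ fun hl => ?_
  rw [linearIndependent_sum] at hl
  obtain ⟨h1, h2, h3⟩ := hl
  rw [Submodule.disjoint_def] at h3
  have := h3 (v i) (subset_span ⟨i, rfl⟩) (by simpa using hi)
  exact h1.ne_zero i this

lemma map_elim_eq_right [Fintype α] [Fintype β] (ω : V [⋀^α ⊕ β]→ₗ[ℚ] ℚ) {d : α → V} {b b' : β → V}
    (K : Submodule ℚ V) (hd : ∀ i, d i ∈ K) (hK : finrank ℚ K ≤ Fintype.card α)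
    (h : ∀ i, b i - b' i ∈ K) :
    ω (Sum.elim d b) = ω (Sum.elim d b') := by
  rw [← freezeLeft_apply, ← freezeLeft_apply]
  refine map_eq_of_sub_mem (freezeLeft ω d) K ?_ h
  intro v i hi
  rw [freezeLeft_apply]
  refine ω.map_linearDependent _ fun hl => ?_
  have h2 : LinearIndependent ℚ (fun o : Option α => o.elim (v i) d) := by
    have := hl.comp (fun o : Option α => o.elim (Sum.inr i) Sum.inl) (by
      rintro (_ | a) (_ | a') h <;> simp_all)
    have h3 : (Sum.elim d v ∘ fun o : Option α => o.elim (Sum.inr i) Sum.inl)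
        = fun o : Option α => o.elim (v i) d := by
      ext o; cases o <;> rfl
    rwa [h3] at this
  refine not_linearIndependent_of_mem (K := K) (fun o => ?_) ?_ h2
  · cases o with
    | none => exact hi
    | some a => exact hd a
  · rw [Fintype.card_option]; omega

lemma map_elim_eq [Fintype α] [Fintype β] (ω : V [⋀^α ⊕ β]→ₗ[ℚ] ℚ) {d d' : α → V} {b b' : β → V}
    (K : Submodule ℚ V) (hd : ∀ i, d i - d' i ∈ span ℚ (Set.range b)) (hd' : ∀ i, d' i ∈ K)
    (hK : finrank ℚ K ≤ Fintype.card α) (h : ∀ i, b i - b' i ∈ K) :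
    ω (Sum.elim d b) = ω (Sum.elim d' b') :=
  (map_elim_eq_left ω hd).trans (map_elim_eq_right ω K hd' hK h)

/-- A linearly independent family of full size as a basis. -/
lemma exists_basis_of_card_eq [Fintype ι] {v : ι → V} (hv : LinearIndependent ℚ v)
    (hc : Fintype.card ι = finrank ℚ V) : ∃ B : Basis ι ℚ V, ⇑B = v :=
  ⟨Basis.mk hv (hv.span_eq_top_of_card_eq_finrank' hc).ge, Basis.coe_mk _ _⟩

lemma map_ne_zero_iff_linearIndependent [Fintype ι] {ω : V [⋀^ι]→ₗ[ℚ] ℚ} (hω : ω ≠ 0)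
    (hc : Fintype.card ι = finrank ℚ V) {v : ι → V} : ω v ≠ 0 ↔ LinearIndependent ℚ v := by
  classical
  constructor
  · intro h
    by_contra h'
    exact h (ω.map_linearDependent v h')
  · intro hv
    obtain ⟨B, rfl⟩ := exists_basis_of_card_eq hv hc
    exact (AlternatingMap.map_basis_ne_zero_iff B ω).2 hω

lemma map_update_basis [Fintype ι] [DecidableEq ι] (ω : V [⋀^ι]→ₗ[ℚ] ℚ) (B : Basis ι ℚ V) (i : ι)
    (a : V) : ω (update B i a) = B.repr a i * ω B := by
  have h := B.sum_repr a
  conv_lhs => rw [← h]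
  rw [AlternatingMap.map_update_sum, Finset.sum_eq_single i]
  · rw [AlternatingMap.map_update_smul, update_eq_self, smul_eq_mul]
  · intro j _ hj
    rw [AlternatingMap.map_update_smul, AlternatingMap.map_update_self _ _ hj.symm, smul_zero]
  · simp

lemma linearIndependent_elim_of_ker {π : V →ₗ[ℚ] V'} {y : α → V} {X : β → V}
    (hy : LinearIndependent ℚ y) (hπ : ∀ i, π (y i) = 0) (hX : LinearIndependent ℚ (π ∘ X)) :
    LinearIndependent ℚ (Sum.elim y X) := by
  refine hy.sum_type (.of_comp π hX) ?_
  have h1 : Disjoint (span ℚ (Set.range X)) (LinearMap.ker π) :=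
    Submodule.range_ker_disjoint hX
  refine (h1.mono_right ?_).symm
  rw [span_le]
  rintro _ ⟨i, rfl⟩
  exact hπ i

lemma linearIndependent_comp_of_ker {π : V →ₗ[ℚ] V'} {y : α → V} {X : β → V}
    (hπ : LinearMap.ker π = span ℚ (Set.range y)) (h : LinearIndependent ℚ (Sum.elim y X)) :
    LinearIndependent ℚ (π ∘ X) := by
  rw [linearIndependent_sum] at h
  obtain ⟨_, h2, h3⟩ := h
  refine h2.map ?_
  rw [hπ]
  exact h3.symm

lemma finrank_add_card_of_ker {π : V →ₗ[ℚ] V'} (hs : Surjective π) [Fintype α] {y : α → V}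
    (hy : LinearIndependent ℚ y) (hπ : LinearMap.ker π = span ℚ (Set.range y)) :
    Fintype.card α + finrank ℚ V' = finrank ℚ V := by
  have h1 := π.finrank_range_add_finrank_ker
  rw [hπ, finrank_span_eq_card hy, LinearMap.range_eq_top.2 hs, finrank_top] at h1
  omega

lemma span_image_eq_top {π : V →ₗ[ℚ] V'} (hs : Surjective π) {S : Set V} (hS : span ℚ S = ⊤) :
    span ℚ (π '' S) = ⊤ := by
  rw [Submodule.span_image, hS, Submodule.map_top, LinearMap.range_eq_top.2 hs]

lemma exists_basis_in [Fintype β] (hc : Fintype.card β = finrank ℚ V) {S : Set V}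
    (hS : span ℚ S = ⊤) : ∃ X : β → V, (∀ j, X j ∈ S) ∧ LinearIndependent ℚ X := by
  obtain ⟨b, hb, hb1, hb2⟩ := exists_linearIndependent ℚ S
  rw [hS] at hb1
  have hfin : Finite b := hb2.finite
  cases nonempty_fintype b
  have hcard : Fintype.card b = Fintype.card β := by
    rw [hc]
    have := finrank_span_eq_card hb2
    rw [Subtype.range_coe, hb1, finrank_top] at this
    exact this.symm
  let e := Fintype.equivOfCardEq hcard
  exact ⟨fun j => e.symm j, fun j => hb (e.symm j).2, hb2.comp _ e.symm.injective⟩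

lemma exists_extension_of_ker {π : V →ₗ[ℚ] V'} (hs : Surjective π) [Fintype β] {y : α → V}
    (hy : LinearIndependent ℚ y) (hπ : ∀ i, π (y i) = 0)
    (hc : Fintype.card β = finrank ℚ V') {S : Set V} (hS : span ℚ S = ⊤) :
    ∃ X : β → V, (∀ j, X j ∈ S) ∧ LinearIndependent ℚ (Sum.elim y X) := by
  obtain ⟨b, hb, hb2⟩ := exists_basis_in hc (span_image_eq_top hs hS)
  choose X hX hX' using hb
  refine ⟨X, hX, linearIndependent_elim_of_ker hy hπ ?_⟩
  have : π ∘ X = b := funext hX'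
  rwa [this]

lemma exists_extension [Fintype α] [Fintype β] {y : α → V} (hy : LinearIndependent ℚ y)
    (hc : Fintype.card α + Fintype.card β = finrank ℚ V) {S : Set V} (hS : span ℚ S = ⊤) :
    ∃ X : β → V, (∀ j, X j ∈ S) ∧ LinearIndependent ℚ (Sum.elim y X) := by
  refine exists_extension_of_ker (π := (span ℚ (Set.range y)).mkQ) (mkQ_surjective _) hy
    (fun i => ?_) ?_ hS
  · simpa using subset_span (Set.mem_range_self i)
  · have := finrank_add_card_of_ker (mkQ_surjective _) hy (ker_mkQ (span ℚ (Set.range y)))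
    omega

lemma exists_quotient_form [Fintype α] [Fintype β] (ω : V [⋀^α ⊕ β]→ₗ[ℚ] ℚ) {π : V →ₗ[ℚ] V'}
    (hs : Surjective π) {y : α → V} (hπ : LinearMap.ker π = span ℚ (Set.range y)) :
    ∃ ω' : V' [⋀^β]→ₗ[ℚ] ℚ, ∀ v : β → V, ω' (π ∘ v) = ω (Sum.elim y v) := by
  obtain ⟨g, hg⟩ := π.exists_rightInverse_of_surjective (LinearMap.range_eq_top.2 hs)
  refine ⟨(freezeLeft ω y).compLinearMap g, fun v => ?_⟩
  rw [AlternatingMap.compLinearMap_apply, ← freezeLeft_apply]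
  refine map_eq_of_sub_mem (freezeLeft ω y) (LinearMap.ker π) ?_ ?_
  · intro w i hi
    rw [freezeLeft_apply]
    refine ω.map_linearDependent _ fun hl => ?_
    have := (linearIndependent_comp_of_ker hπ hl).ne_zero i
    exact this hi
  · intro i
    rw [LinearMap.mem_ker, map_sub]
    have := LinearMap.congr_fun hg (π (v i))
    simp only [LinearMap.comp_apply, LinearMap.id_apply] at this
    simp [this]

lemma IsModular.exists_form {Δ : ℤ} {S : Set V} (h : IsModular Δ S) [Fintype ι]
    (hc : Fintype.card ι = finrank ℚ V) : ∃ ω : V [⋀^ι]→ₗ[ℚ] ℚ, ω ≠ 0 ∧ Bdd ω S Δ := by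
  obtain ⟨ω, h0, hω⟩ := h
  let e : Fin (finrank ℚ V) ≃ ι := Fintype.equivOfCardEq (by simpa using hc.symm)
  refine ⟨ω.domDomCongr e, ?_, fun v hv => ?_⟩
  · rwa [Ne, AlternatingMap.domDomCongr_eq_zero_iff]
  · rw [AlternatingMap.domDomCongr_apply]
    exact hω _ fun i => hv _

lemma IsModular.of_form {Δ : ℤ} {S : Set V} [Fintype ι] {ω : V [⋀^ι]→ₗ[ℚ] ℚ} (h0 : ω ≠ 0)
    (h : Bdd ω S Δ) (hc : Fintype.card ι = finrank ℚ V) : IsModular Δ S := by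
  let e : ι ≃ Fin (finrank ℚ V) := Fintype.equivOfCardEq (by simpa using hc)
  refine ⟨ω.domDomCongr e, ?_, fun v hv => ?_⟩
  · rwa [Ne, AlternatingMap.domDomCongr_eq_zero_iff]
  · rw [AlternatingMap.domDomCongr_apply]
    exact h _ fun i => hv _

lemma IsModular.mono {Δ : ℤ} {S T : Set V} (h : IsModular Δ S) (hT : T ⊆ S) : IsModular Δ T := by
  obtain ⟨ω, h0, hω⟩ := h
  exact ⟨ω, h0, fun v hv => hω v fun i => hT (hv i)⟩

/-- If the values of a form with left block frozen at `y` are bounded up to a common factor,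
then the quotient by the span of `y` is modular. -/
lemma isModular_quotient_of_scaled {Δ : ℤ} {S : Set V} [Fintype α] [Fintype β]
    {ω : V [⋀^α ⊕ β]→ₗ[ℚ] ℚ} (h0 : ω ≠ 0) (hc : Fintype.card α + Fintype.card β = finrank ℚ V)
    (hS : span ℚ S = ⊤) {π : V →ₗ[ℚ] V'} (hs : Surjective π) {y : α → V}
    (hy : LinearIndependent ℚ y) (hπ : LinearMap.ker π = span ℚ (Set.range y)) {c : ℚ}
    (h : ∀ X : β → V, (∀ j, X j ∈ S) → ∃ z : ℤ, ω (Sum.elim y X) = c * z ∧ |z| ≤ Δ) :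
    IsModular Δ (π '' S) := by
  obtain ⟨ω', hω'⟩ := exists_quotient_form ω hs hπ
  obtain ⟨X, hX, hX'⟩ := exists_extension hy hc hS
  have h1 := (map_ne_zero_iff_linearIndependent h0 (by simpa using hc)).2 hX'
  have hc0 : c ≠ 0 := by
    rintro rfl
    obtain ⟨z, hz, _⟩ := h X hX
    exact h1 (by simpa using hz)
  have hcard := finrank_add_card_of_ker hs hy hπ
  refine IsModular.of_form (ω := c⁻¹ • ω') ?_ ?_ (by omega)
  · intro h2
    have : (c⁻¹ • ω') (π ∘ X) = 0 := by rw [h2]; rfl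
    rw [AlternatingMap.smul_apply, hω', smul_eq_mul] at this
    exact mul_ne_zero (inv_ne_zero hc0) h1 this
  · intro v hv
    choose w hw hw' using hv
    obtain ⟨z, hz, hz'⟩ := h w hw
    have : v = π ∘ w := (funext hw').symm
    refine ⟨z, ?_, hz'⟩
    rw [this, AlternatingMap.smul_apply, hω', hz, smul_eq_mul]
    field_simp

lemma IsModular.quotient {Δ : ℤ} {S : Set V} (h : IsModular Δ S) (hS : span ℚ S = ⊤)
    {π : V →ₗ[ℚ] V'} (hs : Surjective π) [Fintype α] {y : α → V}
    (hy : LinearIndependent ℚ y) (hyS : ∀ i, y i ∈ S)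
    (hπ : LinearMap.ker π = span ℚ (Set.range y)) : IsModular Δ (π '' S) := by
  have hcard := finrank_add_card_of_ker hs hy hπ
  obtain ⟨ω, h0, hω⟩ := h.exists_form (ι := α ⊕ Fin (finrank ℚ V')) (by simpa using hcard)
  refine isModular_quotient_of_scaled h0 (by simpa using hcard) hS hs hy hπ (c := 1) fun X hX => ?_
  obtain ⟨z, hz, hz'⟩ := hω (Sum.elim y X) (by rintro (i | i); exacts [hyS i, hX i])
  exact ⟨z, by simpa using hz, hz'⟩

/-- If `ω (y', X) = ρ ω (y, X)` with `ρ ∉ {0, 1, -1}`, then contracting `y` leaves a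
unimodular system. -/
lemma isModular_one_of_ratio {S : Set V} [Fintype α] [Fintype β]
    {ω : V [⋀^α ⊕ β]→ₗ[ℚ] ℚ} (h0 : ω ≠ 0) (hω : Bdd ω S 3)
    (hc : Fintype.card α + Fintype.card β = finrank ℚ V)
    (hS : span ℚ S = ⊤) {π : V →ₗ[ℚ] V'} (hs : Surjective π) {y y' : α → V}
    (hy : LinearIndependent ℚ y) (hyS : ∀ i, y i ∈ S) (hyS' : ∀ i, y' i ∈ S)
    (hπ : LinearMap.ker π = span ℚ (Set.range y)) {ρ : ℚ} (hρ : ρ ≠ 0) (hρ1 : |ρ| ≠ 1)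
    (h : ∀ X : β → V, (∀ j, X j ∈ S) → ω (Sum.elim y' X) = ρ * ω (Sum.elim y X)) :
    IsModular 1 (π '' S) := by
  have key : ∃ c : ℚ, ∀ X : β → V, (∀ j, X j ∈ S) →
      ω (Sum.elim y X) = 0 ∨ ω (Sum.elim y X) = c ∨ ω (Sum.elim y X) = -c := by
    refine ⟨ρ.den, fun X hX => ?_⟩
    obtain ⟨a, ha, ha3⟩ := hω (Sum.elim y X) (by rintro (i | i); exacts [hyS i, hX i])
    obtain ⟨b, hb, hb3⟩ := hω (Sum.elim y' X) (by rintro (i | i); exacts [hyS' i, hX i])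
    have h1 := h X hX
    rw [ha, hb] at h1
    have h2 : b * (ρ.den : ℤ) = ρ.num * a := by
      have h3 : (ρ.den : ℚ) ≠ 0 := by exact_mod_cast ρ.den_ne_zero
      have h4 : (ρ.num : ℚ) = ρ * ρ.den := (Rat.mul_den_eq_num ρ).symm
      have : (b : ℚ) * ρ.den = ρ.num * a := by rw [h4, h1]; ring
      exact_mod_cast this
    have hcop : IsCoprime (ρ.den : ℤ) ρ.num := by
      rw [Int.isCoprime_iff_nat_coprime]
      simpa using ρ.reduced.symm
    obtain ⟨k, rfl⟩ : (ρ.den : ℤ) ∣ a := hcop.dvd_of_dvd_mul_left ⟨b, by rw [← h2]; ring⟩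
    have hd : (0 : ℤ) < ρ.den := by exact_mod_cast ρ.den_pos
    have hb' : b = ρ.num * k := by
      have : b * (ρ.den : ℤ) = (ρ.num * k) * ρ.den := by rw [h2]; ring
      exact mul_right_cancel₀ hd.ne' this
    have hn : ρ.num ≠ 0 := Rat.num_ne_zero.2 hρ
    have hne : ¬ ((ρ.den : ℤ) = 1 ∧ |ρ.num| = 1) := by
      rintro ⟨h5, h6⟩
      apply hρ1
      have h7 : ρ = ρ.num := ((Rat.den_eq_one_iff ρ).1 (by exact_mod_cast h5)).symm
      rw [h7, ← Int.cast_abs, h6, Int.cast_one]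
    have hk : |k| ≤ 1 := by
      by_contra hk
      push Not at hk
      rw [hb', abs_mul] at hb3
      rw [abs_mul, abs_of_pos hd] at ha3
      have := abs_pos.2 hn
      exact hne ⟨by nlinarith, by nlinarith⟩
    have hk' : k = 0 ∨ k = 1 ∨ k = -1 := by
      rw [abs_le] at hk; omega
    rw [ha]
    rcases hk' with rfl | rfl | rfl <;> simp
  obtain ⟨c, hc'⟩ := key
  refine isModular_quotient_of_scaled h0 hc hS hs hy hπ (c := c) fun X hX => ?_
  rcases hc' X hX with h | h | h
  · exact ⟨0, by simpa using h, by simp⟩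
  · exact ⟨1, by simpa using h, by simp⟩
  · exact ⟨-1, by simpa using h, by simp⟩

lemma repr_inr_eq_zero (B : Basis (α ⊕ β) ℚ V) {x : V}
    (hx : x ∈ span ℚ (Set.range (B ∘ Sum.inl))) (j : β) : B.repr x (Sum.inr j) = 0 := by
  have : span ℚ (Set.range (B ∘ Sum.inl)) ≤ LinearMap.ker (B.coord (Sum.inr j)) := by
    rw [span_le]
    rintro _ ⟨i, rfl⟩
    simp
  simpa using this hx

lemma card_le_seven_pow {S : Set V} (h : IsModular 3 S) (hS : span ℚ S = ⊤) {T : Finset V}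
    (hT : ∀ x ∈ T, x ∈ S) {U : Submodule ℚ V} (hU : ∀ x ∈ T, x ∈ U) :
    T.card ≤ 7 ^ finrank ℚ U := by
  classical
  obtain ⟨b, hb, hb1, hb2⟩ := exists_linearIndependent ℚ (T : Set V)
  have : Finite b := hb2.finite
  cases nonempty_fintype b
  have hk : Fintype.card b ≤ finrank ℚ U := by
    by_contra hlt
    push Not at hlt
    exact not_linearIndependent_of_mem (fun i : b => hU i (hb i.2)) hlt hb2
  have hk2 := hb2.fintype_card_le_finrank
  have hc : Fintype.card b + Fintype.card (Fin (finrank ℚ V - Fintype.card b)) = finrank ℚ V := by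
    rw [Fintype.card_fin]; exact Nat.add_sub_of_le hk2
  obtain ⟨X, hX, hX'⟩ := exists_extension hb2 hc hS
  have hc' : Fintype.card (b ⊕ Fin (finrank ℚ V - Fintype.card b)) = finrank ℚ V := by
    rw [Fintype.card_sum, hc]
  obtain ⟨ω, h0, hω⟩ := h.exists_form hc'
  obtain ⟨B, hB⟩ := exists_basis_of_card_eq hX' hc'
  have hωB : ω B ≠ 0 := by
    rw [hB]; exact (map_ne_zero_iff_linearIndependent h0 hc').2 hX'
  have hBS : ∀ i, B i ∈ S := by
    rw [hB]
    rintro (i | i)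
    exacts [hT _ (hb i.2), hX i]
  have hval : ∀ (x : V) (i : b), ∃ z : ℤ, x ∈ T → ω (update B (Sum.inl i) x) = z ∧ |z| ≤ 3 := by
    intro x i
    by_cases hx : x ∈ T
    · obtain ⟨z, hz⟩ := hω (update B (Sum.inl i) x) (fun j => by
        by_cases hj : j = Sum.inl i
        · subst hj; simpa using hT x hx
        · simpa [hj] using hBS j)
      exact ⟨z, fun _ => hz⟩
    · exact ⟨0, fun h => absurd h hx⟩
  choose z hz using hval
  calc T.card ≤ (Fintype.piFinset fun _ : b => Finset.Icc (-3 : ℤ) 3).card := by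
        refine Finset.card_le_card_of_injOn z ?_ ?_
        · intro x hx
          simp only [Finset.mem_coe, Fintype.mem_piFinset, Finset.mem_Icc]
          intro i
          exact abs_le.1 (hz x i hx).2
        · intro x hx x' hx' hxx
          have hmem : ∀ x ∈ T, x ∈ span ℚ (Set.range (B ∘ Sum.inl)) := by
            intro x hx
            have h1 : B ∘ Sum.inl = (Subtype.val : b → V) := by
              rw [hB]; rfl
            rw [h1, Subtype.range_coe, hb1]
            exact subset_span hx
          apply B.ext_elem
          rintro (i | i)
          · have h1 := (hz x i hx).1
            have h2 := (hz x' i hx').1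
            rw [map_update_basis] at h1 h2
            have h3 : (z x i : ℚ) = z x' i := by rw [hxx]
            rw [← h1, ← h2] at h3
            exact mul_right_cancel₀ hωB h3
          · rw [repr_inr_eq_zero B (hmem x hx), repr_inr_eq_zero B (hmem x' hx')]
    _ = 7 ^ Fintype.card b := by simp
    _ ≤ 7 ^ finrank ℚ U := Nat.pow_le_pow_right (by norm_num) hk

lemma card_le_six {T : Finset ι} {a : ι → ℚ} {g : ℚ} (ha : ∀ i ∈ T, a i ≠ 0)
    (h : ∀ s ⊆ T, ∃ z : ℤ, g - ∑ i ∈ s, a i = z ∧ |z| ≤ 3) : T.card ≤ 6 := by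
  classical
  have h1 : ∀ i ∈ T, 1 ≤ |a i| := by
    intro i hi
    obtain ⟨z, hz, _⟩ := h ∅ (by simp)
    obtain ⟨w, hw, _⟩ := h {i} (by simpa using hi)
    have h2 : a i = ((z - w : ℤ) : ℚ) := by
      push_cast
      rw [← hz, ← hw]; simp
    have h3 := ha i hi
    rw [h2] at h3 ⊢
    have : z - w ≠ 0 := by exact_mod_cast h3
    exact_mod_cast Int.one_le_abs this
  have h2 : ∑ i ∈ T, |a i| ≤ 6 := by
    obtain ⟨z, hz, hz3⟩ := h (T.filter fun i => 0 ≤ a i) (Finset.filter_subset _ _)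
    obtain ⟨w, hw, hw3⟩ := h (T.filter fun i => ¬ 0 ≤ a i) (Finset.filter_subset _ _)
    rw [← Finset.sum_filter_add_sum_filter_not T (fun i => 0 ≤ a i)]
    have e1 : ∑ i ∈ T.filter (fun i => 0 ≤ a i), |a i| = ∑ i ∈ T.filter (fun i => 0 ≤ a i), a i :=
      Finset.sum_congr rfl fun i hi => abs_of_nonneg (Finset.mem_filter.1 hi).2
    have e2 : ∑ i ∈ T.filter (fun i => ¬ 0 ≤ a i), |a i|
        = - ∑ i ∈ T.filter (fun i => ¬ 0 ≤ a i), a i := by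
      rw [← Finset.sum_neg_distrib]
      exact Finset.sum_congr rfl fun i hi =>
        abs_of_nonpos (le_of_lt (not_le.1 (Finset.mem_filter.1 hi).2))
    rw [e1, e2]
    have hz3' : (-3 : ℚ) ≤ z := by exact_mod_cast (abs_le.1 hz3).1
    have hw3' : (w : ℚ) ≤ 3 := by exact_mod_cast (abs_le.1 hw3).2
    linarith
  have h3 : (T.card : ℚ) ≤ ∑ i ∈ T, |a i| := by
    calc (T.card : ℚ) = ∑ i ∈ T, (1 : ℚ) := by simp
      _ ≤ _ := Finset.sum_le_sum h1
  exact_mod_cast h3.trans h2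

end

section

variable {V : Type*} [AddCommGroup V] [Module ℚ V] [FiniteDimensional ℚ V]
variable {V' : Type*} [AddCommGroup V'] [Module ℚ V'] [FiniteDimensional ℚ V']
variable {ι α β : Type*}

lemma mkQ_eq_zero {K : Submodule ℚ V} {x : V} : K.mkQ x = 0 ↔ x ∈ K := by simp

lemma map_update_update_basis [Fintype ι] [DecidableEq ι] (ω : V [⋀^ι]→ₗ[ℚ] ℚ) (B : Basis ι ℚ V)
    {i j : ι} (hij : i ≠ j) (a b : V) :
    ω (update (update B i a) j b) =
      (B.repr a i * B.repr b j - B.repr a j * B.repr b i) * ω B := by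
  have h := B.sum_repr b
  conv_lhs => rw [← h]
  rw [AlternatingMap.map_update_sum, Finset.sum_eq_add_of_mem i j (Finset.mem_univ _)
    (Finset.mem_univ _) hij]
  · rw [AlternatingMap.map_update_smul, AlternatingMap.map_update_smul]
    have h1 : update (update B i a) j (B j) = update B i a := by
      rw [update_comm hij, update_eq_self]
    have h2 : ω (update (update B i a) j (B i)) = - (B.repr a j * ω B) := by
      have := ω.map_swap (update (update B i a) j (B i)) hij
      have h3 : (update (update B i a) j (B i)) ∘ Equiv.swap i j = update B j a := by
        ext k
        by_cases hk : k = i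
        · subst hk; simp [hij]
        · by_cases hk' : k = j
          · subst hk'; simp [hij]
          · simp [hk, hk', Equiv.swap_apply_of_ne_of_ne]
      rw [h3, map_update_basis] at this
      rw [this]; ring
    rw [h1, h2, map_update_basis, smul_eq_mul, smul_eq_mul]
    ring
  · intro k _ hk
    rw [AlternatingMap.map_update_smul]
    have : ω (update (update B i a) j (B k)) = 0 := by
      refine ω.map_eq_zero_of_eq _ (i := j) (j := k) ?_ hk.2.symm
      simp [hk.1, hk.2]
    rw [this, smul_zero]

/-- Entries and `2 × 2` minors with respect to a basis inside a unimodular system. -/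
lemma unimodular_entry_minor {S : Set V} (h : IsModular 1 S) [Fintype ι] (B : Basis ι ℚ V)
    (hB : ∀ i, B i ∈ S) :
    (∀ a ∈ S, ∀ i, ∃ z : ℤ, B.repr a i = z ∧ |z| ≤ 1) ∧
    (∀ a ∈ S, ∀ b ∈ S, ∀ i j, i ≠ j →
      |B.repr a i * B.repr b j - B.repr a j * B.repr b i| ≤ 1) := by
  classical
  have hc : Fintype.card ι = finrank ℚ V := (finrank_eq_card_basis B).symm
  obtain ⟨ω, h0, hω⟩ := h.exists_form hc
  have h1 : ω B ≠ 0 := (map_ne_zero_iff_linearIndependent h0 hc).2 B.linearIndependent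
  have h2 : ω B = 1 ∨ ω B = -1 := by
    obtain ⟨z, hz, hz1⟩ := hω B hB
    rw [abs_le] at hz1
    have : z ≠ 0 := by rintro rfl; exact h1 (by simpa using hz)
    have : z = 1 ∨ z = -1 := by omega
    rcases this with rfl | rfl <;> simp [hz]
  have hupd : ∀ (v : ι → V) a i, (∀ j, v j ∈ S) → a ∈ S → ∀ j, update v i a j ∈ S := by
    intro v a i hv ha j
    by_cases hj : j = i
    · subst hj; simpa
    · simpa [hj] using hv j
  constructor
  · intro a ha i
    obtain ⟨z, hz, hz1⟩ := hω _ (hupd B a i hB ha)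
    rw [map_update_basis] at hz
    rcases h2 with h2 | h2
    · exact ⟨z, by rw [← hz, h2, mul_one], hz1⟩
    · exact ⟨-z, by push_cast; rw [← hz, h2]; ring, by rwa [abs_neg]⟩
  · intro a ha b hb i j hij
    obtain ⟨z, hz, hz1⟩ := hω _ (hupd _ b j (hupd B a i hB ha) hb)
    rw [map_update_update_basis _ _ hij] at hz
    have h3 : |ω B| = 1 := by rcases h2 with h2 | h2 <;> simp [h2]
    have h4 := congrArg abs hz
    rw [abs_mul, h3, mul_one] at h4
    rw [h4]
    exact_mod_cast hz1

/-- In a unimodular system, points whose differences lie in the system are affinely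
independent. -/
lemma linearIndependent_sub_of_unimodular {S : Set V} (h : IsModular 1 S) (hS : span ℚ S = ⊤)
    {k : ℕ} {g : Fin (k + 1) → V} (hg : Injective g) (hgS : ∀ i j, g i - g j ∈ S) :
    LinearIndependent ℚ (fun j : Fin k => g j.succ - g 0) := by
  classical
  set T : Set V := Set.range (fun j : Fin k => g j.succ - g 0) with hT
  obtain ⟨b, hb, hb1, hb2⟩ := exists_linearIndependent ℚ T
  have : Finite b := hb2.finite
  cases nonempty_fintype b
  have hinj : Injective (fun j : Fin k => g j.succ - g 0) := by
    intro i j hij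
    exact Fin.succ_injective _ (hg (sub_left_injective hij))
  have key : ∀ j : Fin k, g j.succ - g 0 ∈ b := by
    have hc : Fintype.card b + Fintype.card (Fin (finrank ℚ V - Fintype.card b)) = finrank ℚ V := by
      rw [Fintype.card_fin]; exact Nat.add_sub_of_le hb2.fintype_card_le_finrank
    obtain ⟨X, hX, hX'⟩ := exists_extension hb2 hc hS
    obtain ⟨B, hB⟩ := exists_basis_of_card_eq hX' (by rw [Fintype.card_sum, hc])
    have hbS : ∀ x ∈ b, x ∈ S := by
      intro x hx
      obtain ⟨j, rfl⟩ := hb hx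
      exact hgS _ _
    have hBS : ∀ i, B i ∈ S := by
      rw [hB]
      rintro (i | i)
      exacts [hbS _ i.2, hX i]
    have hBl : ∀ i : b, B (Sum.inl i) = i := by intro i; rw [hB]; rfl
    obtain ⟨he, hm⟩ := unimodular_entry_minor h B hBS
    intro j
    by_contra hj
    set x := g j.succ - g 0 with hx
    have hxS : x ∈ S := hgS _ _
    have hx0 : x ≠ 0 := by
      rw [hx, sub_ne_zero]
      exact fun h => Fin.succ_ne_zero j (hg h)
    have hsub : ∀ i : b, x - i ∈ S := by
      intro i
      obtain ⟨l, hl⟩ := hb i.2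
      have : x - i = g j.succ - g l.succ := by rw [← hl, hx]; simp
      rw [this]; exact hgS _ _
    have hsub' : ∀ i i' : b, (i : V) - i' ∈ S := by
      intro i i'
      obtain ⟨l, hl⟩ := hb i.2
      obtain ⟨l', hl'⟩ := hb i'.2
      have : (i : V) - i' = g l.succ - g l'.succ := by rw [← hl, ← hl']; simp
      rw [this]; exact hgS _ _
    have hr : ∀ i : b, B.repr x (Sum.inl i) = 0 ∨ B.repr x (Sum.inl i) = 1 := by
      intro i
      obtain ⟨z, hz, hz1⟩ := he x hxS (Sum.inl i)
      obtain ⟨w, hw, hw1⟩ := he _ (hsub i) (Sum.inl i)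
      rw [map_sub, Finsupp.sub_apply, ← hBl i, B.repr_self, Finsupp.single_eq_same, hz] at hw
      have : z - 1 = w := by exact_mod_cast hw
      rw [abs_le] at hz1 hw1
      have : z = 0 ∨ z = 1 := by omega
      rw [hz]
      rcases this with rfl | rfl <;> simp
    have hr0 : ∀ i, B.repr x (Sum.inr i) = 0 := by
      intro i
      apply repr_inr_eq_zero
      have h1 : B ∘ Sum.inl = (Subtype.val : b → V) := funext hBl
      rw [h1, Subtype.range_coe, hb1]
      exact subset_span ⟨j, rfl⟩
    obtain ⟨i, hi⟩ : ∃ i, B.repr x (Sum.inl i) = 1 := by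
      by_contra hne
      push Not at hne
      apply hx0
      apply B.ext_elem
      rintro (i | i)
      · simpa using (hr i).resolve_right (hne i)
      · simpa using hr0 i
    obtain ⟨i', hii', hi'⟩ : ∃ i', i ≠ i' ∧ B.repr x (Sum.inl i') = 1 := by
      by_contra hne
      push Not at hne
      apply hj
      have : x = i := by
        rw [← hBl i]
        apply B.ext_elem
        rintro (l | l)
        · by_cases hl : i = l
          · subst hl; simpa using hi
          · rw [(hr l).resolve_right (hne l hl)]
            simp [hl]
        · simpa using hr0 l
      rw [this]; exact i.2
    clear_value x
    have := hm x hxS _ (hsub' i i') (Sum.inl i) (Sum.inl i') (by simpa using hii')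
    rw [map_sub, Finsupp.sub_apply, Finsupp.sub_apply, ← hBl i, ← hBl i'] at this
    simp [hi, hi', hii', hii'.symm] at this
    norm_num at this
  have := hb2.comp (fun j : Fin k => (⟨_, key j⟩ : b)) (fun i j hij => hinj (by simpa using hij))
  exact this

/-- Representatives of the classes of `F` modulo `K`, affinely independent modulo `K`. -/
structure Simplex (K : Submodule ℚ V) (F : Finset V) {k : ℕ} (f : Fin (k + 1) → V) : Prop where
  mem : ∀ j, f j ∈ F
  cover : ∀ x ∈ F, ∃ j, x - f j ∈ K
  indep : ∀ c : Fin (k + 1) → ℚ, ∑ j, c j = 0 → ∑ j, c j • f j ∈ K → c = 0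

lemma exists_simplex_of_unimodular {S : Set V} (hS : span ℚ S = ⊤) {K : Submodule ℚ V}
    (h : IsModular 1 (K.mkQ '' S)) {F : Finset V} (hF : F.Nonempty)
    (hFS : ∀ x ∈ F, ∀ y ∈ F, x - y ∈ S) :
    ∃ (k : ℕ) (f : Fin (k + 1) → V), Simplex K F f := by
  classical
  set G := F.image K.mkQ with hG
  obtain ⟨k, hk⟩ : ∃ k, G.card = k + 1 :=
    Nat.exists_eq_succ_of_ne_zero (Finset.card_pos.2 (hF.image _)).ne'
  let e := (Finset.equivFinOfCardEq hk).symm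
  have hlift : ∀ j, ∃ x ∈ F, K.mkQ x = e j := fun j => Finset.mem_image.1 (e j).2
  choose f hf hf' using hlift
  refine ⟨k, f, hf, fun x hx => ?_, fun c hc hcK => ?_⟩
  · refine ⟨e.symm ⟨K.mkQ x, Finset.mem_image_of_mem _ hx⟩, ?_⟩
    rw [← mkQ_eq_zero, map_sub, hf']
    simp
  · have hli := linearIndependent_sub_of_unimodular h (span_image_eq_top K.mkQ_surjective hS)
      (g := fun j => K.mkQ (f j)) (fun i j hij => by
        simp only [hf'] at hij
        exact e.injective (Subtype.ext hij))
      (fun i j => ⟨f i - f j, hFS _ (hf i) _ (hf j), by rw [map_sub]⟩)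
    rw [Fintype.linearIndependent_iff] at hli
    have h0 : ∑ j, c j • K.mkQ (f j) = 0 := by
      rw [← mkQ_eq_zero, map_sum] at hcK
      simpa only [map_smul] using hcK
    have h1 : ∑ j : Fin k, c j.succ • (K.mkQ (f j.succ) - K.mkQ (f 0)) = 0 := by
      simp only [smul_sub, Finset.sum_sub_distrib, ← Finset.sum_smul]
      rw [Fin.sum_univ_succ] at h0 hc
      rw [eq_sub_of_add_eq' h0, eq_sub_of_add_eq' hc]
      simp
    have h2 := hli _ h1
    ext j
    refine Fin.cases ?_ h2 j
    rw [Fin.sum_univ_succ] at hc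
    simpa [h2] using hc

lemma Simplex.linearIndependent {K : Submodule ℚ V} {F : Finset V} {k : ℕ}
    {f : Fin (k + 1) → V} (hs : Simplex K F f) :
    LinearIndependent ℚ (K.mkQ ∘ fun j : Fin k => f j.castSucc - f j.succ) := by
  rw [Fintype.linearIndependent_iff]
  intro c hc
  have h1 : ∑ j : Fin k, c j • (f j.castSucc - f j.succ) ∈ K := by
    rw [← mkQ_eq_zero, map_sum]
    simpa using hc
  set d : Fin (k + 1) → ℚ := Fin.snoc (α := fun _ => ℚ) c 0 - Fin.cons (α := fun _ => ℚ) 0 c with hd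
  have h2 : d = 0 := by
    refine hs.indep d ?_ ?_
    · simp only [hd, Pi.sub_apply, Finset.sum_sub_distrib]
      rw [Fin.sum_univ_castSucc, Fin.sum_univ_succ (n := k)]
      simp
    · convert h1 using 1
      simp only [hd, Pi.sub_apply, sub_smul, Finset.sum_sub_distrib, smul_sub]
      congr 1
      · rw [Fin.sum_univ_castSucc]
        simp
      · rw [Fin.sum_univ_succ]
        simp
  have h3 : ∀ m : ℕ, ∀ hm : m < k, c ⟨m, hm⟩ = 0 := by
    intro m
    induction m with
    | zero =>
      intro hm
      have := congrFun h2 (Fin.castSucc ⟨0, hm⟩)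
      have e : (Fin.castSucc ⟨0, hm⟩ : Fin (k + 1)) = 0 := rfl
      simp only [hd, Pi.sub_apply, Fin.snoc_castSucc, Pi.zero_apply] at this
      rw [e, Fin.cons_zero, sub_zero] at this
      exact this
    | succ m ih =>
      intro hm
      have := congrFun h2 (Fin.castSucc ⟨m + 1, hm⟩)
      have e : (Fin.castSucc ⟨m + 1, hm⟩ : Fin (k + 1)) = Fin.succ ⟨m, by omega⟩ := rfl
      simp only [hd, Pi.sub_apply, Fin.snoc_castSucc, Pi.zero_apply] at this
      rw [e, Fin.cons_succ, ih, sub_zero] at this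
      exact this
  exact fun i => h3 i i.2

lemma sum_sub_eq_telescope {k : ℕ} (t b : Fin (k + 1) → V) :
    ∑ j, (t j - b j) = (t (Fin.last k) - b 0) + ∑ j : Fin k, (t j.castSucc - b j.succ) := by
  rw [Finset.sum_sub_distrib, Finset.sum_sub_distrib, Fin.sum_univ_castSucc t,
    Fin.sum_univ_succ b]
  abel

lemma Simplex.exists_form {S : Set V} (h : IsModular 3 S) (hS : span ℚ S = ⊤)
    {K : Submodule ℚ V} {F : Finset V} (hFS : ∀ x ∈ F, ∀ y ∈ F, x - y ∈ S) {k : ℕ}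
    {f : Fin (k + 1) → V} (hs : Simplex K F f) [Fintype α] [DecidableEq α]
    (hα : Fintype.card α = finrank ℚ K) :
    k + finrank ℚ K ≤ finrank ℚ V ∧ ∃ ψ : V [⋀^α]→ₗ[ℚ] ℚ,
      (∀ v, (∀ i, v i ∈ K) → LinearIndependent ℚ v → ψ v ≠ 0) ∧
      ∀ t b : Fin (k + 1) → V, (∀ j, t j ∈ F ∧ t j - f j ∈ K) → (∀ j, b j ∈ F ∧ b j - f j ∈ K) →
        ∀ v i₀, (∀ i, i ≠ i₀ → v i ∈ S ∧ v i ∈ K) →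
          ∃ z : ℤ, ψ (update v i₀ (∑ j, (t j - b j))) = z ∧ |z| ≤ 3 := by
  set D : Fin k → V := fun j => f j.castSucc - f j.succ with hD
  have hli := hs.linearIndependent
  have hK : finrank ℚ (V ⧸ K) + finrank ℚ K = finrank ℚ V := finrank_quotient_add_finrank K
  have hk : k ≤ finrank ℚ (V ⧸ K) := by simpa using hli.fintype_card_le_finrank
  refine ⟨by omega, ?_⟩
  obtain ⟨X', hX', hl⟩ := exists_extension (β := Fin (finrank ℚ (V ⧸ K) - k)) hli
    (by simp; omega) (span_image_eq_top K.mkQ_surjective hS)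
  choose X hX hXX using hX'
  have hl' : LinearIndependent ℚ (K.mkQ ∘ Sum.elim D X) := by
    have : K.mkQ ∘ Sum.elim D X = Sum.elim (K.mkQ ∘ D) X' := by
      ext i; rcases i with i | i
      · rfl
      · exact hXX i
    rwa [this]
  have hcard : Fintype.card (α ⊕ (Fin k ⊕ Fin (finrank ℚ (V ⧸ K) - k))) = finrank ℚ V := by
    simp only [Fintype.card_sum, Fintype.card_fin]; omega
  obtain ⟨ω, h0, hω⟩ := h.exists_form hcard
  refine ⟨freezeRight ω (Sum.elim D X), ?_, ?_⟩
  · intro v hv hvl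
    rw [freezeRight_apply, map_ne_zero_iff_linearIndependent h0 hcard]
    exact linearIndependent_elim_of_ker (π := K.mkQ) hvl (fun i => mkQ_eq_zero.2 (hv i)) hl'
  · intro t b ht hb v i₀ hv
    rw [freezeRight_apply]
    set z : Fin k → V := fun j => t j.castSucc - b j.succ with hz
    have hsum : ∑ j, (t j - b j) ∈ K := by
      refine K.sum_mem fun j _ => ?_
      have := K.sub_mem (ht j).2 (hb j).2
      simpa using this
    have e : ω (Sum.elim (update v i₀ (t (Fin.last k) - b 0)) (Sum.elim z X)) =
        ω (Sum.elim (update v i₀ (∑ j, (t j - b j))) (Sum.elim D X)) := by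
      refine map_elim_eq ω K ?_ ?_ hα.ge ?_
      · intro i
        by_cases hi : i = i₀
        · subst hi
          rw [update_self, update_self, sum_sub_eq_telescope, sub_add_cancel_left]
          refine (span ℚ _).neg_mem ((span ℚ _).sum_mem fun j _ => subset_span ⟨Sum.inl j, rfl⟩)
        · simp [hi]
      · intro i
        by_cases hi : i = i₀
        · subst hi; simpa using hsum
        · simpa [hi] using (hv i hi).2
      · rintro (j | j)
        · have := K.sub_mem (ht j.castSucc).2 (hb j.succ).2
          simp only [Sum.elim_inl, hz, hD]
          convert this using 1
          abel
        · simp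
    rw [← e]
    refine hω _ ?_
    rintro (i | j | j)
    · by_cases hi : i = i₀
      · subst hi; simpa using hFS _ (ht _).1 _ (hb _).1
      · simpa [hi] using (hv i hi).1
    · exact hFS _ (ht _).1 _ (hb _).1
    · exact hX j

/-- The class of `x₀` modulo `K` inside `F`. -/
noncomputable def fiber (K : Submodule ℚ V) (F : Finset V) (x₀ : V) : Finset V :=
  open scoped Classical in F.filter fun x => x - x₀ ∈ K

lemma mem_fiber {K : Submodule ℚ V} {F : Finset V} {x₀ x : V} :
    x ∈ fiber K F x₀ ↔ x ∈ F ∧ x - x₀ ∈ K := by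
  simp [fiber]

lemma Simplex.eq_of_sub_mem {K : Submodule ℚ V} {F : Finset V} {k : ℕ}
    {f : Fin (k + 1) → V} (hs : Simplex K F f) {i j : Fin (k + 1)} (h : f i - f j ∈ K) : i = j := by
  classical
  by_contra hij
  have := hs.indep (Pi.single i 1 - Pi.single j 1) (by simp [Finset.sum_sub_distrib]) (by
    simpa [sub_smul, Finset.sum_sub_distrib, Pi.single_apply, ite_smul] using h)
  have := congrFun this i
  simp [hij] at this

lemma Simplex.card_eq {K : Submodule ℚ V} {F : Finset V} {k : ℕ}
    {f : Fin (k + 1) → V} (hs : Simplex K F f) : F.card = ∑ j, (fiber K F (f j)).card := by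
  classical
  rw [← Finset.card_biUnion]
  · congr 1
    ext x
    simp only [Finset.mem_biUnion, Finset.mem_univ, true_and, mem_fiber]
    exact ⟨fun h => (hs.cover x h).imp fun j hj => ⟨h, hj⟩, fun ⟨j, hj⟩ => hj.1⟩
  · intro i _ j _ hij
    change Disjoint _ _
    rw [Finset.disjoint_left]
    intro x hx hx'
    rw [mem_fiber] at hx hx'
    apply hij
    apply hs.eq_of_sub_mem
    have := K.sub_mem hx'.2 hx.2
    simpa using this

lemma Simplex.mem_fiber_self {K : Submodule ℚ V} {F : Finset V} {k : ℕ}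
    {f : Fin (k + 1) → V} (hs : Simplex K F f) (j) : f j ∈ fiber K F (f j) := by
  rw [mem_fiber, sub_self]; exact ⟨hs.mem j, K.zero_mem⟩

/-- Integrality of a functional on sums over sections forces integrality on each fiber and a
bound on the sum of absolute values. -/
lemma section_bound {k : ℕ} {G : Fin (k + 1) → Finset V} {φ : V →ₗ[ℚ] ℚ}
    (hφ : ∀ t b : Fin (k + 1) → V, (∀ j, t j ∈ G j) → (∀ j, b j ∈ G j) →
      ∃ z : ℤ, φ (∑ j, (t j - b j)) = z ∧ |z| ≤ 3) {f : Fin (k + 1) → V} (hf : ∀ j, f j ∈ G j) :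
    (∀ j, ∀ x ∈ G j, ∀ y ∈ G j, ∃ z : ℤ, φ (x - y) = z ∧ |z| ≤ 3) ∧
    ∀ t b : Fin (k + 1) → V, (∀ j, t j ∈ G j) → (∀ j, b j ∈ G j) →
      ∑ j, |φ (t j - b j)| ≤ 3 := by
  classical
  constructor
  · intro j x hx y hy
    have := hφ (update f j x) (update f j y)
      (fun i => by by_cases hi : i = j
                   · subst hi; simpa
                   · simpa [hi] using hf i)
      (fun i => by by_cases hi : i = j
                   · subst hi; simpa
                   · simpa [hi] using hf i)
    rwa [Finset.sum_eq_single j, update_self, update_self] at this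
    · intro i _ hi
      simp [hi]
    · simp
  · intro t b ht hb
    obtain ⟨z, hz, hz3⟩ := hφ (fun j => if 0 ≤ φ (t j - b j) then t j else b j)
      (fun j => if 0 ≤ φ (t j - b j) then b j else t j)
      (fun j => by split_ifs; exacts [ht j, hb j])
      (fun j => by split_ifs; exacts [hb j, ht j])
    have : ∑ j, |φ (t j - b j)| = z := by
      rw [← hz, map_sum]
      refine Finset.sum_congr rfl fun j _ => ?_
      split_ifs with h
      · exact abs_of_nonneg h
      · rw [abs_of_neg (not_le.1 h), ← map_neg, neg_sub]
    rw [this]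
    exact_mod_cast (abs_le.1 hz3).2

lemma card_le_of_diam {T : Finset ι} {z : ι → ℤ} (hz : Set.InjOn z T) {D : ℤ} (hD : 0 ≤ D)
    (h : ∀ x ∈ T, ∀ y ∈ T, z x - z y ≤ D) : (T.card : ℤ) ≤ D + 1 := by
  classical
  rcases T.eq_empty_or_nonempty with rfl | hT
  · simp; omega
  obtain ⟨m, hm, hmin⟩ := T.exists_min_image z hT
  have : T.card ≤ (Finset.Icc (z m) (z m + D)).card := by
    refine Finset.card_le_card_of_injOn z ?_ hz
    intro x hx
    simp only [Finset.coe_Icc, Set.mem_Icc]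
    have := h x hx m hm
    exact ⟨hmin x hx, by linarith⟩
  rw [Int.card_Icc] at this
  omega

/-- Nonzero pairwise non-parallel vectors. -/
def Nonpar (A : Finset V) : Prop :=
  (∀ x ∈ A, x ≠ 0) ∧ ∀ x ∈ A, ∀ y ∈ A, ∀ c : ℚ, y = c • x → y = x

lemma Simplex.exists_functional {S : Set V} (h : IsModular 3 S) (hS : span ℚ S = ⊤)
    {p : V} (hp : p ≠ 0) {F : Finset V} (hFS : ∀ x ∈ F, ∀ y ∈ F, x - y ∈ S) {k : ℕ}
    {f : Fin (k + 1) → V} (hs : Simplex (span ℚ {p}) F f) :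
    k + 1 ≤ finrank ℚ V ∧ ∃ φ : V →ₗ[ℚ] ℚ, φ p ≠ 0 ∧
      ∀ t b : Fin (k + 1) → V, (∀ j, t j ∈ fiber (span ℚ {p}) F (f j)) →
        (∀ j, b j ∈ fiber (span ℚ {p}) F (f j)) →
        ∃ z : ℤ, φ (∑ j, (t j - b j)) = z ∧ |z| ≤ 3 := by
  have h1 : finrank ℚ (span ℚ {p}) = 1 := finrank_span_singleton hp
  obtain ⟨hk, ψ, hψ, hψ'⟩ := hs.exists_form (α := Unit) h hS hFS (by simp [h1])
  rw [h1] at hk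
  refine ⟨hk, ψ.toMultilinearMap.toLinearMap 0 (), ?_, fun t b ht hb => ?_⟩
  · rw [MultilinearMap.toLinearMap_apply]
    refine hψ _ (fun i => ?_) ?_
    · simp
    · rw [linearIndependent_unique_iff]
      simpa using hp
  · obtain ⟨z, hz⟩ := hψ' t b (fun j => mem_fiber.1 (ht j)) (fun j => mem_fiber.1 (hb j)) 0 ()
      (fun i hi => absurd rfl hi)
    exact ⟨z, hz⟩

lemma Simplex.line_widths {S : Set V} (h : IsModular 3 S) (hS : span ℚ S = ⊤)
    {p : V} (hp : p ≠ 0) {F : Finset V} (hFS : ∀ x ∈ F, ∀ y ∈ F, x - y ∈ S) {k : ℕ}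
    {f : Fin (k + 1) → V} (hs : Simplex (span ℚ {p}) F f) :
    k + 1 ≤ finrank ℚ V ∧ ∃ (b : Fin (k + 1) → V) (M : Fin (k + 1) → ℤ) (c : ℚ),
      ∑ j, M j ≤ 3 ∧ (∀ j, 0 ≤ M j) ∧ (∀ j, b j ∈ F ∧ b j - f j ∈ span ℚ {p}) ∧
      (∀ j, ((fiber (span ℚ {p}) F (f j)).card : ℤ) ≤ M j + 1) ∧
      ∀ j, ∀ x ∈ fiber (span ℚ {p}) F (f j), ∃ z : ℤ, 0 ≤ z ∧ z ≤ M j ∧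
        x = b j + (c * z) • p := by
  obtain ⟨hk, φ, hφp, hφ⟩ := hs.exists_functional h hS hp hFS
  refine ⟨hk, ?_⟩
  obtain ⟨hint, hbound⟩ := section_bound (f := f) hφ hs.mem_fiber_self
  have hb := fun j => (fiber (span ℚ {p}) F (f j)).exists_min_image φ ⟨_, hs.mem_fiber_self j⟩
  have ht := fun j => (fiber (span ℚ {p}) F (f j)).exists_max_image φ ⟨_, hs.mem_fiber_self j⟩
  choose b hbG hbmin using hb
  choose t htG htmax using ht
  choose M hM _ using fun j => hint j _ (htG j) _ (hbG j)
  have hM0 : ∀ j, 0 ≤ M j := by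
    intro j
    have := hbmin j _ (htG j)
    have h2 : (0 : ℚ) ≤ M j := by rw [← hM, map_sub]; linarith
    exact_mod_cast h2
  have key : ∀ j, ∀ x ∈ fiber (span ℚ {p}) F (f j), ∃ z : ℤ, 0 ≤ z ∧ z ≤ M j ∧
        x = b j + ((φ p)⁻¹ * z) • p ∧ φ (x - b j) = z := by
    intro j x hx
    obtain ⟨z, hz, _⟩ := hint j x hx _ (hbG j)
    have hxp : x - b j ∈ span ℚ {p} := by
      have := (span ℚ {p}).sub_mem (mem_fiber.1 hx).2 (mem_fiber.1 (hbG j)).2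
      simpa using this
    obtain ⟨a, ha⟩ := mem_span_singleton.1 hxp
    have h1 := hbmin j x hx
    have h2 := htmax j x hx
    have hMj := hM j
    rw [map_sub] at hMj
    refine ⟨z, ?_, ?_, ?_, hz⟩
    · have : (0 : ℚ) ≤ z := by rw [← hz, map_sub]; linarith
      exact_mod_cast this
    · have : (z : ℚ) ≤ M j := by rw [← hz, map_sub]; linarith
      exact_mod_cast this
    · rw [← ha, map_smul, smul_eq_mul] at hz
      have : (φ p)⁻¹ * z = a := by rw [← hz]; field_simp
      rw [this, ha]; abel
  refine ⟨b, M, (φ p)⁻¹, ?_, hM0, fun j => mem_fiber.1 (hbG j), fun j => ?_, fun j x hx => ?_⟩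
  · have h1 := hbound t b htG hbG
    have h2 : ∑ j, |φ (t j - b j)| = ((∑ j, M j : ℤ) : ℚ) := by
      push_cast
      refine Finset.sum_congr rfl fun j _ => ?_
      rw [hM, abs_of_nonneg]
      exact_mod_cast hM0 j
    rw [h2] at h1
    exact_mod_cast h1
  · choose! z hz0 hzM hzx hzφ using key j
    refine card_le_of_diam (z := z) ?_ (hM0 j) ?_
    · intro x hx y hy hxy
      rw [hzx x hx, hzx y hy, hxy]
    · intro x hx y hy
      linarith [hz0 y hy, hzM x hx]
  · obtain ⟨z, h0, h1, h2, _⟩ := key j x hx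
    exact ⟨z, h0, h1, h2⟩

lemma Simplex.card_le_of_line {S : Set V} (h : IsModular 3 S) (hS : span ℚ S = ⊤)
    {p : V} (hp : p ≠ 0) {F : Finset V} (hFS : ∀ x ∈ F, ∀ y ∈ F, x - y ∈ S) {k : ℕ}
    {f : Fin (k + 1) → V} (hs : Simplex (span ℚ {p}) F f) : F.card ≤ finrank ℚ V + 3 := by
  obtain ⟨hk, b, M, c, hM, hM0, -, hcard, -⟩ := hs.line_widths h hS hp hFS
  have h1 : (F.card : ℤ) ≤ ∑ j, (M j + 1) := by
    rw [hs.card_eq]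
    push_cast
    exact Finset.sum_le_sum fun j _ => hcard j
  rw [Finset.sum_add_distrib] at h1
  simp at h1
  omega

lemma sum_pairs_eq {n : ℕ} (M : Fin n → ℤ) :
    2 * ∑ i, ∑ j, (if i < j then M i + M j + 1 else 0) = 2 * (n - 1) * ∑ j, M j + n * (n - 1) := by
  have h1 : ∑ i, ∑ j, (if i < j then M i + M j + 1 else 0) =
      ∑ i, ∑ j, (if j < i then M i + M j + 1 else 0) := by
    rw [Finset.sum_comm]
    refine Finset.sum_congr rfl fun i _ => Finset.sum_congr rfl fun j _ => ?_
    split_ifs <;> ring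
  have h2 : ∀ i j : Fin n, (if i < j then M i + M j + 1 else 0) +
      (if j < i then M i + M j + 1 else 0) = M i + M j + 1 - if i = j then 2 * M i + 1 else 0 := by
    intro i j
    rcases lt_trichotomy i j with h | h | h
    · simp [h, h.ne, h.not_gt]
    · subst h; simp; ring
    · simp [h, h.ne', h.not_gt]
  calc 2 * ∑ i, ∑ j, (if i < j then M i + M j + 1 else 0)
      = ∑ i, ∑ j, (M i + M j + 1 - if i = j then 2 * M i + 1 else 0) := by
        rw [two_mul]
        nth_rewrite 2 [h1]
        rw [← Finset.sum_add_distrib]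
        refine Finset.sum_congr rfl fun i _ => ?_
        rw [← Finset.sum_add_distrib]
        exact Finset.sum_congr rfl fun j _ => h2 i j
    _ = _ := by
        simp [Finset.sum_add_distrib, ← Finset.mul_sum]
        ring

lemma card_le_of_parallel {E Y : Finset V} (hY : Nonpar Y)
    (h : ∀ y ∈ Y, ∃ e ∈ E, ∃ c : ℚ, y = c • e) : Y.card ≤ E.card := by
  choose! e he c hc using h
  refine Finset.card_le_card_of_injOn e he ?_
  intro x hx y hy hxy
  have hcx : c x ≠ 0 := by
    intro h0
    have := hc x hx
    rw [h0, zero_smul] at this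
    exact hY.1 x hx this
  refine (hY.2 x hx y hy (c y * (c x)⁻¹) ?_).symm
  have h1 : (c x)⁻¹ • x = e x := by
    rw [inv_smul_eq_iff₀ hcx]; exact hc x hx
  rw [mul_smul, h1, hxy]
  exact hc y hy

lemma Simplex.card_directions_of_line {S : Set V} (h : IsModular 3 S) (hS : span ℚ S = ⊤)
    {p : V} (hp : p ≠ 0) {F : Finset V} (hFS : ∀ x ∈ F, ∀ y ∈ F, x - y ∈ S) {k : ℕ}
    {f : Fin (k + 1) → V} (hs : Simplex (span ℚ {p}) F f) {Y : Finset V} (hY : Nonpar Y)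
    (hYF : ∀ y ∈ Y, ∃ f ∈ F, ∃ g ∈ F, ∃ c : ℚ, y = c • (f - g)) :
    2 * (Y.card : ℤ) ≤ finrank ℚ V * (finrank ℚ V - 1) + 6 * (finrank ℚ V - 1) + 2 := by
  classical
  obtain ⟨hk, b, M, c, hM, hM0, hb, -, hx⟩ := hs.line_widths h hS hp hFS
  let E : Finset V := insert p (Finset.univ.biUnion fun i => Finset.univ.biUnion fun j =>
    if i < j then (Finset.Icc (-M j) (M i)).image fun z : ℤ => b i - b j + (c * z) • p else ∅)
  have hEcard : (E.card : ℤ) ≤ (∑ i, ∑ j, (if i < j then M i + M j + 1 else 0)) + 1 := by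
    have h1 : E.card ≤ (∑ i, ∑ j, (if i < j then (M i + M j + 1).toNat else 0)) + 1 := by
      refine (Finset.card_insert_le _ _).trans (Nat.add_le_add_right ?_ 1)
      refine Finset.card_biUnion_le.trans (Finset.sum_le_sum fun i _ => ?_)
      refine Finset.card_biUnion_le.trans (Finset.sum_le_sum fun j _ => ?_)
      split_ifs with hij
      · refine Finset.card_image_le.trans ?_
        rw [Int.card_Icc]
        have := hM0 i
        have := hM0 j
        omega
      · simp
    refine (Int.ofNat_le.2 h1).trans ?_
    push_cast
    refine add_le_add_left (Finset.sum_le_sum fun i _ => Finset.sum_le_sum fun j _ => ?_) 1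
    split_ifs
    · have := hM0 i
      have := hM0 j
      omega
    · simp
  have hYE : Y.card ≤ E.card := by
    refine card_le_of_parallel hY fun y hy => ?_
    obtain ⟨f₁, hf₁, f₂, hf₂, a, rfl⟩ := hYF y hy
    obtain ⟨i, hi⟩ := hs.cover f₁ hf₁
    obtain ⟨j, hj⟩ := hs.cover f₂ hf₂
    obtain ⟨z, hz0, hzM, hz⟩ := hx i f₁ (mem_fiber.2 ⟨hf₁, hi⟩)
    obtain ⟨w, hw0, hwM, hw⟩ := hx j f₂ (mem_fiber.2 ⟨hf₂, hj⟩)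
    rcases lt_trichotomy i j with hij | hij | hij
    · refine ⟨f₁ - f₂, ?_, a, rfl⟩
      refine Finset.mem_insert_of_mem ?_
      simp only [Finset.mem_biUnion, Finset.mem_univ, true_and]
      refine ⟨i, j, ?_⟩
      rw [if_pos hij, Finset.mem_image]
      refine ⟨z - w, Finset.mem_Icc.2 ⟨by linarith, by linarith⟩, ?_⟩
      rw [hz, hw]
      push_cast
      rw [mul_sub, sub_smul]
      abel
    · subst hij
      refine ⟨p, Finset.mem_insert_self _ _, a * (c * z - c * w), ?_⟩
      rw [hz, hw]
      module
    · refine ⟨f₂ - f₁, ?_, -a, by rw [neg_smul, ← smul_neg, neg_sub]⟩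
      refine Finset.mem_insert_of_mem ?_
      simp only [Finset.mem_biUnion, Finset.mem_univ, true_and]
      refine ⟨j, i, ?_⟩
      rw [if_pos hij, Finset.mem_image]
      refine ⟨w - z, Finset.mem_Icc.2 ⟨by linarith, by linarith⟩, ?_⟩
      rw [hz, hw]
      push_cast
      rw [mul_sub, sub_smul]
      abel
  have h2 := sum_pairs_eq M
  have h3 : (Y.card : ℤ) ≤ E.card := by exact_mod_cast hYE
  have hk' : (k : ℤ) + 1 ≤ finrank ℚ V := by exact_mod_cast hk
  push_cast at h2
  have hk0 : (0 : ℤ) ≤ k := by positivity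
  nlinarith

lemma linearIndependent_unit {d : V} (hd : d ≠ 0) : LinearIndependent ℚ (fun _ : Unit => d) := by
  rw [linearIndependent_unique_iff]; exact hd

lemma isModular_one_of_smul {S : Set V} (h : IsModular 3 S) (hS : span ℚ S = ⊤) {d : V}
    (hd : d ≠ 0) (hdS : d ∈ S) {c : ℚ} (hc : c ≠ 0) (hc1 : |c| ≠ 1) (hcd : c • d ∈ S) :
    IsModular 1 ((span ℚ {d}).mkQ '' S) := by
  have hli := linearIndependent_unit hd
  have hr : Set.range (fun _ : Unit => d) = {d} := Set.range_const
  have hcard : Fintype.card Unit + Fintype.card (Fin (finrank ℚ V - 1)) = finrank ℚ V := by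
    have := hli.fintype_card_le_finrank
    simp at this ⊢; omega
  obtain ⟨ω, h0, hω⟩ := h.exists_form (ι := Unit ⊕ Fin (finrank ℚ V - 1)) (by simpa using hcard)
  refine isModular_one_of_ratio h0 hω hcard hS (mkQ_surjective _) (y := fun _ => d)
    (y' := fun _ => c • d) hli (fun _ => hdS) (fun _ => hcd) (by rw [ker_mkQ, hr]) hc hc1 ?_
  intro X _
  rw [← freezeRight_apply, ← freezeRight_apply]
  have := (freezeRight ω X).map_update_smul (fun _ : Unit => d) () c d
  have e1 : update (fun _ : Unit => d) () (c • d) = fun _ => c • d := by ext; simp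
  have e2 : update (fun _ : Unit => d) () d = fun _ => d := by ext; simp
  rwa [e1, e2] at this

lemma map_pair {ω : V [⋀^Fin 2]→ₗ[ℚ] ℚ} {d₁ d₂ : V} {a₁ a₂ b₁ b₂ : ℚ} :
    ω ![a₁ • d₁ + a₂ • d₂, b₁ • d₁ + b₂ • d₂] = (a₁ * b₂ - a₂ * b₁) * ω ![d₁, d₂] := by
  have hadd : ∀ x y z : V, ω ![x, y + z] = ω ![x, y] + ω ![x, z] := by
    intro x y z
    have e : ∀ w, ![x, w] = update ![x, 0] 1 w := by
      intro w; ext i; fin_cases i <;> simp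
    rw [e, e y, e z, AlternatingMap.map_update_add]
  have hsm : ∀ (c : ℚ) (x y : V), ω ![x, c • y] = c * ω ![x, y] := by
    intro c x y
    have e : ∀ w, ![x, w] = update ![x, 0] 1 w := by
      intro w; ext i; fin_cases i <;> simp
    rw [e, e y, AlternatingMap.map_update_smul, smul_eq_mul]
  have hadd' : ∀ x y z : V, ω ![x + y, z] = ω ![x, z] + ω ![y, z] := by
    intro x y z
    have e : ∀ w, ![w, z] = update ![0, z] 0 w := by
      intro w; ext i; fin_cases i <;> simp
    rw [e, e x, e y, AlternatingMap.map_update_add]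
  have hsm' : ∀ (c : ℚ) (x y : V), ω ![c • x, y] = c * ω ![x, y] := by
    intro c x y
    have e : ∀ w, ![w, y] = update ![0, y] 0 w := by
      intro w; ext i; fin_cases i <;> simp
    rw [e, e x, AlternatingMap.map_update_smul, smul_eq_mul]
  have hself : ∀ x : V, ω ![x, x] = 0 := fun x =>
    ω.map_eq_zero_of_eq ![x, x] (i := 0) (j := 1) rfl (by decide)
  have hsw : ω ![d₂, d₁] = - ω ![d₁, d₂] := by
    have := hself (d₁ + d₂)
    rw [hadd, hadd', hadd', hself, hself] at this
    linarith
  rw [hadd, hadd', hadd', hsm, hsm, hsm, hsm, hsm', hsm', hsm', hsm', hself, hself, hsw]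
  ring

lemma isModular_one_of_pair {S : Set V} (h : IsModular 3 S) (hS : span ℚ S = ⊤) {d₁ d₂ : V}
    (hd : LinearIndependent ℚ ![d₁, d₂]) (h₁ : d₁ ∈ S) (h₂ : d₂ ∈ S) {a₁ a₂ b₁ b₂ : ℚ}
    (ha : a₁ • d₁ + a₂ • d₂ ∈ S) (hb : b₁ • d₁ + b₂ • d₂ ∈ S) (h0 : a₁ * b₂ - a₂ * b₁ ≠ 0)
    (h1 : |a₁ * b₂ - a₂ * b₁| ≠ 1) : IsModular 1 ((span ℚ {d₁, d₂}).mkQ '' S) := by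
  have hcard : Fintype.card (Fin 2) + Fintype.card (Fin (finrank ℚ V - 2)) = finrank ℚ V := by
    have := hd.fintype_card_le_finrank
    simp at this ⊢; omega
  obtain ⟨ω, hω0, hω⟩ := h.exists_form (ι := Fin 2 ⊕ Fin (finrank ℚ V - 2)) (by simpa using hcard)
  refine isModular_one_of_ratio hω0 hω hcard hS (mkQ_surjective _) (y := ![d₁, d₂])
    (y' := ![a₁ • d₁ + a₂ • d₂, b₁ • d₁ + b₂ • d₂]) hd ?_ ?_ ?_ h0 h1 ?_
  · intro i; fin_cases i <;> assumption
  · intro i; fin_cases i <;> assumption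
  · rw [ker_mkQ]; simp [Set.pair_comm]
  · intro X _
    exact map_pair (ω := freezeRight ω X)

/-- Twice an integral combination. -/
lemma isModular_one_of_two_smul {S : Set V} (h : IsModular 3 S) (hS : span ℚ S = ⊤) {d₁ d₂ y : V}
    (h₁ : d₁ ∈ S) (h₂ : d₂ ∈ S) (hy : y ≠ 0) (hyS : y ∈ S) {m n : ℤ}
    (hyd : y = (2 : ℚ) • ((m : ℚ) • d₁ + (n : ℚ) • d₂)) :
    IsModular 1 ((span ℚ {y}).mkQ '' S) := by
  have hli := linearIndependent_unit hy
  have hr : Set.range (fun _ : Unit => y) = {y} := Set.range_const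
  have hcard : Fintype.card Unit + Fintype.card (Fin (finrank ℚ V - 1)) = finrank ℚ V := by
    have := hli.fintype_card_le_finrank
    simp at this ⊢; omega
  obtain ⟨ω, h0, hω⟩ := h.exists_form (ι := Unit ⊕ Fin (finrank ℚ V - 1)) (by simpa using hcard)
  refine isModular_quotient_of_scaled h0 hcard hS (mkQ_surjective _) (y := fun _ => y) hli
    (by rw [ker_mkQ, hr]) (c := 2) fun X hX => ?_
  have hS' : ∀ d ∈ S, ∀ i, Sum.elim (fun _ : Unit => d) X i ∈ S := by
    rintro d hd (i | i)
    exacts [hd, hX i]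
  obtain ⟨z₁, hz₁, _⟩ := hω _ (hS' d₁ h₁)
  obtain ⟨z₂, hz₂, _⟩ := hω _ (hS' d₂ h₂)
  obtain ⟨z, hz, hz3⟩ := hω _ (hS' y hyS)
  have e : ω (Sum.elim (fun _ : Unit => y) X) = 2 * (m * z₁ + n * z₂) := by
    have e1 : ∀ w, (fun _ : Unit => w) = update (fun _ : Unit => (0 : V)) () w := by
      intro w; ext; simp
    rw [← freezeRight_apply, e1, hyd, AlternatingMap.map_update_smul, AlternatingMap.map_update_add,
      AlternatingMap.map_update_smul, AlternatingMap.map_update_smul, ← e1, ← e1,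
      freezeRight_apply, freezeRight_apply, hz₁, hz₂]
    simp
  have e2 : z = 2 * (m * z₁ + n * z₂) := by
    rw [hz] at e; exact_mod_cast e
  refine ⟨m * z₁ + n * z₂, by rw [e]; push_cast; ring, ?_⟩
  rw [abs_le] at hz3 ⊢
  omega

/-- The data of an alternating bracket on a plane, with the integrality inherited from a modular
system on sections over a simplex modulo the plane. -/
structure Bracket (K : Submodule ℚ V) (F : Finset V) {k : ℕ} (f : Fin (k + 1) → V)
    (br : V →ₗ[ℚ] V →ₗ[ℚ] ℚ) : Prop where
  self : ∀ u, br u u = 0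
  ne : ∀ u ∈ K, ∀ v ∈ K, LinearIndependent ℚ ![u, v] → br u v ≠ 0
  int : ∀ x ∈ F, ∀ y ∈ F, x - y ∈ K → ∀ g ∈ F, ∀ h ∈ F, g - h ∈ K → ∃ z : ℤ,
    br (x - y) (g - h) = z ∧ |z| ≤ 3
  bound : ∀ t b : Fin (k + 1) → V, (∀ j, t j ∈ fiber K F (f j)) → (∀ j, b j ∈ fiber K F (f j)) →
    ∀ g ∈ F, ∀ h ∈ F, g - h ∈ K → ∑ j, |br (t j - b j) (g - h)| ≤ 3

lemma Simplex.exists_bracket {S : Set V} (h : IsModular 3 S) (hS : span ℚ S = ⊤)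
    {K : Submodule ℚ V} (hK : finrank ℚ K = 2) {F : Finset V}
    (hFS : ∀ x ∈ F, ∀ y ∈ F, x - y ∈ S) {k : ℕ}
    {f : Fin (k + 1) → V} (hs : Simplex K F f) :
    k + 2 ≤ finrank ℚ V ∧ ∃ br : V →ₗ[ℚ] V →ₗ[ℚ] ℚ, Bracket K F f br := by
  obtain ⟨hk, ψ, hψ, hψ'⟩ := hs.exists_form (α := Fin 2) h hS hFS (by simp [hK])
  rw [hK] at hk
  refine ⟨hk, ?_⟩
  have e1 : ∀ x w : V, ![x, w] = update ![x, 0] 1 w := by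
    intro x w; ext i; fin_cases i <;> simp
  have e0 : ∀ x w : V, ![w, x] = update ![0, x] 0 w := by
    intro x w; ext i; fin_cases i <;> simp
  let br : V →ₗ[ℚ] V →ₗ[ℚ] ℚ := LinearMap.mk₂ ℚ (fun u v => ψ ![u, v])
    (fun x y z => by rw [e0, e0 z x, e0 z y, AlternatingMap.map_update_add])
    (fun c x y => by rw [e0, e0 y x, AlternatingMap.map_update_smul])
    (fun x y z => by rw [e1, e1 x y, e1 x z, AlternatingMap.map_update_add])
    (fun c x y => by rw [e1, e1 x y, AlternatingMap.map_update_smul])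
  have hbr : ∀ u v, br u v = ψ ![u, v] := fun u v => rfl
  have key : ∀ g ∈ F, ∀ h ∈ F, g - h ∈ K → _ := fun g hg h hh hgh =>
    section_bound (φ := br.flip (g - h)) (G := fun j => fiber K F (f j)) (f := f)
      (fun t b ht hb => by
        obtain ⟨z, hz⟩ := hψ' t b (fun j => mem_fiber.1 (ht j)) (fun j => mem_fiber.1 (hb j))
          ![0, g - h] 0 (fun i hi => by
            fin_cases i
            · exact absurd rfl hi
            · exact ⟨hFS _ hg _ hh, hgh⟩)
        rw [← e0] at hz
        exact ⟨z, hz⟩) hs.mem_fiber_self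
  refine ⟨br, fun u => ?_, fun u hu v hv huv => ?_, fun x hx y hy hxy g hg h hh hgh => ?_,
    fun t b ht hb g hg h hh hgh => ?_⟩
  · exact ψ.map_eq_zero_of_eq ![u, u] (i := 0) (j := 1) rfl (by decide)
  · exact hψ _ (fun i => by fin_cases i <;> assumption) huv
  · obtain ⟨j, hj⟩ := hs.cover x hx
    refine (key g hg h hh hgh).1 j x (mem_fiber.2 ⟨hx, hj⟩) y (mem_fiber.2 ⟨hy, ?_⟩)
    have := K.sub_mem hj hxy
    simpa using this
  · exact (key g hg h hh hgh).2 t b ht hb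

lemma bracket_pluecker {br : V →ₗ[ℚ] V →ₗ[ℚ] ℚ} (hs : ∀ u, br u u = 0) {K : Submodule ℚ V}
    {d₁ d₂ : V} (hK : K = span ℚ {d₁, d₂}) {u v w x : V} (hu : u ∈ K) (hv : v ∈ K) (hw : w ∈ K)
    (hx : x ∈ K) : br u v * br w x - br u w * br v x + br u x * br v w = 0 := by
  have hsw : br d₂ d₁ = - br d₁ d₂ := by
    have := hs (d₁ + d₂)
    simp only [map_add, LinearMap.add_apply, hs] at this
    linarith
  subst hK
  rw [mem_span_pair] at hu hv hw hx
  obtain ⟨a, b, rfl⟩ := hu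
  obtain ⟨a', b', rfl⟩ := hv
  obtain ⟨a'', b'', rfl⟩ := hw
  obtain ⟨a₃, b₃, rfl⟩ := hx
  simp only [map_add, map_smul, LinearMap.add_apply, LinearMap.smul_apply, smul_eq_mul, hs, hsw]
  ring

/-- Integer brackets of differences within a family of blocks of points. -/
structure Config {J : Type*} (G : J → Finset V) (b : V → V → V → V → ℤ) : Prop where
  ne : ∀ i j, ∀ x ∈ G i, ∀ y ∈ G i, ∀ g ∈ G j, ∀ h ∈ G j, x ≠ y → g ≠ h →
    ¬ (x = g ∧ y = h) → ¬ (x = h ∧ y = g) → b x y g h ≠ 0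
  sum : ∀ (m : ℕ) (e : Fin m → J), Injective e → ∀ x y : Fin m → V, (∀ i, x i ∈ G (e i)) →
    (∀ i, y i ∈ G (e i)) → ∀ j, ∀ g ∈ G j, ∀ h ∈ G j, ∑ i, |b (x i) (y i) g h| ≤ 3
  symm : ∀ i j, ∀ x ∈ G i, ∀ y ∈ G i, ∀ g ∈ G j, ∀ h ∈ G j, b x y g h = - b g h x y
  add : ∀ i j, ∀ x ∈ G i, ∀ y ∈ G i, ∀ z ∈ G i, ∀ g ∈ G j, ∀ h ∈ G j,
    b x z g h = b x y g h + b y z g h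
  self : ∀ i, ∀ x ∈ G i, ∀ y ∈ G i, b x y x y = 0
  pluecker : ∀ i j k l, ∀ x ∈ G i, ∀ x' ∈ G i, ∀ y ∈ G j, ∀ y' ∈ G j, ∀ z ∈ G k, ∀ z' ∈ G k,
    ∀ w ∈ G l, ∀ w' ∈ G l,
    b x x' y y' * b z z' w w' - b x x' z z' * b y y' w w' + b x x' w w' * b y y' z z' = 0

namespace Config

variable {J : Type*} {G : J → Finset V} {b : V → V → V → V → ℤ}

lemma add' (H : Config G b) {i j : J} {x g g' h : V} {y : V} (hx : x ∈ G i) (hy : y ∈ G i)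
    (hg : g ∈ G j) (hg' : g' ∈ G j) (hh : h ∈ G j) : b x y g h = b x y g g' + b x y g' h := by
  rw [H.symm i j x hx y hy g hg h hh, H.symm i j x hx y hy g hg g' hg',
    H.symm i j x hx y hy g' hg' h hh, H.add j i g hg g' hg' h hh x hx y hy]
  ring

lemma le_one (H : Config G b) {i j : J} {x y g h : V} (hx : x ∈ G i) (hy : y ∈ G i)
    (hg : g ∈ G j) (hh : h ∈ G j) : |b x y g h| ≤ 3 := by
  have := H.sum 1 (fun _ => i) (injective_of_subsingleton _) (fun _ => x) (fun _ => y)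
    (fun _ => hx) (fun _ => hy) j g hg h hh
  simpa using this

lemma le_two (H : Config G b) {i i' j : J} (hi : i ≠ i') {x y x' y' g h : V} (hx : x ∈ G i)
    (hy : y ∈ G i) (hx' : x' ∈ G i') (hy' : y' ∈ G i') (hg : g ∈ G j) (hh : h ∈ G j) :
    |b x y g h| + |b x' y' g h| ≤ 3 := by
  have := H.sum 2 ![i, i'] (by
      intro a b; fin_cases a <;> fin_cases b <;> simp [hi, hi.symm]) ![x, x'] ![y, y']
    (fun a => by fin_cases a <;> assumption) (fun a => by fin_cases a <;> assumption) j g hg h hh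
  simpa [Fin.sum_univ_two] using this

lemma le_three (H : Config G b) {i i' i'' j : J} (hi : i ≠ i') (hi' : i ≠ i'') (hi'' : i' ≠ i'')
    {x y x' y' x'' y'' g h : V} (hx : x ∈ G i)
    (hy : y ∈ G i) (hx' : x' ∈ G i') (hy' : y' ∈ G i') (hx'' : x'' ∈ G i'') (hy'' : y'' ∈ G i'')
    (hg : g ∈ G j) (hh : h ∈ G j) :
    |b x y g h| + |b x' y' g h| + |b x'' y'' g h| ≤ 3 := by
  have := H.sum 3 ![i, i', i''] (by
      intro a b; fin_cases a <;> fin_cases b <;> simp [hi, hi.symm, hi', hi'.symm, hi'', hi''.symm])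
    ![x, x', x''] ![y, y', y'']
    (fun a => by fin_cases a <;> assumption) (fun a => by fin_cases a <;> assumption) j g hg h hh
  simpa [Fin.sum_univ_three] using this

lemma card_le_four (H : Config G b) (i : J) : (G i).card ≤ 4 := by
  classical
  by_contra hc
  obtain ⟨g, hg, h, hh, hgh⟩ := Finset.one_lt_card.1 (show 1 < (G i).card by omega)
  have hcard : ∀ x ∈ G i, 4 ≤ ((G i).erase x).card := fun x hx => by
    rw [Finset.card_erase_of_mem hx]; omega
  have hinj : ∀ g ∈ G i, ∀ h ∈ G i, g ≠ h → ∀ x ∈ (G i).erase h, ∀ y ∈ (G i).erase h,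
      b x g g h = b y g g h → x = y := by
    intro g hg h hh hgh x hx y hy hxy
    by_contra hne
    rw [Finset.mem_erase] at hx hy
    refine H.ne i i x hx.2 y hy.2 g hg h hh hne hgh (fun h => hy.1 h.2) (fun h => hx.1 h.1) ?_
    have e1 := H.add i i x hx.2 y hy.2 g hg g hg h hh
    omega
  have hw : ∀ g ∈ G i, ∀ h ∈ G i, ∀ x ∈ G i, ∀ y ∈ G i, b x g g h - b y g g h ≤ 3 := by
    intro g hg h hh x hx y hy
    have e1 := H.add i i x hx y hy g hg g hg h hh
    have := (abs_le.1 (H.le_one hx hy hg hh)).2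
    omega
  have hself : ∀ x ∈ G i, b x x x x = 0 := fun x hx => H.self i x hx x hx
  have h0 : b g g g h = 0 := by
    have := H.add i i g hg g hg g hg g hg h hh
    omega
  obtain ⟨x, hx, hx1⟩ : ∃ x ∈ G i, b x g g h = 1 ∨ b x g g h = -1 := by
    by_contra hno
    push Not at hno
    let w : V → ℤ := fun x => if 2 ≤ b x g g h then b x g g h - 1 else
      if b x g g h ≤ -2 then b x g g h + 1 else b x g g h
    have hcl := card_le_of_diam (T := (G i).erase h) (z := w) (D := 2) (by
      intro x hx y hy hxy
      refine hinj g hg h hh hgh x hx y hy ?_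
      have h1 := hno x (Finset.mem_of_mem_erase hx)
      have h2 := hno y (Finset.mem_of_mem_erase hy)
      simp only [w] at hxy
      split_ifs at hxy <;> omega) (by norm_num) (by
      intro x hx y hy
      have h1 := hno x (Finset.mem_of_mem_erase hx)
      have h2 := hno y (Finset.mem_of_mem_erase hy)
      have h3 := hw g hg h hh x (Finset.mem_of_mem_erase hx) y (Finset.mem_of_mem_erase hy)
      have h4 := hw g hg h hh x (Finset.mem_of_mem_erase hx) g hg
      have h5 := hw g hg h hh g hg y (Finset.mem_of_mem_erase hy)
      simp only [w]
      split_ifs <;> omega)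
    have := hcard h hh
    omega
  obtain ⟨x₁, hx₁, x₂, hx₂, hne, heq⟩ := Finset.exists_ne_map_eq_of_card_lt_of_maps_to
    (s := G i) (t := (Finset.univ : Finset (ZMod 2 × ZMod 2)))
    (f := fun u => ((b u g g h : ZMod 2), (b u g x g : ZMod 2)))
    (by simp; omega) (fun _ _ => Finset.mem_univ _)
  simp only [Prod.mk.injEq] at heq
  rw [ZMod.intCast_eq_intCast_iff, ZMod.intCast_eq_intCast_iff] at heq
  have ev1 : (2 : ℤ) ∣ b x₁ x₂ g h := by
    have := H.add i i x₁ hx₁ x₂ hx₂ g hg g hg h hh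
    have := heq.1.symm.dvd
    push_cast at this
    omega
  have ev2 : (2 : ℤ) ∣ b x₁ x₂ x g := by
    have := H.add i i x₁ hx₁ x₂ hx₂ g hg x hx g hg
    have := heq.2.symm.dvd
    push_cast at this
    omega
  have ev : ∀ p ∈ G i, ∀ q ∈ G i, (2 : ℤ) ∣ b x₁ x₂ p q := by
    intro p hp q hq
    have := H.pluecker i i i i x₁ hx₁ x₂ hx₂ p hp q hq x hx g hg g hg h hh
    obtain ⟨a, ha⟩ := ev1
    obtain ⟨a', ha'⟩ := ev2
    rw [ha, ha'] at this
    rcases hx1 with h1 | h1 <;> rw [h1] at this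
    · exact ⟨a' * b p q g h - a * b p q x g, by linarith⟩
    · exact ⟨-(a' * b p q g h - a * b p q x g), by linarith⟩
  have ev' : ∀ u ∈ G i, ∃ z, b u x₁ x₁ x₂ = 2 * z := by
    intro u hu
    obtain ⟨z, hz⟩ := ev u hu x₁ hx₁
    exact ⟨-z, by rw [H.symm i i u hu x₁ hx₁ x₁ hx₁ x₂ hx₂, hz]; ring⟩
  have hcl := card_le_of_diam (T := (G i).erase x₂) (z := fun u => b u x₁ x₁ x₂ / 2) (D := 1) (by
    intro x hx y hy hxy
    refine hinj x₁ hx₁ x₂ hx₂ hne x hx y hy ?_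
    obtain ⟨z, hz⟩ := ev' x (Finset.mem_of_mem_erase hx)
    obtain ⟨z', hz'⟩ := ev' y (Finset.mem_of_mem_erase hy)
    simp only at hxy
    omega) (by norm_num) (by
    intro x hx y hy
    have h3 := hw x₁ hx₁ x₂ hx₂ x (Finset.mem_of_mem_erase hx) y (Finset.mem_of_mem_erase hy)
    obtain ⟨z, hz⟩ := ev' x (Finset.mem_of_mem_erase hx)
    obtain ⟨z', hz'⟩ := ev' y (Finset.mem_of_mem_erase hy)
    omega)
  have := hcard x₂ hx₂
  omega

lemma disjoint_ne (H : Config G b) (hd : ∀ i j x, x ∈ G i → x ∈ G j → i = j) {i j : J}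
    (hij : i ≠ j) {x y g h : V} (hx : x ∈ G i) (hy : y ∈ G i)
    (hg : g ∈ G j) (hh : h ∈ G j) (hxy : x ≠ y) (hgh : g ≠ h) : b x y g h ≠ 0 :=
  H.ne i j x hx y hy g hg h hh hxy hgh (fun e => hij (hd i j g (e.1 ▸ hx) hg))
    (fun e => hij (hd i j h (e.1 ▸ hx) hh))

lemma not_four_two (H : Config G b) (hd : ∀ i j x, x ∈ G i → x ∈ G j → i = j) {i j : J}
    (hij : i ≠ j) (hi : 4 ≤ (G i).card) (hj : 2 ≤ (G j).card) : False := by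
  classical
  obtain ⟨p, hp, q, hq, hpq⟩ := Finset.one_lt_card.1 (show 1 < (G j).card by omega)
  obtain ⟨g₀, hg₀⟩ := Finset.card_pos.1 (show 0 < (G i).card by omega)
  obtain ⟨g, hg, h, hh, hgh⟩ : ∃ g ∈ G i, ∃ h ∈ G i, 3 ≤ b g h p q := by
    by_contra hno
    push Not at hno
    have := card_le_of_diam (T := G i) (z := fun x => b x g₀ p q) (D := 2) (by
      intro x hx y hy hxy
      by_contra hne
      refine H.disjoint_ne hd hij hx hy hp hq hne hpq ?_
      have e1 := H.add i j x hx y hy g₀ hg₀ p hp q hq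
      simp only at hxy
      omega) (by norm_num) (by
      intro x hx y hy
      have e1 := H.add i j x hx y hy g₀ hg₀ p hp q hq
      have := hno x hx y hy
      omega)
    omega
  have hne : g ≠ h := by
    rintro rfl
    have e1 := H.add i j g hg g hg g hg p hp q hq
    omega
  obtain ⟨x, hx⟩ := Finset.card_pos.1 (show 0 < (((G i).erase g).erase h).card by
    rw [Finset.card_erase_of_mem (Finset.mem_erase.2 ⟨hne.symm, hh⟩), Finset.card_erase_of_mem hg]
    omega)
  simp only [Finset.mem_erase] at hx
  have h1 := H.le_two hij.symm hp hq hg hx.2.2 hg hh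
  have h2 := H.symm i j g hg h hh p hp q hq
  have h3 : 3 ≤ |b p q g h| := by rw [← abs_neg, ← h2]; exact hgh.trans (le_abs_self _)
  have h4 := H.ne i i g hg x hx.2.2 g hg h hh (Ne.symm hx.2.1) hne (fun e => hx.1 e.2)
    (fun e => hne e.1)
  have := abs_pos.2 h4
  omega

lemma exists_three {s : Finset V} (h : 3 ≤ s.card) :
    ∃ x ∈ s, ∃ y ∈ s, ∃ z ∈ s, x ≠ y ∧ x ≠ z ∧ y ≠ z := by
  classical
  obtain ⟨x, y, z, hx, hy, hz, h⟩ := Finset.two_lt_card_iff.1 (show 2 < s.card by omega)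
  exact ⟨x, hx, y, hy, z, hz, h⟩

lemma row_mod_three {x y z D : ℤ} (h : z = x + y) (hx : x ≠ 0) (hy : y ≠ 0) (hz : z ≠ 0)
    (hD : D ≠ 0) (h1 : |x| + |D| ≤ 3) (h2 : |y| + |D| ≤ 3) (h3 : |z| + |D| ≤ 3) :
    (∃ k, z = 2 * x + 3 * k) ∧ |D| = 1 := by
  have hD := abs_pos.2 hD
  have h1 := abs_le.1 (show |x| ≤ 3 - |D| by omega)
  have h2 := abs_le.1 (show |y| ≤ 3 - |D| by omega)
  have h3 := abs_le.1 (show |z| ≤ 3 - |D| by omega)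
  have hx2 : -2 ≤ x ∧ x ≤ 2 := by omega
  have hy2 : -2 ≤ y ∧ y ≤ 2 := by omega
  obtain ⟨hx3, hx4⟩ := hx2
  obtain ⟨hy3, hy4⟩ := hy2
  refine ⟨⟨(z - 2 * x) / 3, ?_⟩, ?_⟩ <;> interval_cases x <;> interval_cases y <;> omega

lemma not_three_three (H : Config G b) (hd : ∀ i j x, x ∈ G i → x ∈ G j → i = j) {i j : J}
    (hij : i ≠ j) (hi : 3 ≤ (G i).card) (hj : 3 ≤ (G j).card) : False := by
  obtain ⟨p, hp, q, hq, r, hr, hpq, hpr, hqr⟩ := exists_three hi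
  obtain ⟨s, hs, t, ht, u, hu, hst, hsu, htu⟩ := exists_three hj
  have bound : ∀ i j, i ≠ j → ∀ p ∈ G i, ∀ q ∈ G i, ∀ r ∈ G i, ∀ s ∈ G j, ∀ t ∈ G j, p ≠ q →
      p ≠ r → q ≠ r → |b s t p q| + |b p r p q| ≤ 3 ∧ b p r p q ≠ 0 := by
    intro i j hij p hp q hq r hr s hs t ht hpq hpr hqr
    have h3 := H.le_two hij hp hr hs ht hp hq
    exact ⟨by omega, H.ne i i p hp r hr p hp q hq hpr hpq (fun e => hqr e.2.symm)
      (fun e => hpq e.1)⟩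
  have b1 := bound i j hij p hp q hq r hr s hs t ht hpq hpr hqr
  have b2 := bound i j hij p hp q hq r hr t ht u hu hpq hpr hqr
  have b3 := bound i j hij p hp q hq r hr s hs u hu hpq hpr hqr
  have c1 := bound j i hij.symm s hs t ht u hu p hp q hq hst hsu htu
  have c2 := bound j i hij.symm s hs u hu t ht p hp q hq hsu hst htu.symm
  have c3 := bound j i hij.symm t ht u hu s hs p hp q hq htu hst.symm hsu.symm
  have d1 := bound j i hij.symm s hs t ht u hu p hp r hr hst hsu htu
  have d2 := bound j i hij.symm s hs u hu t ht p hp r hr hsu hst htu.symm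
  have d3 := bound j i hij.symm t ht u hu s hs p hp r hr htu hst.symm hsu.symm
  have n1 := H.disjoint_ne hd hij hp hq hs ht hpq hst
  have n2 := H.disjoint_ne hd hij hp hq ht hu hpq htu
  have n3 := H.disjoint_ne hd hij hp hq hs hu hpq hsu
  have n4 := H.disjoint_ne hd hij hp hr hs ht hpr hst
  have n5 := H.disjoint_ne hd hij hp hr ht hu hpr htu
  have n6 := H.disjoint_ne hd hij hp hr hs hu hpr hsu
  have s1 := H.symm i j p hp q hq s hs t ht
  have s2 := H.symm i j p hp q hq s hs u hu
  have s3 := H.symm i j p hp q hq t ht u hu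
  have s4 := H.symm i i p hp q hq p hp r hr
  have s5 := H.symm j j s hs t ht s hs u hu
  have a1 := H.add' hp hq hs ht hu
  have a2 := H.add' hp hr hs ht hu
  have a3 := H.add j j t ht s hs u hu t ht u hu
  have a4 := H.add j j t ht u hu t ht t ht u hu
  have a5 := H.add j j t ht t ht t ht t ht u hu
  have a6 := H.add' (y := s) ht hs ht hs hu
  have a7 := H.self j t ht s hs
  have a8 := H.add j j t ht s hs t ht s hs u hu
  have a9 := H.add j j s hs s hs s hs s hs u hu
  have a10 := H.add j j s hs t ht s hs s hs u hu
  have pl := H.pluecker i i j j p hp q hq p hp r hr s hs t ht s hs u hu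
  have t1 : b t s t u = - b s t s u := by omega
  rw [t1] at c3 d3
  rw [s4] at pl
  rw [s5] at pl c2 d2 c3 d3
  rw [s1] at n1 a1 pl c1
  rw [s2] at n3 a1 pl c2
  rw [s3] at n2 a1 c3
  clear a3 a4 a5 a6 a7 a8 a9 a10 s1 s2 s3 s4 s5 t1 bound
  simp only [abs_neg, ne_eq, neg_eq_zero, neg_neg] at b1 b2 b3 c1 c2 c3 d1 d2 d3 n1 n2 n3 n4 n5 n6
  generalize b s t p q = x₁ at *
  generalize b s u p q = x₂ at *
  generalize b t u p q = x₃ at *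
  generalize b p r s t = y₁ at *
  generalize b p r s u = y₂ at *
  generalize b p r t u = y₃ at *
  generalize b s u s t = E at *
  generalize b p r p q = D at *
  have hx := row_mod_three (x := x₁) (y := x₃) (z := x₂) (D := D) (by linarith) n1 n2 n3 b1.2 b1.1
    b2.1 b3.1
  have hE := row_mod_three (x := x₁) (y := x₃) (z := x₂) (D := E) (by linarith) n1 n2 n3 c1.2 c1.1
    c3.1 c2.1
  have hy := row_mod_three (x := y₁) (y := y₃) (z := y₂) (D := E) (by linarith) n4 n5 n6 d1.2 d1.1
    d3.1 d2.1
  obtain ⟨⟨k, rfl⟩, hD⟩ := hx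
  obtain ⟨⟨k', rfl⟩, -⟩ := hy
  have h3 : D * E = 3 * (k * y₁ - k' * x₁) ∨ D * E = - (3 * (k * y₁ - k' * x₁)) := by
    left; linarith
  have h4 : |D * E| = 1 := by rw [abs_mul, hD, hE.2]; rfl
  rw [abs_eq (by norm_num)] at h4
  omega

lemma not_three_two_two (H : Config G b) (hd : ∀ i j x, x ∈ G i → x ∈ G j → i = j) {i j l : J}
    (hij : i ≠ j) (hil : i ≠ l) (hjl : j ≠ l) (hi : 3 ≤ (G i).card) (hj : 2 ≤ (G j).card)
    (hl : 2 ≤ (G l).card) : False := by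
  obtain ⟨p, hp, q, hq, r, hr, hpq, hpr, hqr⟩ := exists_three hi
  obtain ⟨s, hs, t, ht, hst⟩ := Finset.one_lt_card.1 (show 1 < (G j).card by omega)
  obtain ⟨u, hu, v, hv, huv⟩ := Finset.one_lt_card.1 (show 1 < (G l).card by omega)
  have key : ∀ p ∈ G i, ∀ q ∈ G i, ∀ r ∈ G i, p ≠ q → p ≠ r → q ≠ r → |b s t p q| = 1 := by
    intro p hp q hq r hr hpq hpr hqr
    have h1 := H.le_three hij hil hjl hp hr hs ht hu hv hp hq
    have h2 := abs_pos.2 (H.ne i i p hp r hr p hp q hq hpr hpq (fun e => hqr e.2.symm)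
      (fun e => hpq e.1))
    have h3 := abs_pos.2 (H.disjoint_ne hd hij.symm hs ht hp hq hst hpq)
    have h4 := abs_pos.2 (H.disjoint_ne hd hil.symm hu hv hp hq huv hpq)
    omega
  have k1 := key p hp q hq r hr hpq hpr hqr
  have k2 := key p hp r hr q hq hpr hpq hqr.symm
  have k3 := key q hq r hr p hp hqr hpq.symm hpr.symm
  have a := H.add' hs ht hp hq hr
  rw [abs_eq (by norm_num)] at k1 k2 k3
  omega

lemma not_two_two_two_two (H : Config G b) (hd : ∀ i j x, x ∈ G i → x ∈ G j → i = j)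
    {i : Fin 4 → J} (hi : Injective i) (hc : ∀ a, 2 ≤ (G (i a)).card) : False := by
  have : ∀ a, ∃ x y, x ∈ G (i a) ∧ y ∈ G (i a) ∧ x ≠ y := fun a => by
    obtain ⟨x, hx, y, hy, h⟩ := Finset.one_lt_card.1 (show 1 < (G (i a)).card from hc a)
    exact ⟨x, y, hx, hy, h⟩
  choose x y hx hy hxy using this
  have key : ∀ a c, a ≠ c → |b (x a) (y a) (x c) (y c)| = 1 := by
    intro a c hac
    have h1 := H.sum 4 i hi x y hx hy (i c) (x c) (hx c) (y c) (hy c)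
    have h2 : ∀ a', a' ≠ c → 1 ≤ |b (x a') (y a') (x c) (y c)| := fun a' ha' =>
      Int.one_le_abs (H.disjoint_ne hd (fun e => ha' (hi e)) (hx _) (hy _) (hx _) (hy _)
        (hxy _) (hxy _))
    rw [← Finset.add_sum_erase _ _ (Finset.mem_univ c), H.self (i c) _ (hx c) _ (hy c),
      ← Finset.add_sum_erase _ _ (Finset.mem_erase.2 ⟨hac, Finset.mem_univ a⟩)] at h1
    have h3 := Finset.card_nsmul_le_sum ((Finset.univ.erase c).erase a)
      (fun a' => |b (x a') (y a') (x c) (y c)|) 1 (fun a' ha' => h2 a' (by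
        simp only [Finset.mem_erase] at ha'; exact ha'.2.1))
    rw [Finset.card_erase_of_mem (Finset.mem_erase.2 ⟨hac, Finset.mem_univ a⟩),
      Finset.card_erase_of_mem (Finset.mem_univ c)] at h3
    simp at h3 h1
    have := h2 a hac
    omega
  have pl := H.pluecker (i 0) (i 1) (i 2) (i 3) _ (hx 0) _ (hy 0) _ (hx 1) _ (hy 1) _ (hx 2) _
    (hy 2) _ (hx 3) _ (hy 3)
  have k : ∀ a c, a ≠ c → b (x a) (y a) (x c) (y c) = 1 ∨ b (x a) (y a) (x c) (y c) = -1 :=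
    fun a c h => (abs_eq (by norm_num)).1 (key a c h)
  rcases k 0 1 (by decide) with h1 | h1 <;> rcases k 2 3 (by decide) with h2 | h2 <;>
  rcases k 0 2 (by decide) with h3 | h3 <;> rcases k 1 3 (by decide) with h4 | h4 <;>
  rcases k 0 3 (by decide) with h5 | h5 <;> rcases k 1 2 (by decide) with h6 | h6 <;>
  rw [h1, h2, h3, h4, h5, h6] at pl <;> omega

end Config

lemma Config.sum_card_le {J : Type*} [Fintype J] {G : J → Finset V} {b : V → V → V → V → ℤ}
    (H : Config G b) (hd : ∀ i j x, x ∈ G i → x ∈ G j → i = j) :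
    ∑ j, (G j).card ≤ Fintype.card J + 3 := by
  classical
  suffices h : ∑ j, ((G j).card - 1) ≤ 3 by
    calc ∑ j, (G j).card ≤ ∑ j, (((G j).card - 1) + 1) := Finset.sum_le_sum fun j _ => by omega
      _ = ∑ j, ((G j).card - 1) + Fintype.card J := by rw [Finset.sum_add_distrib]; simp
      _ ≤ _ := by omega
  have h4 := H.card_le_four
  by_cases c4 : ∃ i, 4 ≤ (G i).card
  · obtain ⟨i, hi⟩ := c4
    rw [Finset.sum_eq_single i]
    · have := h4 i; omega
    · intro j _ hj
      by_contra hc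
      exact H.not_four_two hd hj.symm hi (by omega)
    · simp
  push Not at c4
  by_cases c3 : ∃ i, 3 ≤ (G i).card
  · obtain ⟨i, hi⟩ := c3
    have h2 : ∀ j, j ≠ i → (G j).card ≤ 2 := fun j hj => by
      by_contra hc
      exact H.not_three_three hd hj.symm hi (by omega)
    by_cases c2 : ∃ j, j ≠ i ∧ 2 ≤ (G j).card
    · obtain ⟨j, hj, hj2⟩ := c2
      rw [Finset.sum_eq_add i j hj.symm]
      · have := c4 i
        have := h2 j hj
        omega
      · intro l _ hl
        by_contra hc
        exact H.not_three_two_two hd hj.symm hl.1.symm hl.2.symm hi hj2 (by omega)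
      · simp
      · simp
    · push Not at c2
      rw [Finset.sum_eq_single i]
      · have := c4 i; omega
      · intro j _ hj
        have := c2 j hj
        omega
      · simp
  push Not at c3
  by_contra hc
  have : ∑ j, ((G j).card - 1) ≤ (Finset.univ.filter fun j => 2 ≤ (G j).card).card := by
    rw [Finset.card_filter]
    refine Finset.sum_le_sum fun j _ => ?_
    have := c3 j
    split_ifs <;> omega
  obtain ⟨T, hT, hTc⟩ := Finset.exists_subset_card_eq (show 4 ≤ (Finset.univ.filter fun j => 2 ≤ (G j).card).card by omega)
  let e := T.equivFinOfCardEq hTc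
  refine H.not_two_two_two_two hd (i := fun a => (e.symm a : J))
    (Subtype.val_injective.comp e.symm.injective) fun a => ?_
  exact (Finset.mem_filter.1 (hT (e.symm a).2)).2

lemma Bracket.sum_le {K : Submodule ℚ V} {F : Finset V} {k : ℕ} {f : Fin (k + 1) → V}
    (hs : Simplex K F f) {br : V →ₗ[ℚ] V →ₗ[ℚ] ℚ} (hb : Bracket K F f br) {m : ℕ}
    {e : Fin m → Fin (k + 1)} (he : Injective e) {x y : Fin m → V}
    (hx : ∀ i, x i ∈ fiber K F (f (e i))) (hy : ∀ i, y i ∈ fiber K F (f (e i))) {g h : V}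
    (hg : g ∈ F) (hh : h ∈ F) (hgh : g - h ∈ K) : ∑ i, |br (x i - y i) (g - h)| ≤ 3 := by
  have := hb.bound (extend e x f) (extend e y f) (fun j => by
      by_cases hj : ∃ a, e a = j
      · obtain ⟨a, rfl⟩ := hj; rw [he.extend_apply]; exact hx a
      · rw [extend_apply' _ _ _ hj]; exact hs.mem_fiber_self j) (fun j => by
      by_cases hj : ∃ a, e a = j
      · obtain ⟨a, rfl⟩ := hj; rw [he.extend_apply]; exact hy a
      · rw [extend_apply' _ _ _ hj]; exact hs.mem_fiber_self j) g hg h hh hgh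
  have h2 := Finset.sum_le_sum_of_subset_of_nonneg (Finset.subset_univ
    (Finset.univ.map ⟨e, he⟩)) (f := fun j => |br (extend e x f j - extend e y f j) (g - h)|)
    (fun _ _ _ => abs_nonneg _)
  rw [Finset.sum_map] at h2
  simp only [Embedding.coeFn_mk, he.extend_apply] at h2
  exact h2.trans this

lemma Bracket.card_le {K : Submodule ℚ V} {F : Finset V} {k : ℕ} {f : Fin (k + 1) → V}
    (hs : Simplex K F f) {br : V →ₗ[ℚ] V →ₗ[ℚ] ℚ} (hb : Bracket K F f br) {d₁ d₂ : V}
    (hK : K = span ℚ {d₁, d₂})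
    (hli : ∀ x ∈ F, ∀ y ∈ F, ∀ g ∈ F, ∀ h ∈ F, x ≠ y → g ≠ h → ¬ (x = g ∧ y = h) →
      ¬ (x = h ∧ y = g) → LinearIndependent ℚ ![x - y, g - h]) : F.card ≤ k + 4 := by
  rw [hs.card_eq]
  let G : Fin (k + 1) → Finset V := fun j => fiber K F (f j)
  let b : V → V → V → V → ℤ := fun x y g h => ⌊br (x - y) (g - h)⌋
  have hmem : ∀ {i x}, x ∈ G i → x ∈ F := fun hx => (mem_fiber.1 hx).1
  have hsub : ∀ {i x y}, x ∈ G i → y ∈ G i → x - y ∈ K := fun {i x y} hx hy => by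
    have := K.sub_mem (mem_fiber.1 hx).2 (mem_fiber.1 hy).2
    simpa using this
  have cast : ∀ {i j x y g h}, x ∈ G i → y ∈ G i → g ∈ G j → h ∈ G j →
      (b x y g h : ℚ) = br (x - y) (g - h) := fun {i j x y g h} hx hy hg hh => by
    obtain ⟨z, hz, _⟩ := hb.int x (hmem hx) y (hmem hy) (hsub hx hy) g (hmem hg) h (hmem hh)
      (hsub hg hh)
    simp only [b]
    rw [hz, Int.floor_intCast]
  have hanti : ∀ u v, br u v = - br v u := fun u v => by
    have := hb.self (u + v)
    simp only [map_add, LinearMap.add_apply, hb.self] at this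
    linarith
  have H : Config G b :=
    { ne := fun i j x hx y hy g hg h hh hxy hgh h1 h2 e => by
        have e' : br (x - y) (g - h) = 0 := by rw [← cast hx hy hg hh, e]; simp
        exact hb.ne _ (hsub hx hy) _ (hsub hg hh) (hli x (hmem hx) y (hmem hy) g (hmem hg) h
          (hmem hh) hxy hgh h1 h2) e'
      sum := fun m e he x y hx hy j g hg h hh => by
        have h2 := hb.sum_le hs he hx hy (hmem hg) (hmem hh) (hsub hg hh)
        have h3 : ((∑ i, |b (x i) (y i) g h| : ℤ) : ℚ) ≤ 3 := by
          push_cast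
          refine le_trans (le_of_eq (Finset.sum_congr rfl fun i _ => ?_)) h2
          rw [cast (hx i) (hy i) hg hh]
        exact_mod_cast h3
      symm := fun i j x hx y hy g hg h hh => by
        have : (b x y g h : ℚ) = - b g h x y := by
          rw [cast hx hy hg hh, cast hg hh hx hy, hanti]
        exact_mod_cast this
      add := fun i j x hx y hy z hz g hg h hh => by
        have : (b x z g h : ℚ) = b x y g h + b y z g h := by
          rw [cast hx hy hg hh, cast hx hz hg hh, cast hy hz hg hh, ← LinearMap.add_apply,
            ← map_add, sub_add_sub_cancel]
        exact_mod_cast this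
      self := fun i x hx y hy => by
        have : (b x y x y : ℚ) = 0 := by rw [cast hx hy hx hy, hb.self]
        exact_mod_cast this
      pluecker := fun i j k l x hx x' hx' y hy y' hy' z hz z' hz' w hw w' hw' => by
        have := bracket_pluecker hb.self hK (hsub hx hx') (hsub hy hy') (hsub hz hz') (hsub hw hw')
        rw [← cast hx hx' hy hy', ← cast hx hx' hz hz', ← cast hx hx' hw hw', ← cast hy hy' hz hz',
          ← cast hy hy' hw hw', ← cast hz hz' hw hw'] at this
        exact_mod_cast this }
  have := H.sum_card_le (fun i j x hi hj => hs.eq_of_sub_mem (by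
    have := K.sub_mem (mem_fiber.1 hj).2 (mem_fiber.1 hi).2
    simpa using this))
  rw [Fintype.card_fin] at this
  omega

/-- A direction collapsing the system onto a simplex. -/
def HasDirection (F : Finset V) : Prop :=
  ∃ p : V, p ≠ 0 ∧ (∃ f ∈ F, ∃ g ∈ F, p = f - g) ∧
    ∃ (k : ℕ) (f : Fin (k + 1) → V), Simplex (span ℚ {p}) F f

lemma hasDirection_of_unimodular {S : Set V} (hS : span ℚ S = ⊤) {F : Finset V}
    (hFS : ∀ x ∈ F, ∀ y ∈ F, x - y ∈ S) {f g : V} (hf : f ∈ F) (hg : g ∈ F) (hfg : f ≠ g)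
    (h : IsModular 1 ((span ℚ {f - g}).mkQ '' S)) : HasDirection F :=
  ⟨f - g, sub_ne_zero.2 hfg, ⟨f, hf, g, hg, rfl⟩, exists_simplex_of_unimodular hS h ⟨f, hf⟩ hFS⟩

lemma linearIndependent_pair_of {u v : V} (hu : u ≠ 0) (h : ∀ c : ℚ, v ≠ c • u) :
    LinearIndependent ℚ ![u, v] := by
  rw [LinearIndependent.pair_iff' hu]
  exact fun a => (h a).symm

lemma hasDirection_of_parallelogram {S : Set V} (h : IsModular 3 S) (hS : span ℚ S = ⊤)
    {F : Finset V} (hFS : ∀ x ∈ F, ∀ y ∈ F, x - y ∈ S) (hc : finrank ℚ V + 3 ≤ F.card)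
    {o d₁ d₂ : V} (h0 : o ∈ F) (h1 : o + d₁ ∈ F) (h2 : o + d₂ ∈ F) (h12 : o + d₁ + d₂ ∈ F)
    (hd₁ : d₁ ≠ 0) (hd₂ : d₂ ≠ 0) : HasDirection F := by
  classical
  by_contra hno
  have hN : ∀ f ∈ F, ∀ g ∈ F, f ≠ g → ¬ IsModular 1 ((span ℚ {f - g}).mkQ '' S) :=
    fun f hf g hg hfg hm => hno (hasDirection_of_unimodular hS hFS hf hg hfg hm)
  have hpar : ∀ f ∈ F, ∀ g ∈ F, f ≠ g → ∀ c : ℚ, c • (f - g) ∈ S → c ≠ 0 → |c| = 1 :=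
    fun f hf g hg hfg c hcS hc0 => by
      by_contra hc1
      exact hN f hf g hg hfg (isModular_one_of_smul h hS (sub_ne_zero.2 hfg) (hFS _ hf _ hg) hc0 hc1
        hcS)
  have hd₁S : d₁ ∈ S := by simpa using hFS _ h1 _ h0
  have hd₂S : d₂ ∈ S := by simpa using hFS _ h2 _ h0
  have haS : d₁ + d₂ ∈ S := by simpa [add_assoc] using hFS _ h12 _ h0
  have hbS : d₁ - d₂ ∈ S := by simpa using hFS _ h1 _ h2
  have hli : LinearIndependent ℚ ![d₁, d₂] := by
    refine linearIndependent_pair_of hd₁ fun c hcd => ?_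
    have hp := hpar _ h1 _ h0 (by simpa using hd₁)
    simp only [add_sub_cancel_left] at hp
    have hc1 := hp c (hcd ▸ hd₂S) (by rintro rfl; simp at hcd; exact hd₂ hcd)
    rcases (abs_eq (by norm_num)).1 hc1 with rfl | rfl
    · have := hp 2 (by rw [two_smul]; simpa [hcd] using haS) (by norm_num)
      norm_num at this
    · have := hp 2 (by rw [two_smul]; simpa [hcd] using hbS) (by norm_num)
      norm_num at this
  have hm := isModular_one_of_pair h hS hli hd₁S hd₂S (a₁ := 1) (a₂ := 1) (b₁ := 1) (b₂ := -1)
    (by simpa using haS) (by simpa [sub_eq_add_neg] using hbS) (by norm_num) (by norm_num)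
  obtain ⟨K, hK⟩ : ∃ K, K = span ℚ {d₁, d₂} := ⟨_, rfl⟩
  rw [← hK] at hm
  have hKr : finrank ℚ K = 2 := by
    have := finrank_span_eq_card hli
    have hr : Set.range ![d₁, d₂] = {d₁, d₂} := by simp [Set.pair_comm]
    rw [hr] at this
    rw [hK, this, Fintype.card_fin]
  obtain ⟨k, f, hs⟩ := exists_simplex_of_unimodular hS hm ⟨o, h0⟩ hFS
  obtain ⟨hk, br, hb⟩ := hs.exists_bracket h hS hKr hFS
  have hd₁K : d₁ ∈ K := hK ▸ subset_span (by simp)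
  have hd₂K : d₂ ∈ K := hK ▸ subset_span (by simp)
  have hanti : ∀ u v, br u v = - br v u := fun u v => by
    have := hb.self (u + v)
    simp only [map_add, LinearMap.add_apply, hb.self] at this
    linarith
  have hε : br d₁ d₂ = 1 ∨ br d₁ d₂ = -1 := by
    obtain ⟨z, hz, hz3⟩ := hb.int _ h1 _ h0 (by simpa using hd₁K) _ h2 _ h0 (by simpa using hd₂K)
    obtain ⟨w, hw, hw3⟩ := hb.int _ h12 _ h0 (by simpa [add_assoc] using K.add_mem hd₁K hd₂K) _ h1 _
      h2 (by simpa using K.sub_mem hd₁K hd₂K)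
    have hne := hb.ne _ hd₁K _ hd₂K hli
    have e1 : o + d₁ + d₂ - o = d₁ + d₂ := by abel
    have e2 : o + d₁ - (o + d₂) = d₁ - d₂ := by abel
    rw [e1, e2] at hw
    simp only [add_sub_cancel_left] at hz
    simp only [map_add, map_sub, LinearMap.add_apply, hb.self, hanti d₂ d₁, hz] at hw
    rw [hz] at hne ⊢
    have hw' : w = -2 * z := by
      have : (w : ℚ) = -2 * z := by rw [← hw]; ring
      exact_mod_cast this
    have hz0 : z ≠ 0 := by exact_mod_cast hne
    rw [abs_le] at hw3
    have : z = 1 ∨ z = -1 := by omega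
    rcases this with rfl | rfl <;> simp
  have hint : ∀ x ∈ F, ∀ y ∈ F, x - y ∈ K → ∃ a b : ℤ, x - y = (a : ℚ) • d₁ + (b : ℚ) • d₂ := by
    intro x hx y hy hxy
    obtain ⟨z, hz, _⟩ := hb.int _ hx _ hy hxy _ h2 _ h0 (by simpa using hd₂K)
    obtain ⟨w, hw, _⟩ := hb.int _ hx _ hy hxy _ h1 _ h0 (by simpa using hd₁K)
    rw [hK, mem_span_pair] at hxy
    obtain ⟨a, b, hab⟩ := hxy
    rw [← hab] at hz hw ⊢
    simp only [add_sub_cancel_left, map_add, map_smul, LinearMap.add_apply, LinearMap.smul_apply,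
      smul_eq_mul, hb.self, hanti d₂ d₁] at hz hw
    rcases hε with e | e <;> rw [e] at hz hw
    · exact ⟨z, -w, by push_cast; congr 2 <;> linarith⟩
    · exact ⟨-z, w, by push_cast; congr 2 <;> linarith⟩
  obtain ⟨j₀, hj₀⟩ := hs.cover o h0
  have hsub : ∀ {i x y}, x ∈ fiber K F (f i) → y ∈ fiber K F (f i) → x - y ∈ K :=
    fun {i x y} hx hy => by
      have := K.sub_mem (mem_fiber.1 hx).2 (mem_fiber.1 hy).2
      simpa using this
  have ho : o ∈ fiber K F (f j₀) := mem_fiber.2 ⟨h0, hj₀⟩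
  have ho1 : o + d₁ ∈ fiber K F (f j₀) := mem_fiber.2 ⟨h1, by
    have := K.add_mem hj₀ hd₁K; rwa [← sub_add_eq_add_sub]⟩
  have ho2 : o + d₂ ∈ fiber K F (f j₀) := mem_fiber.2 ⟨h2, by
    have := K.add_mem hj₀ hd₂K; rwa [← sub_add_eq_add_sub]⟩
  have ho12 : o + d₁ + d₂ ∈ fiber K F (f j₀) := mem_fiber.2 ⟨h12, by
    have := K.add_mem (K.add_mem hj₀ hd₁K) hd₂K; rwa [← sub_add_eq_add_sub, ← sub_add_eq_add_sub]⟩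
  have hsq : ∀ x ∈ fiber K F (f j₀), x = o ∨ x = o + d₁ ∨ x = o + d₂ ∨ x = o + d₁ + d₂ := by
    intro x hx
    obtain ⟨a, b, hab⟩ := hint x (mem_fiber.1 hx).1 o h0 (hsub hx ho)
    have key : ∀ g ∈ F, ∀ m n : ℤ, x - g = (2 : ℚ) • ((m : ℚ) • d₁ + (n : ℚ) • d₂) → x = g := by
      intro g hg m n e
      by_contra hne
      exact hN x (mem_fiber.1 hx).1 g hg hne (isModular_one_of_two_smul h hS hd₁S hd₂S
        (sub_ne_zero.2 hne) (hFS _ (mem_fiber.1 hx).1 _ hg) e)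
    have hx' : x = o + ((a : ℚ) • d₁ + (b : ℚ) • d₂) := by rw [← hab]; abel
    rcases Int.even_or_odd' a with ⟨m, rfl | rfl⟩ <;> rcases Int.even_or_odd' b with ⟨n, rfl | rfl⟩
    · exact Or.inl (key o h0 m n (by rw [hx']; push_cast; module))
    · exact Or.inr (Or.inr (Or.inl (key _ h2 m n (by rw [hx']; push_cast; module))))
    · exact Or.inr (Or.inl (key _ h1 m n (by rw [hx']; push_cast; module)))
    · exact Or.inr (Or.inr (Or.inr (key _ h12 m n (by rw [hx']; push_cast; module))))
  have hDD : |br (o + d₁ + d₂ - o) (o + d₁ - (o + d₂))| = 2 := by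
    have e1 : o + d₁ + d₂ - o = d₁ + d₂ := by abel
    have e2 : o + d₁ - (o + d₂) = d₁ - d₂ := by abel
    rw [e1, e2]
    simp only [map_add, map_sub, LinearMap.add_apply, hb.self, hanti d₂ d₁]
    rcases hε with e | e <;> rw [e] <;> norm_num
  have hDD' : |br (o + d₁ - (o + d₂)) (o + d₁ + d₂ - o)| = 2 := by rw [hanti, abs_neg, hDD]
  have hoff : ∀ j, j ≠ j₀ → ∀ x ∈ fiber K F (f j), ∀ y ∈ fiber K F (f j), x ≠ y →
      |br (x - y) (o + d₁ - (o + d₂))| = 1 ∧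
        ((x - y = d₁ ∨ x - y = - d₁) ∨ (x - y = d₂ ∨ x - y = -d₂)) := by
    intro j hj x hx y hy hxy
    obtain ⟨a, b, hab⟩ := hint x (mem_fiber.1 hx).1 y (mem_fiber.1 hy).1 (hsub hx hy)
    have he : Injective ![j, j₀] := by
      intro a b; fin_cases a <;> fin_cases b <;> simp [hj, hj.symm]
    have b1 := hb.sum_le hs he (x := ![x, o + d₁ + d₂]) (y := ![y, o])
      (fun i => by fin_cases i <;> assumption) (fun i => by fin_cases i <;> assumption) h1 h2
      (hsub ho1 ho2)
    have b2 := hb.sum_le hs he (x := ![x, o + d₁]) (y := ![y, o + d₂])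
      (fun i => by fin_cases i <;> assumption) (fun i => by fin_cases i <;> assumption) h12 h0
      (hsub ho12 ho)
    simp only [Fin.sum_univ_two, Matrix.cons_val_zero, Matrix.cons_val_one, hDD, hDD'] at b1 b2
    have e1 : o + d₁ + d₂ - o = d₁ + d₂ := by abel
    have e2 : o + d₁ - (o + d₂) = d₁ - d₂ := by abel
    have v1 : |br (x - y) (o + d₁ - (o + d₂))| = ((|a + b| : ℤ) : ℚ) := by
      rw [hab, e2]
      simp only [map_add, map_sub, map_smul, LinearMap.add_apply, LinearMap.smul_apply, hb.self,
        hanti d₂ d₁, smul_eq_mul]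
      push_cast
      rcases hε with e | e <;> rw [e]
      · rw [← abs_neg]; congr 1; ring
      · congr 1; ring
    have v2 : |br (x - y) (o + d₁ + d₂ - o)| = ((|a - b| : ℤ) : ℚ) := by
      rw [hab, e1]
      simp only [map_add, map_smul, LinearMap.add_apply, LinearMap.smul_apply, hb.self,
        hanti d₂ d₁, smul_eq_mul]
      push_cast
      rcases hε with e | e <;> rw [e]
      · congr 1; ring
      · rw [← abs_neg]; congr 1; ring
    rw [v1] at b1 ⊢
    rw [v2] at b2
    have b1' : |a + b| ≤ 1 := by
      have : ((|a + b| : ℤ) : ℚ) ≤ 1 := by linarith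
      exact_mod_cast this
    have b2' : |a - b| ≤ 1 := by
      have : ((|a - b| : ℤ) : ℚ) ≤ 1 := by linarith
      exact_mod_cast this
    have hn : ¬ (a = 0 ∧ b = 0) := by
      rintro ⟨rfl, rfl⟩
      apply hxy
      simpa [sub_eq_zero] using hab
    rw [abs_le] at b1' b2'
    have hcase : (a = 1 ∧ b = 0) ∨ (a = -1 ∧ b = 0) ∨ (a = 0 ∧ b = 1) ∨ (a = 0 ∧ b = -1) := by omega
    rcases hcase with ⟨rfl, rfl⟩ | ⟨rfl, rfl⟩ | ⟨rfl, rfl⟩ | ⟨rfl, rfl⟩ <;> simp [hab]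
  have hone : ∀ j, j ≠ j₀ → ∀ x ∈ fiber K F (f j), ∀ y ∈ fiber K F (f j), x ≠ y →
      ∀ j', j' ≠ j₀ → ∀ x' ∈ fiber K F (f j'), ∀ y' ∈ fiber K F (f j'), x' ≠ y' → j = j' := by
    intro j hj x hx y hy hxy j' hj' x' hx' y' hy' hxy'
    by_contra hne
    have he : Injective ![j, j', j₀] := by
      intro a b; fin_cases a <;> fin_cases b <;> simp [hj, hj.symm, hj', hj'.symm, hne, Ne.symm hne]
    have b1 := hb.sum_le hs he (x := ![x, x', o + d₁ + d₂]) (y := ![y, y', o])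
      (fun i => by fin_cases i <;> assumption) (fun i => by fin_cases i <;> assumption) h1 h2
      (hsub ho1 ho2)
    simp only [Fin.sum_univ_three, Matrix.cons_val_zero, Matrix.cons_val_one, Matrix.cons_val_two,
      Matrix.tail_cons, Matrix.head_cons, hDD,
      (hoff j hj x hx y hy hxy).1, (hoff j' hj' x' hx' y' hy' hxy').1] at b1
    norm_num at b1
  obtain ⟨j₁, hj₁, x₁, hx₁, y₁, hy₁, hxy₁⟩ : ∃ j, j ≠ j₀ ∧ ∃ x ∈ fiber K F (f j),
      ∃ y ∈ fiber K F (f j), x ≠ y := by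
    by_contra hall
    push Not at hall
    have c0 : (fiber K F (f j₀)).card ≤ 4 := by
      refine (Finset.card_le_card (t := {o, o + d₁, o + d₂, o + d₁ + d₂}) fun x hx => ?_).trans
        Finset.card_le_four
      simpa using hsq x hx
    have c1 : ∑ j ∈ Finset.univ.erase j₀, (fiber K F (f j)).card ≤
        ∑ j ∈ Finset.univ.erase j₀, 1 := by
      refine Finset.sum_le_sum fun j hj => Finset.card_le_one.2 fun x hx y hy => ?_
      exact hall j (Finset.ne_of_mem_erase hj) x hx y hy
    have := hs.card_eq
    rw [← Finset.add_sum_erase _ _ (Finset.mem_univ j₀)] at this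
    simp at c1
    omega
  have fin : ∀ e₁ e₂ : V, LinearIndependent ℚ ![e₁, e₂] → e₁ ∈ K →
      (∀ x ∈ fiber K F (f j₀), x = o ∨ x = o + e₁ ∨ x = o + e₂ ∨ x = o + e₁ + e₂) → e₂ ∈ K →
      o + e₂ ∈ F → (x₁ - y₁ = e₁ ∨ x₁ - y₁ = -e₁) → HasDirection F := by
    intro e₁ e₂ hli he₁ hsq he₂ he₂F hp
    refine ⟨x₁ - y₁, sub_ne_zero.2 hxy₁, ⟨x₁, (mem_fiber.1 hx₁).1, y₁, (mem_fiber.1 hy₁).1, rfl⟩,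
      k + 1, Fin.cons (o + e₂) (update f j₀ o), ?_⟩
    have hspan : span ℚ {x₁ - y₁} = span ℚ {e₁} := by
      rcases hp with e | e
      · rw [e]
      · rw [e, ← Set.neg_singleton, span_neg]
    have hle : span ℚ {e₁} ≤ K := by rw [span_singleton_le_iff_mem]; exact he₁
    have he₁m : e₁ ∈ span ℚ {e₁} := mem_span_singleton_self _
    rw [hspan]
    refine ⟨fun j => ?_, fun x hx => ?_, fun c hc hcm => ?_⟩
    · refine Fin.cases ?_ (fun j => ?_) j
      · exact he₂F
      · rw [Fin.cons_succ]
        by_cases hj : j = j₀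
        · rw [hj, update_self]; exact h0
        · rw [update_of_ne hj]; exact hs.mem j
    · obtain ⟨j, hj⟩ := hs.cover x hx
      by_cases hjj : j = j₀
      · subst hjj
        rcases hsq x (mem_fiber.2 ⟨hx, hj⟩) with rfl | rfl | rfl | rfl
        · exact ⟨j.succ, by simp⟩
        · exact ⟨j.succ, by simp⟩
        · exact ⟨0, by simp⟩
        · exact ⟨0, by
            have : o + e₁ + e₂ - (o + e₂) = e₁ := by abel
            rw [Fin.cons_zero, this]; exact he₁m⟩
      · refine ⟨j.succ, ?_⟩
        rw [Fin.cons_succ, update_of_ne hjj]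
        by_cases hxf : x = f j
        · rw [hxf, sub_self]; exact zero_mem _
        have hxj := mem_fiber.2 ⟨hx, hj⟩
        have hfj := hs.mem_fiber_self j
        obtain rfl := hone j hjj x hxj _ hfj hxf j₁ hj₁ x₁ hx₁ y₁ hy₁ hxy₁
        have hmem : ∀ z ∈ fiber K F (f j), z = x₁ ∨ z = y₁ := by
          intro z hz
          by_contra hne
          push Not at hne
          have v1 := (hoff j hjj z hz x₁ hx₁ hne.1).1
          have v2 := (hoff j hjj z hz y₁ hy₁ hne.2).1
          have v3 := (hoff j hjj x₁ hx₁ y₁ hy₁ hxy₁).1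
          rw [← sub_add_sub_cancel z x₁ y₁, map_add, LinearMap.add_apply] at v2
          rw [abs_eq (by norm_num)] at v1 v2 v3
          rcases v1 with v1 | v1 <;> rcases v3 with v3 | v3 <;> rw [v1, v3] at v2 <;>
            norm_num at v2
        have hm2 : y₁ - x₁ ∈ span ℚ {x₁ - y₁} := by
          rw [← neg_sub x₁ y₁]; exact neg_mem (mem_span_singleton_self _)
        rw [← hspan]
        rcases hmem x hxj with e | e <;> rcases hmem _ hfj with e' | e' <;> rw [e, e']
        · rw [sub_self]; exact zero_mem _
        · exact mem_span_singleton_self _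
        · exact hm2
        · rw [sub_self]; exact zero_mem _
    · have hz := hs.indep (fun j => c j.succ + if j = j₀ then c 0 else 0) (by
        rw [Finset.sum_add_distrib, Finset.sum_ite_eq' Finset.univ j₀]
        rw [Fin.sum_univ_succ] at hc
        simp; linarith) (by
        have hu : ∀ j, c j.succ • update f j₀ o j = c j.succ • f j +
            if j = j₀ then c j₀.succ • (o - f j₀) else 0 := by
          intro j
          by_cases hj : j = j₀
          · subst hj; simp; module
          · simp [hj]
        rw [Fin.sum_univ_succ] at hcm
        simp only [Fin.cons_zero, Fin.cons_succ, hu, Finset.sum_add_distrib, Finset.sum_ite_eq',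
          Finset.mem_univ, if_true] at hcm
        simp only [add_smul, ite_smul, zero_smul, Finset.sum_add_distrib, Finset.sum_ite_eq',
          Finset.mem_univ, if_true]
        have t1 := K.smul_mem (c 0) he₂
        have t2 := K.smul_mem (c 0) hj₀
        have t3 := K.smul_mem (c j₀.succ) hj₀
        have := K.sub_mem (K.sub_mem (K.sub_mem (hle hcm) t1) t2) t3
        convert this using 1
        module)
      have hj : ∀ j, j ≠ j₀ → c j.succ = 0 := fun j hj => by
        have := congrFun hz j
        simpa [hj] using this
      have hj' : c j₀.succ = - c 0 := by
        have := congrFun hz j₀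
        simp at this; linarith
      have hc0 : c 0 = 0 := by
        rw [Fin.sum_univ_succ, Finset.sum_eq_single j₀ (fun j _ h => by
          simp [hj j h]) (by simp), Fin.cons_zero, Fin.cons_succ, update_self, hj'] at hcm
        rw [mem_span_singleton] at hcm
        obtain ⟨a, ha⟩ := hcm
        have := LinearIndependent.pair_iff.1 hli (-a) (c 0) (by rw [neg_smul, ha]; module)
        exact this.2
      ext j
      refine Fin.cases hc0 (fun j => ?_) j
      by_cases hjj : j = j₀
      · rw [hjj, hj', hc0]; simp
      · exact hj j hjj
  rcases (hoff j₁ hj₁ x₁ hx₁ y₁ hy₁ hxy₁).2 with hp | hp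
  · exact hno (fin d₁ d₂ hli hd₁K hsq hd₂K h2 hp)
  · refine hno (fin d₂ d₁ ?_ hd₂K (fun x hx => ?_) hd₁K h1 hp)
    · exact LinearIndependent.pair_symm_iff.1 hli
    · rcases hsq x hx with e | e | e | e
      · exact Or.inl e
      · exact Or.inr (Or.inr (Or.inl e))
      · exact Or.inr (Or.inl e)
      · exact Or.inr (Or.inr (Or.inr (by rw [e]; abel)))

lemma Simplex.lift {d p : V} {F : Finset V} {F' : Finset (V ⧸ span ℚ {d})} {k : ℕ}
    {f' : Fin (k + 1) → V ⧸ span ℚ {d}} (hF : ∀ x ∈ F, (span ℚ {d}).mkQ x ∈ F')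
    (hF' : ∀ x' ∈ F', ∃ x ∈ F, (span ℚ {d}).mkQ x = x')
    (hs : Simplex (span ℚ {(span ℚ {d}).mkQ p}) F' f') :
    ∃ f : Fin (k + 1) → V, Simplex (span ℚ {d, p}) F f := by
  obtain ⟨π, hπ⟩ : ∃ π, π = (span ℚ {d}).mkQ := ⟨_, rfl⟩
  have hd : π d = 0 := by rw [hπ, mkQ_eq_zero]; exact mem_span_singleton_self _
  have hmem : ∀ x, π x ∈ span ℚ {π p} ↔ x ∈ span ℚ {d, p} := by
    intro x
    rw [mem_span_singleton, mem_span_pair]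
    constructor
    · rintro ⟨c, hc⟩
      have : x - c • p ∈ span ℚ {d} := by
        rw [← mkQ_eq_zero, ← hπ, map_sub, map_smul, hc, sub_self]
      obtain ⟨a, ha⟩ := mem_span_singleton.1 this
      exact ⟨a, c, by rw [ha]; abel⟩
    · rintro ⟨a, c, rfl⟩
      exact ⟨c, by rw [map_add, map_smul, map_smul, hd, smul_zero, zero_add]⟩
  have := fun j => hF' (f' j) (hs.mem j)
  choose f hf hff using this
  rw [← hπ] at hF hs hff
  refine ⟨f, hf, fun x hx => ?_, fun c hc hm => ?_⟩
  · obtain ⟨j, hj⟩ := hs.cover _ (hF x hx)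
    exact ⟨j, (hmem _).1 (by rw [map_sub, hff]; exact hj)⟩
  · refine hs.indep c hc ?_
    have := (hmem _).2 hm
    simpa [map_sum, map_smul, hff] using this

universe u in
theorem exists_direction (n : ℕ) : ∀ {V : Type u} [AddCommGroup V] [Module ℚ V]
    [FiniteDimensional ℚ V] {S : Set V}, finrank ℚ V = n → IsModular 3 S → span ℚ S = ⊤ →
    ∀ {F : Finset V}, (∀ x ∈ F, ∀ y ∈ F, x - y ∈ S) → finrank ℚ V + 3 ≤ F.card →
      HasDirection F := by
  classical
  induction n with
  | zero =>
    intro V _ _ _ S hn h hS F hFS hc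
    have : Subsingleton V := Module.finrank_zero_iff.1 hn
    have := Finset.card_le_one_of_subsingleton F
    omega
  | succ n ih =>
    intro V _ _ _ S hn h hS F hFS hc
    by_contra hno
    have hN : ∀ f ∈ F, ∀ g ∈ F, f ≠ g → ¬ IsModular 1 ((span ℚ {f - g}).mkQ '' S) :=
      fun f hf g hg hfg hm => hno (hasDirection_of_unimodular hS hFS hf hg hfg hm)
    have hP : ∀ f₁ ∈ F, ∀ f₂ ∈ F, ∀ f₃ ∈ F, ∀ f₄ ∈ F, f₁ - f₂ = f₃ - f₄ → f₁ ≠ f₂ → f₁ = f₃ := by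
      intro f₁ h₁ f₂ h₂ f₃ h₃ f₄ h₄ e hne
      by_contra hne'
      refine hno (hasDirection_of_parallelogram h hS hFS hc (o := f₄) (d₁ := f₃ - f₄)
        (d₂ := f₂ - f₄) h₄ (by simpa using h₃) (by simpa using h₂) ?_ (by
          rw [← e]; exact sub_ne_zero.2 hne) ?_)
      · have : f₄ + (f₃ - f₄) + (f₂ - f₄) = f₁ := by
          rw [← e]; abel
        rwa [this]
      · rw [sub_ne_zero]
        rintro rfl
        exact hne' (sub_left_injective e)
    have hpar : ∀ x ∈ F, ∀ y ∈ F, ∀ g ∈ F, ∀ h ∈ F, x ≠ y → g ≠ h → ∀ c : ℚ, g - h = c • (x - y) →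
        (x = g ∧ y = h) ∨ (x = h ∧ y = g) := by
      intro x hx y hy g hg k hk hxy hgh c hcc
      have hc0 : c ≠ 0 := by
        rintro rfl
        rw [zero_smul, sub_eq_zero] at hcc
        exact hgh hcc
      have hc1 : |c| = 1 := by
        by_contra hc1
        exact hN x hx y hy hxy (isModular_one_of_smul h hS (sub_ne_zero.2 hxy) (hFS _ hx _ hy) hc0
          hc1 (hcc ▸ hFS _ hg _ hk))
      rcases (abs_eq (by norm_num)).1 hc1 with rfl | rfl
      · rw [one_smul] at hcc
        obtain rfl := hP g hg k hk x hx y hy hcc hgh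
        exact Or.inl ⟨rfl, (sub_right_injective hcc).symm⟩
      · rw [neg_one_smul, neg_sub] at hcc
        obtain rfl := hP g hg k hk y hy x hx hcc hgh
        exact Or.inr ⟨(sub_right_injective hcc).symm, rfl⟩
    obtain ⟨f, hf, f', hf', hff⟩ := Finset.one_lt_card.1 (show 1 < F.card by omega)
    have hd0 : f - f' ≠ 0 := sub_ne_zero.2 hff
    obtain ⟨d, hd⟩ : ∃ d, d = f - f' := ⟨_, rfl⟩
    have hdK : ∀ x y, (span ℚ {d}).mkQ x = (span ℚ {d}).mkQ y → ∃ c : ℚ, x - y = c • (f - f') := by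
      intro x y hxy
      rw [← sub_eq_zero, ← map_sub, mkQ_eq_zero, mem_span_singleton] at hxy
      obtain ⟨c, hc⟩ := hxy
      exact ⟨c, by rw [← hd, hc]⟩
    have hinj : Set.InjOn (span ℚ {d}).mkQ (F.erase f') := by
      intro x hx y hy hxy
      by_contra hne
      have hx := Finset.mem_erase.1 (Finset.mem_coe.1 hx)
      have hy := Finset.mem_erase.1 (Finset.mem_coe.1 hy)
      obtain ⟨c, hc⟩ := hdK x y hxy
      rcases hpar f hf f' hf' x hx.2 y hy.2 hff hne c hc with e | e
      · exact hy.1 e.2.symm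
      · exact hx.1 e.2.symm
    have hπf : (span ℚ {d}).mkQ f' = (span ℚ {d}).mkQ f := by
      rw [← sub_eq_zero, ← map_sub, mkQ_eq_zero, hd, ← neg_sub f f', neg_mem_iff]
      exact mem_span_singleton_self _
    have hrank := finrank_add_card_of_ker (mkQ_surjective (span ℚ {d}))
      (linearIndependent_unit (hd ▸ hd0)) (by rw [ker_mkQ, Set.range_const])
    rw [Fintype.card_unit] at hrank
    have hm' := h.quotient hS (mkQ_surjective (span ℚ {d})) (linearIndependent_unit (hd ▸ hd0))
      (fun _ => by rw [hd]; exact hFS _ hf _ hf') (by rw [ker_mkQ, Set.range_const])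
    obtain ⟨p', hp0', ⟨g', hg', h', hh', rfl⟩, k, f₁, hs⟩ := ih (by omega) hm'
      (span_image_eq_top (mkQ_surjective _) hS) (F := (F.erase f').image (span ℚ {d}).mkQ)
      (by
        intro x' hx' y' hy'
        obtain ⟨x, hx, rfl⟩ := Finset.mem_image.1 hx'
        obtain ⟨y, hy, rfl⟩ := Finset.mem_image.1 hy'
        exact ⟨x - y, hFS _ (Finset.mem_of_mem_erase hx) _ (Finset.mem_of_mem_erase hy),
          map_sub _ _ _⟩)
      (by
        rw [Finset.card_image_of_injOn hinj, Finset.card_erase_of_mem hf']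
        omega)
    obtain ⟨g, hg, rfl⟩ := Finset.mem_image.1 hg'
    obtain ⟨h₁, hh, rfl⟩ := Finset.mem_image.1 hh'
    rw [← map_sub] at hs hp0'
    obtain ⟨f₂, hs₂⟩ := hs.lift (F := F) (fun x hx => by
        rw [Finset.mem_image]
        by_cases e : x = f'
        · exact ⟨f, Finset.mem_erase.2 ⟨hff, hf⟩, by rw [e, hπf]⟩
        · exact ⟨x, Finset.mem_erase.2 ⟨e, hx⟩, rfl⟩) (fun x' hx' => by
        obtain ⟨x, hx, rfl⟩ := Finset.mem_image.1 hx'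
        exact ⟨x, Finset.mem_of_mem_erase hx, rfl⟩)
    have hli : LinearIndependent ℚ ![d, g - h₁] := linearIndependent_pair_of (hd ▸ hd0) fun c hcc => by
      apply hp0'
      rw [hcc, map_smul, (mkQ_eq_zero).2 (mem_span_singleton_self d), smul_zero]
    have hr : Set.range ![d, g - h₁] = {d, g - h₁} := by simp [Set.pair_comm]
    have hKr : finrank ℚ (span ℚ {d, g - h₁}) = 2 := by
      have := finrank_span_eq_card hli
      rw [hr] at this
      rw [this, Fintype.card_fin]
    obtain ⟨hk, br, hb⟩ := hs₂.exists_bracket h hS hKr hFS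
    have := hb.card_le hs₂ rfl (fun x hx y hy g hg h hh hxy hgh h1 h2 =>
      linearIndependent_pair_of (sub_ne_zero.2 hxy) fun c hcc =>
        (hpar x hx y hy g hg h hh hxy hgh c hcc).elim h1 h2)
    omega

lemma card_le_of_differences {S : Set V} (h : IsModular 3 S) (hS : span ℚ S = ⊤) {F : Finset V}
    (hFS : ∀ x ∈ F, ∀ y ∈ F, x - y ∈ S) : F.card ≤ finrank ℚ V + 3 := by
  by_cases hc : finrank ℚ V + 3 ≤ F.card
  · obtain ⟨p, hp, -, k, f, hs⟩ := exists_direction _ rfl h hS hFS hc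
    exact hs.card_le_of_line h hS hp hFS
  · omega

lemma card_directions_le {S : Set V} (h : IsModular 3 S) (hS : span ℚ S = ⊤) {F : Finset V}
    (hFS : ∀ x ∈ F, ∀ y ∈ F, x - y ∈ S) (hc : finrank ℚ V + 3 ≤ F.card) {Y : Finset V}
    (hY : Nonpar Y) (hYF : ∀ y ∈ Y, ∃ f ∈ F, ∃ g ∈ F, ∃ c : ℚ, y = c • (f - g)) :
    2 * (Y.card : ℤ) ≤ finrank ℚ V * (finrank ℚ V - 1) + 6 * (finrank ℚ V - 1) + 2 := by
  obtain ⟨p, hp, -, k, f, hs⟩ := exists_direction _ rfl h hS hFS hc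
  exact hs.card_directions_of_line h hS hp hFS hY hYF

lemma map_flip [Fintype ι] [DecidableEq ι] (f : V [⋀^Unit ⊕ ι]→ₗ[ℚ] ℚ) {e x : V} {s : ι → V}
    {y₀ : ℚ} {y : ι → ℚ} (hx : x = y₀ • e + ∑ i, y i • s i) (U : Finset ι) :
    f (Sum.elim (fun _ => x) (fun i => if i ∈ U then e - s i else s i)) =
      (y₀ + ∑ i ∈ U, y i) * ((-1) ^ U.card * f (Sum.elim (fun _ => e) s)) := by
  set b : ι → V := fun i => if i ∈ U then e - s i else s i with hb
  set ε : ι → ℚ := fun i => if i ∈ U then -1 else 1 with hε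
  set ρ := y₀ + ∑ i ∈ U, y i with hρ
  have h1 : f (Sum.elim (fun _ => x) b) = f (Sum.elim (fun _ => ρ • e) b) := by
    refine map_elim_eq_left f fun _ => ?_
    have : x - ρ • e = ∑ i, (ε i * y i) • b i := by
      have h : ∀ i, (ε i * y i) • b i = y i • s i - (if i ∈ U then y i else 0) • e := by
        intro i
        simp only [hε, hb]
        split_ifs <;> module
      rw [Finset.sum_congr rfl fun i _ => h i, Finset.sum_sub_distrib, ← Finset.sum_smul,
        Finset.sum_ite_mem, Finset.univ_inter, hx, hρ]
      module
    rw [this]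
    exact sum_mem fun i _ => smul_mem _ _ (subset_span ⟨i, rfl⟩)
  have h2 : f (Sum.elim (fun _ => ρ • e) b) = ρ * f (Sum.elim (fun _ => e) b) := by
    classical
    have h : ∀ w : V, Sum.elim (fun _ : Unit => w) b =
        update (Sum.elim (fun _ : Unit => e) b) (Sum.inl ()) w := by
      intro w
      ext (i | i) <;> simp
    rw [h, f.map_update_smul, ← h e, smul_eq_mul]
  have h3 : f (Sum.elim (fun _ => e) b) = f (Sum.elim (fun _ => e) fun i => ε i • s i) := by
    refine map_elim_eq_right f (span ℚ {e}) (fun _ => mem_span_singleton_self e)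
      ((finrank_span_le_card _).trans (by simp)) fun i => ?_
    simp only [hε, hb]
    split_ifs
    · have : e - s i - (-1 : ℚ) • s i = e := by module
      rw [this]; exact mem_span_singleton_self e
    · simp
  have h4 : (Sum.elim (fun _ => e) fun i => ε i • s i : Unit ⊕ ι → V) =
      fun k => (Sum.elim (fun _ : Unit => (1 : ℚ)) ε) k • Sum.elim (fun _ : Unit => e) s k := by
    ext (i | i) <;> simp
  rw [h1, h2, h3, h4]
  rw [AlternatingMap.map_smul_univ]
  congr 2
  rw [Fintype.prod_sum_type]
  simp [hε]

lemma star_dichotomy [Fintype ι] {e x : V} {s : ι → V} {y₀ : ℚ} {y : ι → ℚ}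
    (hx : x = y₀ • e + ∑ i, y i • s i) (hxe : ∀ c : ℚ, x ≠ c • e)
    (h : ∀ U : Finset ι, y₀ + ∑ i ∈ U, y i = 0 ∨ y₀ + ∑ i ∈ U, y i = 1) :
    ∃ i, x = s i ∨ x = e - s i := by
  classical
  have h0 := h ∅
  rw [Finset.sum_empty, add_zero] at h0
  obtain ⟨i, hi⟩ : ∃ i, y i ≠ 0 := by
    by_contra! hy
    exact hxe y₀ (by rw [hx]; simp [hy])
  have hi1 := h {i}
  rw [Finset.sum_singleton] at hi1
  have hj : ∀ j, j ≠ i → y j = 0 := by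
    intro j hji
    have hj1 := h {j}
    have hj2 := h {j, i}
    rw [Finset.sum_singleton] at hj1
    rw [Finset.sum_pair hji] at hj2
    rcases h0 with h0 | h0 <;> rcases hi1 with hi1 | hi1 <;> rcases hj1 with hj1 | hj1 <;>
      rcases hj2 with hj2 | hj2 <;> first | linarith | exact absurd (by linarith) hi
  rw [Finset.sum_eq_single i (fun j _ hji => by rw [hj j hji, zero_smul]) (by simp)] at hx
  refine ⟨i, ?_⟩
  rcases h0 with h0 | h0 <;> rcases hi1 with hi1 | hi1
  · exact absurd (by linarith) hi
  · left; rw [hx, h0, show y i = 1 by linarith]; module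
  · right; rw [hx, h0, show y i = -1 by linarith]; module
  · exact absurd (by linarith) hi

lemma exists_star {e : V} (he : e ≠ 0) (T : Set V) :
    ∃ (n : ℕ) (s : Fin n → V), (∀ i, s i ∈ T) ∧
      LinearIndependent ℚ (Sum.elim (fun _ : Unit => e) s) ∧
      ∀ x ∈ T, ∃ (y₀ : ℚ) (y : Fin n → ℚ), x = y₀ • e + ∑ i, y i • s i := by
  obtain ⟨b, hbT, hsp, hli⟩ := exists_linearIndependent ℚ ((span ℚ {e}).mkQ '' T)
  have hfin : Finite b := hli.finite
  obtain ⟨n, ⟨E⟩⟩ := Finite.exists_equiv_fin b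
  choose s hs hsb using fun i : Fin n => hbT (E.symm i).2
  refine ⟨n, s, hs, ?_, ?_⟩
  · refine linearIndependent_elim_of_ker (π := (span ℚ {e}).mkQ) (linearIndependent_unit he)
      (fun _ => mkQ_eq_zero.2 (mem_span_singleton_self e)) ?_
    have : (span ℚ {e}).mkQ ∘ s = (fun x : b => (x : V ⧸ span ℚ {e})) ∘ E.symm := by
      ext i; exact hsb i
    rw [this]
    exact hli.comp _ E.symm.injective
  · intro x hx
    have : (span ℚ {e}).mkQ x ∈ span ℚ (Set.range ((span ℚ {e}).mkQ ∘ s)) := by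
      have hr : Set.range ((span ℚ {e}).mkQ ∘ s) = b := by
        have : (span ℚ {e}).mkQ ∘ s = (fun x : b => (x : V ⧸ span ℚ {e})) ∘ E.symm := by
          ext i; exact hsb i
        rw [this, E.symm.surjective.range_comp]; simp
      rw [hr, hsp]
      exact subset_span ⟨x, hx, rfl⟩
    obtain ⟨y, hy⟩ := (mem_span_range_iff_exists_fun ℚ).1 this
    have h : x - ∑ i, y i • s i ∈ span ℚ {e} := by
      rw [← mkQ_eq_zero, map_sub, map_sum, sub_eq_zero, ← hy]
      simp
    obtain ⟨c, hc⟩ := mem_span_singleton.1 h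
    exact ⟨c, y, by rw [hc]; abel⟩

end

section

variable {V : Type*} [AddCommGroup V] [Module ℚ V] [FiniteDimensional ℚ V]
variable {V' : Type*} [AddCommGroup V'] [Module ℚ V'] [FiniteDimensional ℚ V']
variable {ι α β : Type*}

/-- The set of vectors of `A` and their negatives. -/
def sym (A : Finset V) : Set V := {x | x ∈ A ∨ -x ∈ A}

/-- A spanning nonparallel `3`-modular configuration in which contracting any element destroys
at least `finrank ℚ V + 2` elements. -/
structure Rich (A : Finset V) : Prop where
  nonpar : Nonpar A
  span_eq : span ℚ (sym A) = ⊤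
  modular : IsModular 3 (sym A)
  rich : ∀ e ∈ A, ∀ R ⊆ A, e ∈ R → (∀ x ∈ A, ∀ y ∈ A, x ∉ R → y ∉ R → x ≠ y →
    ∀ a b : ℚ, e ≠ a • x + b • y) → finrank ℚ V + 2 ≤ R.card

variable {A : Finset V}

lemma neg_mem_sym {x : V} (h : x ∈ sym A) : -x ∈ sym A := by
  rcases h with h | h
  · exact Or.inr (by rwa [neg_neg])
  · exact Or.inl h

lemma mem_sym_of_mem {x : V} (h : x ∈ A) : x ∈ sym A := Or.inl h

lemma Nonpar.ne_zero (hA : Nonpar A) {x : V} (h : x ∈ sym A) : x ≠ 0 := by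
  rintro rfl
  rcases h with h | h
  · exact hA.1 _ h rfl
  · exact hA.1 _ h neg_zero

lemma Nonpar.eq_or_eq_neg (hA : Nonpar A) {x y : V} (hx : x ∈ sym A) (hy : y ∈ sym A) {c : ℚ}
    (h : y = c • x) : y = x ∨ y = -x := by
  rcases hx with hx | hx <;> rcases hy with hy | hy
  · exact Or.inl (hA.2 _ hx _ hy c h)
  · right
    rw [← hA.2 _ hx _ hy (-c) (by rw [h, neg_smul]), neg_neg]
  · exact Or.inr (hA.2 _ hx _ hy (-c) (by rw [h]; module))
  · left
    exact neg_injective (hA.2 _ hx _ hy c (by rw [h, smul_neg]))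

lemma Nonpar.two_smul_not_mem (hA : Nonpar A) {x : V} (hx : x ∈ sym A) : (2 : ℚ) • x ∉ sym A := by
  intro h
  have h0 := hA.ne_zero hx
  rcases hA.eq_or_eq_neg hx h rfl with e | e
  · apply h0
    have : x = (2 : ℚ) • x - x := by module
    rw [this, e, sub_self]
  · apply h0
    have : x = (1 / 3 : ℚ) • ((2 : ℚ) • x + x) := by module
    rw [this, e]; simp

lemma Nonpar.ne_smul_of_sub (hA : Nonpar A) {x e : V} (he : e ∈ sym A) (hx : x ∈ sym A)
    (h : e - x ∈ sym A) (c : ℚ) : x ≠ c • e := by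
  intro hc
  rcases hA.eq_or_eq_neg he hx hc with rfl | rfl
  · exact hA.ne_zero h (sub_self _)
  · apply hA.two_smul_not_mem he
    rwa [show (2 : ℚ) • e = e - -e by module]

open Classical in
/-- The representative in `A` of an element of `sym A`. -/
noncomputable def rep (A : Finset V) (x : V) : V := if x ∈ A then x else -x

lemma rep_mem {x : V} (h : x ∈ sym A) : rep A x ∈ A := by
  unfold rep
  split_ifs with hx
  · exact hx
  · exact h.resolve_left hx

lemma Nonpar.eq_rep (hA : Nonpar A) {x s : V} (hx : x ∈ A) (h : x = s ∨ x = -s) : x = rep A s := by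
  unfold rep
  split_ifs with hs
  · rcases h with h | h
    · exact h
    · exact hA.2 _ hs _ hx (-1) (by rw [h]; module)
  · rcases h with rfl | h
    · exact absurd hx hs
    · exact h

lemma Rich.le_card (hA : Rich A) {e : V} (he : e ∈ sym A) {R : Finset V} (hR : R ⊆ A)
    (heR : rep A e ∈ R) (h : ∀ x ∈ A, ∀ y ∈ A, x ∉ R → y ∉ R → x ≠ y →
      ∀ a b : ℚ, e ≠ a • x + b • y) : finrank ℚ V + 2 ≤ R.card := by
  refine hA.rich _ (rep_mem he) R hR heR fun x hx y hy hxR hyR hxy a b hab => ?_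
  unfold rep at hab
  split_ifs at hab with hs
  · exact h x hx y hy hxR hyR hxy a b hab
  · exact h x hx y hy hxR hyR hxy (-a) (-b) (by rw [← neg_neg e, hab]; module)

lemma span_eq_span_inter {S T : Set V} (h : T ⊆ S) : span ℚ T = span ℚ (S ∩ span ℚ T) :=
  le_antisymm (span_mono fun _ hx => ⟨h hx, subset_span hx⟩)
    (span_le.2 fun _ hx => hx.2)

lemma star_or_unimodular (hA : Rich A) {e : V} (he : e ∈ sym A) [Fintype ι] {s : ι → V}
    (hs : ∀ i, s i ∈ sym A) (hes : ∀ i, e - s i ∈ sym A)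
    (hli : LinearIndependent ℚ (Sum.elim (fun _ : Unit => e) s)) {x : V} (hx : x ∈ sym A)
    (hex : e - x ∈ sym A) {y₀ : ℚ} {y : ι → ℚ} (hy : ∀ i, y i ≠ 0)
    (hxy : x = y₀ • e + ∑ i, y i • s i) :
    (∃ i, x = s i ∨ x = e - s i) ∨
      ∃ W : Submodule ℚ V, finrank ℚ W ≤ 7 ∧ W = span ℚ (sym A ∩ W) ∧
        IsModular 1 (W.mkQ '' sym A) := by
  classical
  set d : Unit ⊕ ι → V := Sum.elim (fun _ : Unit => e) s with hd
  have hdS : ∀ i, d i ∈ sym A := by rintro (i | i); exacts [he, hs i]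
  have hle := hli.fintype_card_le_finrank
  have hcard : Fintype.card (Unit ⊕ ι) + Fintype.card (Fin (finrank ℚ V - Fintype.card (Unit ⊕ ι)))
      = finrank ℚ V := by rw [Fintype.card_fin]; omega
  obtain ⟨ω, hω0, hω⟩ := hA.modular.exists_form
    (ι := (Unit ⊕ ι) ⊕ Fin (finrank ℚ V - Fintype.card (Unit ⊕ ι))) (by
      rw [Fintype.card_sum]; exact hcard)
  obtain ⟨X, hX, hXli⟩ := exists_extension hli hcard hA.span_eq
  have hc0 := (map_ne_zero_iff_linearIndependent hω0 (by rw [Fintype.card_sum]; exact hcard)).2 hXli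
  have hflip : ∀ (w : V) (w₀ : ℚ) (z : ι → ℚ) (hw : w = w₀ • e + ∑ i, z i • s i) (U : Finset ι)
      (X : Fin (finrank ℚ V - Fintype.card (Unit ⊕ ι)) → V),
      ω (Sum.elim (Sum.elim (fun _ : Unit => w) (fun i => if i ∈ U then e - s i else s i)) X) =
        ((w₀ + ∑ i ∈ U, z i) * (-1) ^ U.card) * ω (Sum.elim d X) := by
    intro w w₀ z hw U X
    have := map_flip (freezeRight ω X) hw U
    rw [freezeRight_apply, freezeRight_apply] at this
    rw [this, hd, mul_assoc]
  have hfS : ∀ w ∈ sym A, ∀ (U : Finset ι) (k : Unit ⊕ ι),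
      (Sum.elim (fun _ : Unit => w) (fun i => if i ∈ U then e - s i else s i)) k ∈ sym A := by
    rintro w hw U (k | k)
    · exact hw
    · simp only [Sum.elim_inr]
      split_ifs
      exacts [hes k, hs k]
  have h6 : Fintype.card ι ≤ 6 := by
    refine card_le_six (T := Finset.univ) (a := fun i => -(y i * ω (Sum.elim d X)))
      (g := y₀ * ω (Sum.elim d X)) (fun i _ => neg_ne_zero.2 (mul_ne_zero (hy i) hc0)) fun U _ => ?_
    obtain ⟨z, hz, hz3⟩ := hω (Sum.elim (Sum.elim (fun _ : Unit => x)
      (fun i => if i ∈ U then e - s i else s i)) X) (by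
        rintro (k | k)
        exacts [hfS x hx U k, hX k])
    rw [hflip x y₀ y hxy] at hz
    have h1 : y₀ * ω (Sum.elim d X) - ∑ i ∈ U, -(y i * ω (Sum.elim d X)) =
        (y₀ + ∑ i ∈ U, y i) * ω (Sum.elim d X) := by
      rw [Finset.sum_neg_distrib, ← Finset.sum_mul]; ring
    rw [h1]
    rcases neg_one_pow_eq_or ℚ U.card with h2 | h2 <;> rw [h2] at hz
    · exact ⟨z, by rw [← hz]; ring, hz3⟩
    · exact ⟨-z, by push_cast; rw [← hz]; ring, by rwa [abs_neg]⟩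
  by_contra! hcon
  obtain ⟨hne, hno⟩ := hcon
  have hnm : ¬ IsModular 1 ((span ℚ (Set.range d)).mkQ '' sym A) := by
    refine hno _ ?_ (span_eq_span_inter ?_)
    · rw [finrank_span_eq_card hli, Fintype.card_sum, Fintype.card_unit]; omega
    · rintro _ ⟨i, rfl⟩; exact hdS i
  have key : ∀ (w : V) (w₀ : ℚ) (z : ι → ℚ), w ∈ sym A → w = w₀ • e + ∑ i, z i • s i →
      ∀ U : Finset ι, w₀ + ∑ i ∈ U, z i = 0 ∨ |w₀ + ∑ i ∈ U, z i| = 1 := by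
    intro w w₀ z hwS hw U
    by_contra! hU
    have hp : |(-1 : ℚ) ^ U.card| = 1 := by rw [abs_pow]; simp
    refine hnm (isModular_one_of_ratio hω0 hω hcard hA.span_eq (mkQ_surjective _) hli hdS
      (hfS w hwS U) (ker_mkQ _) (ρ := (w₀ + ∑ i ∈ U, z i) * (-1) ^ U.card) ?_ ?_
      fun X _ => hflip w w₀ z hw U X)
    · refine mul_ne_zero hU.1 fun h => ?_
      rw [h] at hp; simp at hp
    · rw [abs_mul, hp, mul_one]; exact hU.2
  obtain ⟨i, hi⟩ := star_dichotomy hxy (hA.nonpar.ne_smul_of_sub he hx hex) (by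
    intro U
    have h1 := key x y₀ y hx hxy U
    have h2 := key (e - x) (1 - y₀) (fun i => - y i) hex (by
      rw [hxy]; simp only [neg_smul, Finset.sum_neg_distrib]; module) U
    rw [Finset.sum_neg_distrib] at h2
    rcases h1 with h1 | h1
    · exact Or.inl h1
    · rcases (abs_eq (by norm_num)).1 h1 with h1 | h1
      · exact Or.inr h1
      · exfalso
        have h3 : 1 - y₀ + -∑ i ∈ U, y i = 2 := by linarith
        rw [h3] at h2
        norm_num at h2)
  rcases hi with hi | hi
  · exact (hne i).1 hi
  · exact (hne i).2 hi

lemma exists_unimodular_quotient (hA : Rich A) (h0 : 0 < finrank ℚ V) :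
    ∃ W : Submodule ℚ V, finrank ℚ W ≤ 7 ∧ W = span ℚ (sym A ∩ W) ∧
        IsModular 1 (W.mkQ '' sym A) := by
  classical
  by_contra hno
  have hcoef : ∀ x ∈ sym A, ∀ y ∈ sym A, LinearIndependent ℚ ![x, y] → ∀ a b : ℚ,
      a • x + b • y ∈ sym A → a = 0 ∨ |a| = 1 := by
    intro x hx y hy hli a b hab
    by_contra! hne
    refine hno ⟨span ℚ {x, y}, ?_, span_eq_span_inter (Set.insert_subset hx
      (Set.singleton_subset_iff.2 hy)), isModular_one_of_pair hA.modular hA.span_eq hli hx hy hab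
      (b₁ := 0) (b₂ := 1) (by simpa using hy) (by simpa using hne.1) (by simpa using hne.2)⟩
    have h1 := finrank_span_le_card (R := ℚ) ({x, y} : Set V)
    have h2 : ({x, y} : Set V).toFinset.card ≤ 2 := by
      rw [Set.toFinset_insert, Set.toFinset_singleton]; exact Finset.card_le_two
    omega
  obtain ⟨e, he⟩ : ∃ e, e ∈ sym A := by
    by_contra! h
    have : sym A = ∅ := Set.eq_empty_iff_forall_notMem.2 h
    have h1 := hA.span_eq
    rw [this, span_empty] at h1
    have h2 := finrank_top ℚ V
    rw [← h1, finrank_bot] at h2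
    omega
  obtain ⟨n, s, hsT, hli, hT⟩ := exists_star (hA.nonpar.ne_zero he)
    {x | x ∈ sym A ∧ e - x ∈ sym A}
  have hstar : ∀ x ∈ sym A, e - x ∈ sym A → ∃ i, x = s i ∨ x = e - s i := by
    intro x hx hex
    obtain ⟨y₀, y, hxy⟩ := hT x ⟨hx, hex⟩
    rcases star_or_unimodular hA he (ι := {i // y i ≠ 0}) (s := fun i => s i)
      (fun i => (hsT i).1) (fun i => (hsT i).2) (by
        have := hli.comp (Sum.map id Subtype.val : Unit ⊕ {i // y i ≠ 0} → Unit ⊕ Fin n)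
          (Sum.map_injective.2 ⟨injective_id, Subtype.val_injective⟩)
        have h2 : Sum.elim (fun _ : Unit => e) s ∘
            (Sum.map id Subtype.val : Unit ⊕ {i // y i ≠ 0} → Unit ⊕ Fin n) =
            Sum.elim (fun _ : Unit => e) (fun i : {i // y i ≠ 0} => s i) := by
          ext (i | i) <;> rfl
        rwa [h2] at this) hx hex (y₀ := y₀) (y := fun i => y i) (fun i => i.2) (by
        rw [hxy]
        congr 1
        rw [← Finset.sum_subtype (Finset.univ.filter fun i => y i ≠ 0) (by simp)
          fun i => y i • s i, Finset.sum_filter_of_ne]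
        intro i _ hi h
        exact hi (by rw [h, zero_smul])
        ) with ⟨i, hi⟩ | h
    · exact ⟨i, hi⟩
    · exact absurd h hno
  have hR := hA.le_card he (R := insert (rep A e) (Finset.univ.image fun i => rep A (s i)))
    (by
      intro x hx
      rcases Finset.mem_insert.1 hx with rfl | hx
      · exact rep_mem he
      · obtain ⟨i, -, rfl⟩ := Finset.mem_image.1 hx
        exact rep_mem (hsT i).1)
    (Finset.mem_insert_self _ _) (by
      intro x hx y hy hxR hyR hxy a b hab
      have hns : ∀ z ∈ A, z ∉ insert (rep A e) (Finset.univ.image fun i => rep A (s i)) →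
          ∀ i, z ≠ s i ∧ z ≠ -s i := by
        intro z hz hzR i
        by_contra! h
        refine hzR (Finset.mem_insert_of_mem (Finset.mem_image.2 ⟨i, Finset.mem_univ _, ?_⟩))
        refine (hA.nonpar.eq_rep hz ?_).symm
        by_contra! h'
        exact h'.2 (h h'.1)
      have hxS := mem_sym_of_mem hx
      have hyS := mem_sym_of_mem hy
      have hli : LinearIndependent ℚ ![x, y] := linearIndependent_pair_of (hA.nonpar.ne_zero hxS)
        fun c hc => hxy (hA.nonpar.2 _ hx _ hy c hc).symm
      have hli' : LinearIndependent ℚ ![y, x] := linearIndependent_pair_of (hA.nonpar.ne_zero hyS)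
        fun c hc => hxy (hA.nonpar.2 _ hy _ hx c hc)
      have ha := hcoef x hxS y hyS hli a b (hab ▸ he)
      have hb := hcoef y hyS x hxS hli' b a (by rw [add_comm]; exact hab ▸ he)
      have hpm : ∀ z ∈ A, ∀ a : ℚ, |a| = 1 → a • z ∈ sym A ∧ (a • z = z ∨ a • z = -z) := by
        intro z hz a ha
        rcases (abs_eq (by norm_num)).1 ha with rfl | rfl
        · rw [one_smul]; exact ⟨mem_sym_of_mem hz, Or.inl rfl⟩
        · rw [neg_one_smul]; exact ⟨neg_mem_sym (mem_sym_of_mem hz), Or.inr rfl⟩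
      have hone : ∀ z ∈ A, z ∉ insert (rep A e) (Finset.univ.image fun i => rep A (s i)) →
          ∀ c : ℚ, e ≠ c • z := by
        intro z hz hzR c hc
        apply hzR
        have : z = e ∨ z = -e := by
          rcases hA.nonpar.eq_or_eq_neg (mem_sym_of_mem hz) he hc with h | h
          · exact Or.inl h.symm
          · exact Or.inr (by rw [h, neg_neg])
        rw [hA.nonpar.eq_rep hz this]
        exact Finset.mem_insert_self _ _
      rcases ha with rfl | ha
      · exact hone y hy hyR b (by rw [hab]; simp)
      rcases hb with rfl | hb
      · exact hone x hx hxR a (by rw [hab]; simp)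
      obtain ⟨h1, h2⟩ := hpm x hx a ha
      obtain ⟨h3, h4⟩ := hpm y hy b hb
      obtain ⟨i, hi⟩ := hstar (a • x) h1 (by rw [hab, add_sub_cancel_left]; exact h3)
      have hx' := hns x hx hxR i
      have hy' := hns y hy hyR i
      rcases hi with hi | hi
      · rcases h2 with h2 | h2
        · exact hx'.1 (by rw [← hi, h2])
        · exact hx'.2 (by rw [← hi, h2, neg_neg])
      · have hi' : b • y = s i := by
          have : s i = e - a • x := by rw [hi]; abel
          rw [this, hab]; abel
        rcases h4 with h4 | h4
        · exact hy'.1 (by rw [← hi', h4])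
        · exact hy'.2 (by rw [← hi', h4, neg_neg]))
  have h1 := (Finset.card_insert_le (rep A e) (Finset.univ.image fun i => rep A (s i)))
  have h2 : (Finset.univ.image fun i => rep A (s i)).card ≤ n :=
    Finset.card_image_le.trans (by simp)
  have h3 := hli.fintype_card_le_finrank
  rw [Fintype.card_sum, Fintype.card_unit, Fintype.card_fin] at h3
  omega

end

section

variable {V : Type*} [AddCommGroup V] [Module ℚ V] [FiniteDimensional ℚ V]
variable {V' : Type*} [AddCommGroup V'] [Module ℚ V'] [FiniteDimensional ℚ V']
variable {ι α β : Type*}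

lemma exists_basis_of_span {K : Submodule ℚ V} {S : Set V} (hK : K = span ℚ (S ∩ K)) :
    ∃ x : Fin (finrank ℚ K) → V, (∀ i, x i ∈ S) ∧ LinearIndependent ℚ x ∧
      span ℚ (Set.range x) = K := by
  obtain ⟨b, hbT, hsp, hli⟩ := exists_linearIndependent ℚ (S ∩ (K : Set V))
  have hfin : Finite b := hli.finite
  have := Fintype.ofFinite b
  have hc : Fintype.card b = finrank ℚ K := by
    rw [hK, ← hsp, finrank_span_set_eq_card hli, Set.toFinset_card]
  let E := Fintype.equivFinOfCardEq hc
  refine ⟨fun i => (E.symm i : V), fun i => (hbT (E.symm i).2).1, hli.comp _ E.symm.injective, ?_⟩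
  have : Set.range (fun i => (E.symm i : V)) = b := by
    rw [show (fun i => (E.symm i : V)) = Subtype.val ∘ E.symm from rfl,
      E.symm.surjective.range_comp]
    simp
  rw [this, hsp, ← hK]

lemma card_ne_le {S : Set V} (h : IsModular 3 S) (hS : span ℚ S = ⊤) {π : V →ₗ[ℚ] V'}
    (hK : LinearMap.ker π = span ℚ (S ∩ LinearMap.ker π)) [Fintype ι] [DecidableEq V] {b b' : ι → V}
    (hb : ∀ i, b i ∈ S) (hb' : ∀ i, b' i ∈ S) (hbb : ∀ i, π (b' i) = π (b i))
    (hli : LinearIndependent ℚ (π ∘ b)) {z : V} (hz : z ∈ S) (hzb : π z = ∑ i, π (b i)) :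
    (Finset.univ.filter fun i => b' i ≠ b i).card ≤ 6 * finrank ℚ (LinearMap.ker π) := by
  classical
  obtain ⟨K, hKdef⟩ : ∃ K, K = LinearMap.ker π := ⟨_, rfl⟩
  rw [← hKdef] at hK ⊢
  obtain ⟨x, hx, hxli, hxK⟩ := exists_basis_of_span hK
  have hxK' : ∀ j, x j ∈ K := fun j => hxK ▸ subset_span ⟨j, rfl⟩
  have hxb := linearIndependent_elim_of_ker (π := π) hxli (fun i => by
    rw [← LinearMap.mem_ker, ← hKdef]; exact hxK' i) hli
  obtain ⟨n, hn⟩ : ∃ n, Fintype.card (Fin (finrank ℚ K) ⊕ ι) + n = finrank ℚ V :=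
    ⟨_, Nat.add_sub_of_le hxb.fintype_card_le_finrank⟩
  obtain ⟨X, hX, hXli⟩ := exists_extension (β := Fin n) hxb (by rw [Fintype.card_fin, hn]) hS
  have hli' : LinearIndependent ℚ (Sum.elim x (Sum.elim b X)) := by
    have := hXli.comp _ (Equiv.sumAssoc (Fin (finrank ℚ K)) ι (Fin n)).symm.injective
    have h2 : Sum.elim (Sum.elim x b) X ∘ (Equiv.sumAssoc (Fin (finrank ℚ K)) ι (Fin n)).symm =
        Sum.elim x (Sum.elim b X) := by
      ext (i | i | i) <;> rfl
    rwa [h2] at this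
  have hcard : Fintype.card (Fin (finrank ℚ K) ⊕ (ι ⊕ Fin n)) = finrank ℚ V := by
    rw [← hn]; simp only [Fintype.card_sum, Fintype.card_fin]; omega
  obtain ⟨ω, hω0, hω⟩ := h.exists_form hcard
  have hc0 := (map_ne_zero_iff_linearIndependent hω0 hcard).2 hli'
  set f := freezeRight ω (Sum.elim b X) with hf
  let L : Fin (finrank ℚ K) → V →ₗ[ℚ] ℚ := fun j => f.toMultilinearMap.toLinearMap x j
  have hL : ∀ j g, L j g = f (update x j g) := fun j g => rfl
  have hsix : ∀ j, (Finset.univ.filter fun i => L j (b' i - b i) ≠ 0).card ≤ 6 := by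
    intro j
    refine card_le_six (a := fun i => L j (b' i - b i)) (g := L j (z - ∑ i, b i))
      (fun i hi => (Finset.mem_filter.1 hi).2) fun s _ => ?_
    obtain ⟨w, hw, hw3⟩ := hω (Sum.elim (update x j z)
      (Sum.elim (fun i => if i ∈ s then b' i else b i) X)) (by
      rintro (i | i | i)
      · by_cases e : i = j
        · subst e; simpa using hz
        · simpa [e] using hx i
      · simp only [Sum.elim_inl, Sum.elim_inr]
        split_ifs
        exacts [hb' i, hb i]
      · exact hX i)
    refine ⟨w, ?_, hw3⟩
    rw [← hw, ← map_sum, ← map_sub, hL, hf, freezeRight_apply]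
    symm
    refine map_elim_eq ω K ?_ ?_ (by simp) ?_
    · intro i
      by_cases e : i = j
      · subst e
        rw [update_self, update_self]
        have h1 : z - (z - ∑ i, b i - ∑ i ∈ s, (b' i - b i)) =
            ∑ i, (if i ∈ s then b' i else b i) := by
          have h2 : ∑ i ∈ s, (b' i - b i) = ∑ i, if i ∈ s then (b' i - b i) else 0 := by
            rw [Finset.sum_ite_mem, Finset.univ_inter]
          rw [h2, sub_sub, sub_sub_cancel, ← Finset.sum_add_distrib]
          refine Finset.sum_congr rfl fun i _ => ?_
          split_ifs <;> abel
        rw [h1]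
        exact sum_mem fun i _ => subset_span ⟨Sum.inl i, rfl⟩
      · simp [e]
    · intro i
      by_cases e : i = j
      · subst e
        rw [update_self, hKdef, LinearMap.mem_ker, map_sub, map_sub, map_sum, map_sum, hzb, sub_self,
          zero_sub, neg_eq_zero]
        exact Finset.sum_eq_zero fun i _ => by rw [map_sub, hbb, sub_self]
      · simpa [e] using hxK' i
    · rintro (i | i)
      · simp only [Sum.elim_inl]
        rw [hKdef, LinearMap.mem_ker, map_sub, sub_eq_zero]
        split_ifs
        exacts [hbb i, rfl]
      · simp
  have hex : ∀ i, b' i ≠ b i → ∃ j, L j (b' i - b i) ≠ 0 := by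
    intro i hi
    by_contra! hLi
    have hmem : b' i - b i ∈ span ℚ (Set.range x) := by
      rw [hxK, hKdef, LinearMap.mem_ker, map_sub, sub_eq_zero]; exact hbb i
    obtain ⟨a, ha⟩ := (mem_span_range_iff_exists_fun ℚ).1 hmem
    apply hi
    rw [← sub_eq_zero, ← ha]
    refine Finset.sum_eq_zero fun j _ => ?_
    have h1 := hLi j
    rw [← ha, map_sum, Finset.sum_eq_single j] at h1
    · rw [map_smul, hL, update_eq_self, smul_eq_mul, hf, freezeRight_apply] at h1
      rw [(mul_eq_zero.1 h1).resolve_right hc0, zero_smul]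
    · intro l _ hlj
      rw [map_smul, hL, f.map_update_self x hlj.symm, smul_zero]
    · simp
  calc (Finset.univ.filter fun i => b' i ≠ b i).card
      ≤ (Finset.univ.biUnion fun j => Finset.univ.filter fun i => L j (b' i - b i) ≠ 0).card := by
        refine Finset.card_le_card fun i hi => ?_
        obtain ⟨j, hj⟩ := hex i (Finset.mem_filter.1 hi).2
        exact Finset.mem_biUnion.2 ⟨j, Finset.mem_univ _, Finset.mem_filter.2 ⟨Finset.mem_univ _, hj⟩⟩
    _ ≤ ∑ j : Fin (finrank ℚ K), 6 := Finset.card_biUnion_le.trans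
        (Finset.sum_le_sum fun j _ => hsix j)
    _ = 6 * finrank ℚ K := by simp [mul_comm]

lemma linearIndependent_of_span_le [Fintype ι] {v w : ι → V} (hv : LinearIndependent ℚ v)
    (h : ∀ i, v i ∈ span ℚ (Set.range w)) : LinearIndependent ℚ w := by
  rw [linearIndependent_iff_card_le_finrank_span]
  have h1 := finrank_span_eq_card hv
  rw [← h1]
  exact finrank_mono (span_le.2 (by rintro _ ⟨i, rfl⟩; exact h i))

/-- A vector is fat if it is nonzero and has at least two preimages in `S`. -/
def Fat (S : Set V) (π : V →ₗ[ℚ] V') (q : V') : Prop :=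
  q ≠ 0 ∧ ∃ a ∈ S, ∃ a' ∈ S, a' ≠ a ∧ π a = q ∧ π a' = q

lemma Fat.neg {A : Finset V} {π : V →ₗ[ℚ] V'} {q : V'} (h : Fat (sym A) π q) :
    Fat (sym A) π (-q) := by
  obtain ⟨h0, a, ha, a', ha', hne, h1, h2⟩ := h
  exact ⟨neg_ne_zero.2 h0, -a, neg_mem_sym ha, -a', neg_mem_sym ha', neg_injective.ne hne,
    by rw [map_neg, h1], by rw [map_neg, h2]⟩

lemma exists_center {A : Finset V} (h : IsModular 3 (sym A)) (hS : span ℚ (sym A) = ⊤)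
    {π : V →ₗ[ℚ] V'} (hK : LinearMap.ker π = span ℚ (sym A ∩ LinearMap.ker π)) {k : ℕ}
    (hk : finrank ℚ (LinearMap.ker π) ≤ k) (h0 : ∃ a ∈ sym A, π a ≠ 0) :
    ∃ e ∈ sym A, π e ≠ 0 ∧ ∃ U : Submodule ℚ V', finrank ℚ U ≤ 6 * k + 1 ∧ π e ∈ U ∧
      ∀ s, Fat (sym A) π s → Fat (sym A) π (π e - s) → s ∈ U := by
  classical
  by_cases hD : ∃ q, Fat (sym A) π q
  swap
  · push Not at hD
    obtain ⟨a, ha, ha0⟩ := h0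
    refine ⟨a, ha, ha0, span ℚ {π a}, ?_, mem_span_singleton_self _, fun s hs => absurd hs (hD s)⟩
    rw [finrank_span_singleton ha0]; omega
  obtain ⟨q, hq⟩ := hD
  let P : ℕ → Prop := fun t => ∃ (a : V') (q : Fin t → V'), Fat (sym A) π a ∧
    (∀ i, Fat (sym A) π (q i)) ∧ LinearIndependent ℚ (Fin.cons a q : Fin (t + 1) → V') ∧
    a + ∑ i, q i ∈ π '' sym A
  have hbound : ∀ t, P t → t + 1 ≤ 6 * k := by
    rintro t ⟨a, q, ha, hq, hli, z, hz, hza⟩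
    have hfat : ∀ i, Fat (sym A) π ((Fin.cons a q : Fin (t + 1) → V') i) := by
      intro i
      refine Fin.cases ha hq i
    choose h1 b hb b' hb' hne hbq hbq' using hfat
    have hcomp : π ∘ b = (Fin.cons a q : Fin (t + 1) → V') := funext hbq
    have := card_ne_le h hS hK hb hb' (fun i => by rw [hbq, hbq']) (by rw [hcomp]; exact hli) hz
      (by
        rw [hza, Finset.sum_congr rfl fun i _ => hbq i, Fin.sum_univ_succ]
        simp)
    rw [Finset.filter_true_of_mem fun i _ => hne i, Finset.card_univ, Fintype.card_fin] at this
    exact this.trans (Nat.mul_le_mul_left 6 hk)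
  have hP0 : P 0 := by
    refine ⟨q, Fin.elim0, hq, fun i => i.elim0, ?_, ?_⟩
    · exact linearIndependent_finCons.2 ⟨linearIndependent_empty_type, by simpa using hq.1⟩
    · obtain ⟨-, a, ha, -, -, -, haq, -⟩ := hq
      exact ⟨a, ha, by simp [haq]⟩
  obtain ⟨t, ht, ht'⟩ : ∃ t, P t ∧ ¬ P (t + 1) := by
    by_contra! hall
    have : ∀ t, P t := fun t => Nat.rec hP0 (fun t iht => hall t iht) t
    have := hbound _ (this (6 * k))
    omega
  have htb := hbound t ht
  obtain ⟨a, q, ha, hq, hli, z, hz, hza⟩ := ht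
  refine ⟨z, hz, ?_, span ℚ (Set.range (Fin.cons a q : Fin (t + 1) → V')), ?_, ?_, ?_⟩
  · intro hz0
    rw [hza] at hz0
    have h1 := Fintype.linearIndependent_iff.1 hli (fun _ => 1) (by
      rw [Fin.sum_univ_succ]; simpa using hz0) 0
    exact one_ne_zero h1
  · rw [finrank_span_eq_card hli, Fintype.card_fin]; omega
  · rw [hza]
    refine add_mem (subset_span ⟨0, rfl⟩) (sum_mem fun i _ => subset_span ⟨i.succ, rfl⟩)
  · intro s hs hs'
    by_contra hsU
    refine ht' ⟨s, Fin.cons (π z - s) (fun i => - q i), hs, fun i => ?_, ?_, ?_⟩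
    · refine Fin.cases hs' (fun i => ?_) i
      simpa using (hq i).neg
    · have hv : LinearIndependent ℚ (Fin.cons s (Fin.cons a q : Fin (t + 1) → V') :
          Fin (t + 2) → V') := linearIndependent_finCons.2 ⟨hli, hsU⟩
      refine linearIndependent_of_span_le hv ?_
      obtain ⟨w, hw⟩ : ∃ w : Fin (t + 2) → V', w = Fin.cons s
        (Fin.cons (π z - s) (fun i => - q i) : Fin (t + 1) → V') := ⟨_, rfl⟩
      have hw0 : s ∈ span ℚ (Set.range w) := subset_span ⟨0, by rw [hw]; rfl⟩
      have hw1 : π z - s ∈ span ℚ (Set.range w) := subset_span ⟨1, by rw [hw]; rfl⟩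
      have hw2 : ∀ i, q i ∈ span ℚ (Set.range w) := fun i => by
        rw [← neg_mem_iff]
        exact subset_span ⟨i.succ.succ, by rw [hw]; rfl⟩
      rw [← hw]
      intro i
      refine Fin.cases ?_ (fun i => ?_) i
      · exact hw0
      · refine Fin.cases ?_ (fun i => ?_) i
        · have : a = s + (π z - s) - ∑ i, q i := by rw [hza]; abel
          change a ∈ _
          rw [this]
          exact sub_mem (add_mem hw0 hw1) (sum_mem fun i _ => hw2 i)
        · exact hw2 i
    · obtain ⟨-, x, hx, -, -, -, hxa, -⟩ := ha
      refine ⟨x, hx, ?_⟩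
      rw [Fin.sum_univ_succ, hxa]
      simp only [Fin.cons_zero, Fin.cons_succ, Finset.sum_neg_distrib]
      rw [hza]; abel

/-- Coordinates in which every element of `S` is zero, a signed unit vector, or a signed edge. -/
structure Frame (S : Set V) (c : V →ₗ[ℚ] (ι → ℚ)) [DecidableEq ι] : Prop where
  star : ∀ i, ∃ x ∈ S, c x = Pi.single i 1
  coef : ∀ a ∈ S, ∀ i, c a i = 0 ∨ c a i = 1 ∨ c a i = -1
  supp : ∀ a ∈ S, ∀ i j k, i ≠ j → i ≠ k → j ≠ k → c a i = 0 ∨ c a j = 0 ∨ c a k = 0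
  minor : ∀ a ∈ S, ∀ b ∈ S, ∀ i j, i ≠ j → c a i ≠ 0 → c a j ≠ 0 → c b i ≠ 0 → c b j ≠ 0 →
    c a i * c b j = c a j * c b i
  ker_eq : LinearMap.ker c = span ℚ (S ∩ LinearMap.ker c)

lemma finrank_comap_le (π : V →ₗ[ℚ] V') (U : Submodule ℚ V') :
    finrank ℚ (U.comap π) ≤ finrank ℚ (LinearMap.ker π) + finrank ℚ U := by
  have h := LinearMap.finrank_range_add_finrank_ker (π.domRestrict (U.comap π))
  have h1 : finrank ℚ (LinearMap.range (π.domRestrict (U.comap π))) ≤ finrank ℚ U := by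
    apply finrank_mono
    rintro _ ⟨x, rfl⟩
    exact x.2
  have h2 : finrank ℚ (LinearMap.ker (π.domRestrict (U.comap π))) ≤
      finrank ℚ (LinearMap.ker π) := by
    rw [← finrank_map_subtype_eq]
    apply finrank_mono
    rintro _ ⟨x, hx, rfl⟩
    exact hx
  omega

lemma unimodular_pair_coef {S : Set V} (h : IsModular 1 S) (hS : span ℚ S = ⊤) {u v : V}
    (hu : u ∈ S) (hv : v ∈ S) (hli : LinearIndependent ℚ ![u, v]) {a b : ℚ}
    (hab : a • u + b • v ∈ S) : (a = 0 ∨ a = 1 ∨ a = -1) ∧ (b = 0 ∨ b = 1 ∨ b = -1) := by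
  obtain ⟨n, hn⟩ : ∃ n, Fintype.card (Fin 2) + n = finrank ℚ V :=
    ⟨_, Nat.add_sub_of_le hli.fintype_card_le_finrank⟩
  obtain ⟨X, hX, hXli⟩ := exists_extension (β := Fin n) hli (by rw [Fintype.card_fin n, hn]) hS
  obtain ⟨B, hB⟩ := exists_basis_of_card_eq hXli (by
    rw [Fintype.card_sum, Fintype.card_fin n, hn])
  have hB0 : B (Sum.inl 0) = u := by rw [hB]; rfl
  have hB1 : B (Sum.inl 1) = v := by rw [hB]; rfl
  have hent := (unimodular_entry_minor h B (by
    intro i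
    rw [hB]
    rcases i with i | i
    · fin_cases i
      exacts [hu, hv]
    · exact hX i)).1 _ hab
  have key : ∀ (x : ℚ), (∃ z : ℤ, x = z ∧ |z| ≤ 1) → (x = 0 ∨ x = 1 ∨ x = -1) := by
    rintro x ⟨z, rfl, hz⟩
    have := abs_le.1 hz
    have : z = 0 ∨ z = 1 ∨ z = -1 := by omega
    rcases this with rfl | rfl | rfl <;> simp
  have hr0 : B.repr (a • u + b • v) (Sum.inl 0) = a := by
    rw [← hB0, ← hB1]; simp
  have hr1 : B.repr (a • u + b • v) (Sum.inl 1) = b := by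
    rw [← hB0, ← hB1]; simp
  exact ⟨key a (hr0 ▸ hent (Sum.inl 0)), key b (hr1 ▸ hent (Sum.inl 1))⟩

lemma eq_of_int_abs_le_one {x : ℚ} (h : ∃ z : ℤ, x = z ∧ |z| ≤ 1) : x = 0 ∨ x = 1 ∨ x = -1 := by
  obtain ⟨z, rfl, hz⟩ := h
  have := abs_le.1 hz
  have : z = 0 ∨ z = 1 ∨ z = -1 := by omega
  rcases this with rfl | rfl | rfl <;> simp

lemma unimodular_flip [Fintype ι] {R : Set V} (h : IsModular 1 R) {e : V} {s : ι → V}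
    (he : e ∈ R) (hs : ∀ i, s i ∈ R) (hli : LinearIndependent ℚ (Sum.elim (fun _ : Unit => e) s))
    (hc : Fintype.card (Unit ⊕ ι) = finrank ℚ V) {U : Finset ι} (hU : ∀ i ∈ U, e - s i ∈ R)
    {x : V} (hx : x ∈ R) {y₀ : ℚ} {y : ι → ℚ} (hxy : x = y₀ • e + ∑ i, y i • s i) :
    y₀ + ∑ i ∈ U, y i = 0 ∨ y₀ + ∑ i ∈ U, y i = 1 ∨ y₀ + ∑ i ∈ U, y i = -1 := by
  classical
  obtain ⟨ω, h0, hω⟩ := h.exists_form hc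
  have h1 := (map_ne_zero_iff_linearIndependent h0 hc).2 hli
  have h2 := eq_of_int_abs_le_one (hω _ (by rintro (i | i); exacts [he, hs i] :
    ∀ i, Sum.elim (fun _ : Unit => e) s i ∈ R))
  have h3 := eq_of_int_abs_le_one (hω (Sum.elim (fun _ : Unit => x)
    (fun i => if i ∈ U then e - s i else s i)) (by
      rintro (i | i)
      · exact hx
      · simp only [Sum.elim_inr]
        split_ifs with hi
        exacts [hU i hi, hs i]))
  rw [map_flip ω hxy U] at h3
  generalize y₀ + ∑ i ∈ U, y i = ρ at h3 ⊢
  rcases h2 with h2 | h2 | h2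
  · exact absurd h2 h1
  all_goals
    rw [h2] at h3
    rcases neg_one_pow_eq_or ℚ U.card with h4 | h4 <;> rw [h4] at h3 <;>
      rcases h3 with h3 | h3 | h3 <;> first
        | exact Or.inl (by linarith)
        | exact Or.inr (Or.inl (by linarith))
        | exact Or.inr (Or.inr (by linarith))

/-- A unimodular image of a rich configuration is spanned by triangles through one vector,
up to bounded rank. -/
lemma exists_star_basis {A : Finset V} (hA : Rich A) {π : V →ₗ[ℚ] V'} (hπ : Surjective π)
    (hK : LinearMap.ker π = span ℚ (sym A ∩ LinearMap.ker π)) (hm : IsModular 1 (π '' sym A))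
    {k : ℕ} (hk : finrank ℚ (LinearMap.ker π) ≤ k) (h0 : 0 < finrank ℚ V') :
    ∃ (n : ℕ) (e : V') (s : Fin n → V'), e ∈ π '' sym A ∧ (∀ i, s i ∈ π '' sym A) ∧
      (∀ i, e - s i ∈ π '' sym A) ∧ LinearIndependent ℚ (Sum.elim (fun _ : Unit => e) s) ∧
      finrank ℚ V + 2 ≤ 7 ^ (7 * k + 1) + n := by
  classical
  have hspan := span_image_eq_top hπ hA.span_eq
  obtain ⟨e, heS, he0, U, hUk, heU, hU⟩ := exists_center hA.modular hA.span_eq hK hk (by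
    by_contra! h
    have hle : span ℚ (π '' sym A) ≤ ⊥ := span_le.2 (by rintro _ ⟨a, ha, rfl⟩; exact h a ha)
    rw [hspan] at hle
    have h2 := finrank_mono hle
    rw [finrank_top, finrank_bot] at h2
    omega)
  have heR : π e ∈ π '' sym A := ⟨e, heS, rfl⟩
  have hneg : ∀ q ∈ π '' sym A, -q ∈ π '' sym A := by
    rintro _ ⟨a, ha, rfl⟩
    exact ⟨-a, neg_mem_sym ha, map_neg _ _⟩
  obtain ⟨n, s, hsT, hli, hT⟩ := exists_star he0
    {x | x ∈ π '' sym A ∧ π e - x ∈ π '' sym A ∧ x ∉ U}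
  have hs := fun i => (hsT i).1
  have hes := fun i => (hsT i).2.1
  have hsU := fun i => (hsT i).2.2
  refine ⟨n, π e, s, heR, hs, hes, hli, ?_⟩
  obtain ⟨m, hmc⟩ : ∃ m, Fintype.card (Unit ⊕ Fin n) + m = finrank ℚ V' :=
    ⟨_, Nat.add_sub_of_le hli.fintype_card_le_finrank⟩
  obtain ⟨z, hz, hzli⟩ := exists_extension (β := Fin m) hli (by rw [Fintype.card_fin m, hmc]) hspan
  have hli' : LinearIndependent ℚ (Sum.elim (fun _ : Unit => π e) (Sum.elim s z)) := by
    have := hzli.comp _ (Equiv.sumAssoc Unit (Fin n) (Fin m)).symm.injective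
    have h2 : Sum.elim (Sum.elim (fun _ : Unit => π e) s) z ∘
        (Equiv.sumAssoc Unit (Fin n) (Fin m)).symm =
        Sum.elim (fun _ : Unit => π e) (Sum.elim s z) := by
      ext (i | i | i) <;> rfl
    rwa [h2] at this
  have hcard : Fintype.card (Unit ⊕ (Fin n ⊕ Fin m)) = finrank ℚ V' := by
    rw [← hmc]; simp only [Fintype.card_sum, Fintype.card_fin]; omega
  have hdich : ∀ x ∈ π '' sym A, π e - x ∈ π '' sym A → x ∉ U → ∃ i, x = s i ∨ x = π e - s i := by
    intro x hx hex hxU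
    obtain ⟨y₀, y, hxy⟩ := hT x ⟨hx, hex, hxU⟩
    refine star_dichotomy hxy (fun c hc => hxU (hc ▸ smul_mem _ _ heU)) fun Q => ?_
    have hflip : ∀ (x : V') (y₀ : ℚ) (y : Fin n → ℚ), x ∈ π '' sym A →
        x = y₀ • π e + ∑ i, y i • s i →
        y₀ + ∑ i ∈ Q, y i = 0 ∨ y₀ + ∑ i ∈ Q, y i = 1 ∨ y₀ + ∑ i ∈ Q, y i = -1 := by
      intro x y₀ y hx hxy
      have := unimodular_flip hm heR (s := Sum.elim s z) (by rintro (i | i); exacts [hs i, hz i])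
        hli' hcard (U := Q.map Embedding.inl) (by
          intro i hi
          obtain ⟨j, -, rfl⟩ := Finset.mem_map.1 hi
          exact hes j) hx (y₀ := y₀) (y := Sum.elim y fun _ => 0) (by
          rw [hxy, Fintype.sum_sum_type]; simp)
      simpa using this
    have h1 := hflip x y₀ y hx hxy
    have h2 := hflip (π e - x) (1 - y₀) (fun i => - y i) hex (by
      rw [hxy]; simp only [neg_smul, Finset.sum_neg_distrib]; module)
    rw [Finset.sum_neg_distrib] at h2
    rcases h1 with h1 | h1 | h1
    · exact Or.inl h1
    · exact Or.inr h1
    · exfalso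
      rcases h2 with h2 | h2 | h2 <;> linarith
  have hchoice : ∀ i, ∃ l ∈ sym A, (π l = s i ∨ π l = π e - s i) ∧
      ∀ a ∈ sym A, π a = π l → a = l := by
    intro i
    have h0 : s i ≠ 0 := fun h => hsU i (h ▸ zero_mem U)
    have h0' : π e - s i ≠ 0 := fun h => hsU i (by rw [← sub_eq_zero.1 h]; exact heU)
    by_cases h1 : Fat (sym A) π (s i)
    · have h2 : ¬ Fat (sym A) π (π e - s i) := fun h => hsU i (hU _ h1 h)
      obtain ⟨l, hl, hle⟩ := hes i
      refine ⟨l, hl, Or.inr hle, fun a ha hal => ?_⟩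
      by_contra hne
      exact h2 ⟨h0', l, hl, a, ha, hne, hle, hal.trans hle⟩
    · obtain ⟨l, hl, hle⟩ := hs i
      refine ⟨l, hl, Or.inl hle, fun a ha hal => ?_⟩
      by_contra hne
      exact h1 ⟨h0, l, hl, a, ha, hne, hle, hal.trans hle⟩
  choose l hl hls hlu using hchoice
  have hR := hA.le_card heS (R := A.filter (fun x => π x ∈ U) ∪
      Finset.univ.image fun i => rep A (l i))
    (by
      refine Finset.union_subset (Finset.filter_subset _ _) fun x hx => ?_
      obtain ⟨i, -, rfl⟩ := Finset.mem_image.1 hx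
      exact rep_mem (hl i))
    (by
      refine Finset.mem_union_left _ (Finset.mem_filter.2 ⟨rep_mem heS, ?_⟩)
      unfold rep
      split_ifs
      · exact heU
      · rw [map_neg]; exact neg_mem heU)
    (by
      intro x hx y hy hxR hyR hxy a b hab
      have hU' : ∀ x ∈ A, x ∉ A.filter (fun x => π x ∈ U) ∪ Finset.univ.image (fun i => rep A (l i)) →
          π x ∉ U := fun x hx hxR hxU =>
        hxR (Finset.mem_union_left _ (Finset.mem_filter.2 ⟨hx, hxU⟩))
      have hl' : ∀ x ∈ A, x ∉ A.filter (fun x => π x ∈ U) ∪ Finset.univ.image (fun i => rep A (l i)) →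
          ∀ i, ∀ c : ℚ, (c = 1 ∨ c = -1) → c • π x ≠ π (l i) := by
        intro x hx hxR i c hc hcx
        apply hxR
        refine Finset.mem_union_right _ (Finset.mem_image.2 ⟨i, Finset.mem_univ _, ?_⟩)
        symm
        apply hA.nonpar.eq_rep hx
        rcases hc with rfl | rfl
        · exact Or.inl (hlu i x (mem_sym_of_mem hx) (by rw [← hcx, one_smul]))
        · right
          rw [← hlu i (-x) (neg_mem_sym (mem_sym_of_mem hx)) (by rw [← hcx, map_neg]; module), neg_neg]
      have hxU := hU' x hx hxR
      have hyU := hU' y hy hyR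
      have hab' : π e = a • π x + b • π y := by rw [hab, map_add, map_smul, map_smul]
      have hsm : ∀ (c : ℚ) (w : V'), w ∉ U → π e = c • w → False := by
        intro c w hw hc
        have hc0 : c ≠ 0 := by
          rintro rfl
          exact he0 (by rw [hc, zero_smul])
        exact hw ((U.smul_mem_iff hc0).1 (hc ▸ heU))
      have hli2 : LinearIndependent ℚ ![π x, π y] :=
        linearIndependent_pair_of (fun h => hxU (h ▸ zero_mem U)) fun c hc =>
          hsm (a + b * c) (π x) hxU (by rw [hab', hc]; module)
      have hco := unimodular_pair_coef hm hspan ⟨x, mem_sym_of_mem hx, rfl⟩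
        ⟨y, mem_sym_of_mem hy, rfl⟩ hli2 (hab' ▸ heR)
      have ha : a = 1 ∨ a = -1 := hco.1.resolve_left fun h =>
        hsm b (π y) hyU (by rw [hab', h]; simp)
      have hb : b = 1 ∨ b = -1 := hco.2.resolve_left fun h =>
        hsm a (π x) hxU (by rw [hab', h]; simp)
      have hsign : ∀ (w : V') (c : ℚ), w ∈ π '' sym A → (c = 1 ∨ c = -1) → c • w ∈ π '' sym A := by
        rintro w c hw (rfl | rfl)
        · rwa [one_smul]
        · rw [neg_one_smul]; exact hneg _ hw
      have hax := hsign (π x) a ⟨x, mem_sym_of_mem hx, rfl⟩ ha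
      have hby := hsign (π y) b ⟨y, mem_sym_of_mem hy, rfl⟩ hb
      have hsub : π e - a • π x = b • π y := by rw [hab']; abel
      obtain ⟨i, hi⟩ := hdich (a • π x) hax (by rw [hsub]; exact hby) (by
        intro h
        refine hxU ((U.smul_mem_iff ?_).1 h)
        rcases ha with rfl | rfl <;> norm_num)
      have h1 := hl' x hx hxR i a ha
      have h2 := hl' y hy hyR i b hb
      rw [← hsub] at h2
      rcases hi with hi | hi <;> rcases hls i with h3 | h3
      · exact h1 (by rw [hi, h3])
      · exact h2 (by rw [hi, h3])
      · exact h2 (by rw [hi, h3]; abel)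
      · exact h1 (by rw [hi, h3]))
  have h1 := card_le_seven_pow hA.modular hA.span_eq (T := A.filter (fun x => π x ∈ U))
    (fun x hx => mem_sym_of_mem (Finset.mem_filter.1 hx).1) (U := U.comap π)
    (fun x hx => (Finset.mem_filter.1 hx).2)
  have h2 : 7 ^ finrank ℚ (U.comap π) ≤ 7 ^ (7 * k + 1) := by
    apply Nat.pow_le_pow_right (by norm_num)
    have := finrank_comap_le π U
    omega
  have h3 := Finset.card_union_le (A.filter (fun x => π x ∈ U))
    (Finset.univ.image fun i => rep A (l i))
  have h4 : (Finset.univ.image fun i => rep A (l i)).card ≤ n :=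
    Finset.card_image_le.trans (by simp)
  omega

lemma exists_frame {A : Finset V} (hA : Rich A) (h0 : 8 ≤ finrank ℚ V) :
    ∃ (n : ℕ) (c : V →ₗ[ℚ] (Fin n → ℚ)), Frame (sym A) c ∧ finrank ℚ V ≤ 7 ^ 50 + n := by
  classical
  obtain ⟨W, hW7, hWS, hm⟩ := exists_unimodular_quotient hA (by omega)
  have hfr := finrank_quotient_add_finrank W
  obtain ⟨π, hπdef⟩ : ∃ π, π = W.mkQ := ⟨_, rfl⟩
  have hπ : Surjective π := hπdef ▸ mkQ_surjective W
  have hker : LinearMap.ker π = W := by rw [hπdef, ker_mkQ]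
  rw [← hπdef] at hm
  have hK : LinearMap.ker π = span ℚ (sym A ∩ LinearMap.ker π) := by rw [hker]; exact hWS
  obtain ⟨n, e, s, heR, hs, hes, hli, hn⟩ := exists_star_basis hA hπ hK hm
    (k := 7) (by rw [hker]; exact hW7) (by omega)
  have hspan := span_image_eq_top hπ hA.span_eq
  obtain ⟨m, hmc⟩ : ∃ m, Fintype.card (Unit ⊕ Fin n) + m = finrank ℚ (V ⧸ W) :=
    ⟨_, Nat.add_sub_of_le hli.fintype_card_le_finrank⟩
  obtain ⟨z, hz, hzli⟩ := exists_extension (β := Fin m) hli (by rw [Fintype.card_fin m, hmc]) hspan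
  have hli' : LinearIndependent ℚ (Sum.elim (fun _ : Unit => e) (Sum.elim s z)) := by
    have := hzli.comp _ (Equiv.sumAssoc Unit (Fin n) (Fin m)).symm.injective
    have h2 : Sum.elim (Sum.elim (fun _ : Unit => e) s) z ∘
        (Equiv.sumAssoc Unit (Fin n) (Fin m)).symm =
        Sum.elim (fun _ : Unit => e) (Sum.elim s z) := by
      ext (i | i | i) <;> rfl
    rwa [h2] at this
  have hcard : Fintype.card (Unit ⊕ (Fin n ⊕ Fin m)) = finrank ℚ (V ⧸ W) := by
    rw [← hmc]; simp only [Fintype.card_sum, Fintype.card_fin]; omega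
  obtain ⟨B, hB⟩ := exists_basis_of_card_eq hli' hcard
  have hBe : B (Sum.inl ()) = e := by rw [hB]; rfl
  have hBs : ∀ i, B (Sum.inr (Sum.inl i)) = s i := fun i => by rw [hB]; rfl
  have hBz : ∀ i, B (Sum.inr (Sum.inr i)) = z i := fun i => by rw [hB]; rfl
  have hBR : ∀ i, B i ∈ π '' sym A := by
    intro i
    rw [hB]
    rcases i with i | i | i
    exacts [heR, hs i, hz i]
  obtain ⟨hent, hmin⟩ := unimodular_entry_minor hm B hBR
  let c : V →ₗ[ℚ] (Fin n → ℚ) :=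
    LinearMap.pi fun i => (B.coord (Sum.inr (Sum.inl i))).comp π
  have hc : ∀ v i, c v i = B.repr (π v) (Sum.inr (Sum.inl i)) := fun v i => rfl
  have hcoef : ∀ a ∈ sym A, ∀ i, c a i = 0 ∨ c a i = 1 ∨ c a i = -1 := fun a ha i =>
    eq_of_int_abs_le_one (hent _ ⟨a, ha, rfl⟩ _)
  have hflip : ∀ a ∈ sym A, ∀ U : Finset (Fin n), -1 ≤ B.repr (π a) (Sum.inl ()) + ∑ i ∈ U, c a i ∧
      B.repr (π a) (Sum.inl ()) + ∑ i ∈ U, c a i ≤ 1 := by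
    intro a ha U
    have := unimodular_flip hm heR (s := Sum.elim s z) (by rintro (i | i); exacts [hs i, hz i])
        hli' hcard (U := U.map Embedding.inl) (by
          intro i hi
          obtain ⟨j, -, rfl⟩ := Finset.mem_map.1 hi
          exact hes j) (x := π a) ⟨a, ha, rfl⟩ (y₀ := B.repr (π a) (Sum.inl ()))
          (y := fun i => B.repr (π a) (Sum.inr i)) (by
          conv_lhs => rw [← B.sum_repr (π a), hB]
          rw [Fintype.sum_sum_type]; simp)
    rw [Finset.sum_map] at this
    simp only [Embedding.inl_apply] at this
    simp only [hc]
    rcases this with h | h | h <;> rw [h] <;> norm_num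
  refine ⟨n, c, ⟨?_, hcoef, ?_, ?_, ?_⟩, ?_⟩
  · intro i
    obtain ⟨x, hx, hxs⟩ := hs i
    refine ⟨x, hx, ?_⟩
    ext j
    rw [hc, hxs, ← hBs, B.repr_self, Finsupp.single_apply, Pi.single_apply]
    by_cases hij : i = j
    · simp [hij]
    · simp [hij, Ne.symm hij]
  · intro a ha i j k hij hik hjk
    have hf := hflip a ha
    have h0 := hf ∅
    have h1 := hf {i}
    have h2 := hf {j}
    have h3 := hf {k}
    have h4 := hf {i, j}
    have h5 := hf {i, k}
    have h6 := hf {j, k}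
    have h7 := hf {i, j, k}
    rw [Finset.sum_empty] at h0
    rw [Finset.sum_singleton] at h1 h2 h3
    rw [Finset.sum_pair hij] at h4
    rw [Finset.sum_pair hik] at h5
    rw [Finset.sum_pair hjk] at h6
    rw [Finset.sum_insert (by simp [hij, hik]), Finset.sum_pair hjk] at h7
    by_contra! hne
    rcases (hcoef a ha i).resolve_left hne.1 with e1 | e1 <;>
      rcases (hcoef a ha j).resolve_left hne.2.1 with e2 | e2 <;>
      rcases (hcoef a ha k).resolve_left hne.2.2 with e3 | e3 <;>
      rw [e1, e2, e3] at h7 <;> rw [e1, e2] at h4 <;> rw [e1, e3] at h5 <;> rw [e2, e3] at h6 <;>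
      rw [e1] at h1 <;> rw [e2] at h2 <;> rw [e3] at h3 <;> linarith
  · intro a ha b hb i j hij h1 h2 h3 h4
    have := abs_le.1 (hmin _ ⟨a, ha, rfl⟩ _ ⟨b, hb, rfl⟩ (Sum.inr (Sum.inl i))
      (Sum.inr (Sum.inl j)) (by simpa using hij))
    simp only [← hc] at this
    rcases (hcoef a ha i).resolve_left h1 with e1 | e1 <;>
      rcases (hcoef a ha j).resolve_left h2 with e2 | e2 <;>
      rcases (hcoef b hb i).resolve_left h3 with e3 | e3 <;>
      rcases (hcoef b hb j).resolve_left h4 with e4 | e4 <;>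
      rw [e1, e2, e3, e4] at this ⊢ <;> first | norm_num at this; done | norm_num
  · refine le_antisymm ?_ (span_le.2 fun x hx => hx.2)
    have hWc : W ≤ span ℚ (sym A ∩ LinearMap.ker c) := by
      rw [hWS]
      refine span_mono fun x hx => ⟨hx.1, ?_⟩
      have : π x = 0 := by rw [← LinearMap.mem_ker, hker]; exact hx.2
      rw [SetLike.mem_coe, LinearMap.mem_ker]
      ext i
      rw [hc, this]; simp
    have hlift : ∀ k, (∀ i, k ≠ Sum.inr (Sum.inl i)) →
        ∃ x ∈ span ℚ (sym A ∩ LinearMap.ker c), π x = B k := by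
      intro k hk
      obtain ⟨x, hx, hxk⟩ := hBR k
      refine ⟨x, subset_span ⟨hx, ?_⟩, hxk⟩
      rw [SetLike.mem_coe, LinearMap.mem_ker]
      ext i
      rw [hc, hxk, B.repr_self, Finsupp.single_apply, if_neg (hk i)]; rfl
    obtain ⟨e', he', hee⟩ := hlift (Sum.inl ()) (by simp)
    choose z' hz' hzz using fun i : Fin m => hlift (Sum.inr (Sum.inr i)) (by simp)
    intro v hv
    have hv' : ∀ i, B.repr (π v) (Sum.inr (Sum.inl i)) = 0 := fun i => by
      rw [← hc, LinearMap.mem_ker.1 hv]; rfl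
    have hsum := B.sum_repr (π v)
    rw [Fintype.sum_sum_type, Fintype.sum_sum_type] at hsum
    simp only [hv', zero_smul, Finset.sum_const_zero, zero_add, Finset.univ_unique,
      Finset.sum_singleton, PUnit.default_eq_unit, ← hee, ← hzz] at hsum
    have hmem : v - (B.repr (π v) (Sum.inl ()) • e' +
        ∑ i, B.repr (π v) (Sum.inr (Sum.inr i)) • z' i) ∈ W := by
      refine (SetLike.ext_iff.1 hker _).1 ?_
      rw [LinearMap.mem_ker, map_sub, map_add, map_sum, map_smul]
      simp only [map_smul]
      exact sub_eq_zero.2 hsum.symm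
    rw [← sub_add_cancel v (B.repr (π v) (Sum.inl ()) • e' +
        ∑ i, B.repr (π v) (Sum.inr (Sum.inr i)) • z' i)]
    exact add_mem (hWc hmem) (add_mem (smul_mem _ _ he')
      (sum_mem fun i _ => smul_mem _ _ (hz' i)))
  · have : (7 : ℕ) * 7 + 1 = 50 := by norm_num
    rw [this] at hn
    omega

lemma finrank_supported_le [Fintype ι] (T : Finset ι) (U : Submodule ℚ (ι → ℚ))
    (hU : ∀ w ∈ U, ∀ i, i ∉ T → w i = 0) : finrank ℚ U ≤ T.card := by
  let f : U →ₗ[ℚ] (T → ℚ) := (LinearMap.funLeft ℚ ℚ ((↑) : T → ι)).comp U.subtype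
  have hf : Injective f := by
    rw [← LinearMap.ker_eq_bot, LinearMap.ker_eq_bot']
    intro w hw
    apply Subtype.ext
    ext i
    by_cases hi : i ∈ T
    · exact congrFun hw ⟨i, hi⟩
    · exact hU w w.2 i hi
  simpa using LinearMap.finrank_le_finrank_of_injective hf

lemma card_supported_le {S : Set V} (h : IsModular 3 S) (hS : span ℚ S = ⊤) [Fintype ι]
    (c : V →ₗ[ℚ] (ι → ℚ)) (T : Finset ι) {B : Finset V} (hB : ∀ x ∈ B, x ∈ S)
    (hT : ∀ x ∈ B, ∀ k, k ∉ T → c x k = 0) :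
    B.card ≤ 7 ^ (finrank ℚ (LinearMap.ker c) + T.card) := by
  let U : Submodule ℚ (ι → ℚ) := ⨅ k ∉ T, LinearMap.ker (LinearMap.proj k : (ι → ℚ) →ₗ[ℚ] ℚ)
  have hU : ∀ w, w ∈ U ↔ ∀ k, k ∉ T → w k = 0 := fun w => by simp [U, Submodule.mem_iInf]
  refine (card_le_seven_pow h hS (U := U.comap c) hB fun x hx => (hU _).2 (hT x hx)).trans ?_
  apply Nat.pow_le_pow_right (by norm_num)
  have h1 := finrank_comap_le c U
  have h2 := finrank_supported_le T U fun w hw => (hU w).1 hw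
  omega

/-- Some element of `S` is supported at both `i` and `j`. -/
def IsEdge (S : Set V) (c : V →ₗ[ℚ] (ι → ℚ)) (i j : ι) : Prop :=
  ∃ a ∈ S, c a i ≠ 0 ∧ c a j ≠ 0

open Classical in
lemma card_common_le {A : Finset V} (hA : Rich A) [Fintype ι] [DecidableEq ι]
    {c : V →ₗ[ℚ] (ι → ℚ)} (hF : Frame (sym A) c) {i j : ι} (hij : i ≠ j)
    (h : IsEdge (sym A) c i j) :
    finrank ℚ V + 2 ≤ ((Finset.univ.filter fun l => l ≠ i ∧ l ≠ j ∧
      IsEdge (sym A) c i l ∧ IsEdge (sym A) c j l).card + 1) *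
      7 ^ (finrank ℚ (LinearMap.ker c) + 3) := by
  obtain ⟨e, he, hi, hj⟩ := h
  obtain ⟨N, hN⟩ : ∃ N, N = Finset.univ.filter fun l => l ≠ i ∧ l ≠ j ∧
      IsEdge (sym A) c i l ∧ IsEdge (sym A) c j l := ⟨_, rfl⟩
  rw [← hN]
  let P : Finset ι → Finset V := fun T => A.filter fun x => ∀ k, k ∉ T → c x k = 0
  have hP : ∀ T : Finset ι, T.card ≤ 3 → (P T).card ≤ 7 ^ (finrank ℚ (LinearMap.ker c) + 3) := by
    intro T hT
    refine (card_supported_le hA.modular hA.span_eq c T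
      (fun x hx => mem_sym_of_mem (Finset.mem_filter.1 hx).1)
      fun x hx => (Finset.mem_filter.1 hx).2).trans ?_
    exact Nat.pow_le_pow_right (by norm_num) (by omega)
  have hek : ∀ k, k ≠ i → k ≠ j → c e k = 0 := fun k hki hkj => by
    rcases hF.supp e he i j k hij hki.symm hkj.symm with h | h | h
    exacts [absurd h hi, absurd h hj, h]
  have key := hA.le_card (R := P {i, j} ∪ N.biUnion fun l => P {i, j, l}) he (by
      refine Finset.union_subset (Finset.filter_subset _ _) ?_
      exact Finset.biUnion_subset.2 fun l _ => Finset.filter_subset _ _) (by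
      refine Finset.mem_union_left _ (Finset.mem_filter.2 ⟨rep_mem he, fun k hk => ?_⟩)
      simp only [Finset.mem_insert, Finset.mem_singleton, not_or] at hk
      have := hek k hk.1 hk.2
      unfold rep
      split_ifs
      · exact this
      · rw [map_neg, Pi.neg_apply, this, neg_zero]) (by
      intro x hx y hy hxR hyR hxy a b hab
      have hout : ∀ x ∈ A, x ∉ P {i, j} ∪ (N.biUnion fun l => P {i, j, l}) →
          (∃ l, l ≠ i ∧ l ≠ j ∧ c x l ≠ 0) ∧ ∀ l, l ≠ i → l ≠ j → c x l ≠ 0 →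
            IsEdge (sym A) c i l → IsEdge (sym A) c j l → c x i = 0 ∧ c x j = 0 := by
        intro x hx hxR
        rw [Finset.mem_union, not_or] at hxR
        refine ⟨?_, ?_⟩
        · by_contra! h
          exact hxR.1 (Finset.mem_filter.2 ⟨hx, fun k hk => by
            simp only [Finset.mem_insert, Finset.mem_singleton, not_or] at hk
            exact h k hk.1 hk.2⟩)
        · intro l hli hlj hl h1 h2
          have hlN : l ∈ N := by rw [hN]; simp [*]
          by_contra hne
          refine hxR.2 (Finset.mem_biUnion.2 ⟨l, hlN, Finset.mem_filter.2 ⟨hx, fun k hk => ?_⟩⟩)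
          simp only [Finset.mem_insert, Finset.mem_singleton, not_or] at hk
          have hs := hF.supp x (mem_sym_of_mem hx)
          rcases hs i l k hli.symm (Ne.symm hk.1) (Ne.symm hk.2.2) with h | h | h
          · rcases hs j l k hlj.symm (Ne.symm hk.2.1) (Ne.symm hk.2.2) with h' | h' | h'
            exacts [absurd ⟨h, h'⟩ hne, absurd h' hl, h']
          · exact absurd h hl
          · exact h
      have hcoord : ∀ k, c e k = a * c x k + b * c y k := fun k => by rw [hab]; simp
      have hxs := hF.supp x (mem_sym_of_mem hx)
      have hys := hF.supp y (mem_sym_of_mem hy)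
      obtain ⟨⟨l, hli, hlj, hl⟩, hx2⟩ := hout x hx hxR
      obtain ⟨⟨l', hli', hlj', hl'⟩, hy2⟩ := hout y hy hyR
      have ha : a ≠ 0 := by
        rintro rfl
        have h1 := hcoord l'
        rw [hek l' hli' hlj', zero_mul, zero_add] at h1
        have hb : b = 0 := (mul_eq_zero.1 h1.symm).resolve_right hl'
        exact hi (by rw [hcoord, hb]; ring)
      have hb : b ≠ 0 := by
        rintro rfl
        have h1 := hcoord l
        rw [hek l hli hlj, zero_mul, add_zero] at h1
        exact ha ((mul_eq_zero.1 h1.symm).resolve_right hl)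
      have hyl : c y l ≠ 0 := by
        intro h0
        have h1 := hcoord l
        rw [hek l hli hlj, h0, mul_zero, add_zero] at h1
        exact hl ((mul_eq_zero.1 h1.symm).resolve_left ha)
      have hior : c x i ≠ 0 ∨ c y i ≠ 0 := by
        by_contra! h
        exact hi (by rw [hcoord, h.1, h.2]; ring)
      have hjor : c x j ≠ 0 ∨ c y j ≠ 0 := by
        by_contra! h
        exact hj (by rw [hcoord, h.1, h.2]; ring)
      have hei : IsEdge (sym A) c i l := by
        rcases hior with h | h
        exacts [⟨x, mem_sym_of_mem hx, h, hl⟩, ⟨y, mem_sym_of_mem hy, h, hyl⟩]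
      have hej : IsEdge (sym A) c j l := by
        rcases hjor with h | h
        exacts [⟨x, mem_sym_of_mem hx, h, hl⟩, ⟨y, mem_sym_of_mem hy, h, hyl⟩]
      have h1 := hx2 l hli hlj hl hei hej
      have h2 := hy2 l hli hlj hyl hei hej
      exact hior.elim (fun h => h h1.1) (fun h => h h2.1))
  have h1 := Finset.card_union_le (P {i, j}) (N.biUnion fun l => P {i, j, l})
  have h2 := hP {i, j} (Finset.card_le_two.trans (by norm_num))
  have h3 : (N.biUnion fun l => P {i, j, l}).card ≤
      N.card * 7 ^ (finrank ℚ (LinearMap.ker c) + 3) :=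
    Finset.card_biUnion_le_card_mul _ _ _ fun l _ => hP _ Finset.card_le_three
  rw [add_mul, one_mul]
  omega

end

section

variable {V : Type*} [AddCommGroup V] [Module ℚ V] [FiniteDimensional ℚ V]
variable {V' : Type*} [AddCommGroup V'] [Module ℚ V'] [FiniteDimensional ℚ V']
variable {ι α β : Type*}

lemma exists_common [Fintype ι] [DecidableEq ι] {M D t q : ℕ} (N : Fin M → Finset ι)
    (hM : M = 2 * t * D) (ht : 0 < t) (hD : 0 < D) (hN : ∀ k, Fintype.card ι ≤ (N k).card * D)
    (hq : 2 * D * 2 ^ M * q < Fintype.card ι) :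
    ∃ I : Finset (Fin M), t ≤ I.card ∧
      q < (Finset.univ.filter fun v => ∀ k ∈ I, v ∈ N k).card := by
  classical
  by_contra! hI
  let d : ι → Finset (Fin M) := fun v => Finset.univ.filter fun k => v ∈ N k
  let G : Finset ι := Finset.univ.filter fun v => t ≤ (d v).card
  have hG : G.card ≤ q * 2 ^ M := by
    have h1 := Finset.card_le_mul_card_image (f := d) G q (by
      intro I hI'
      obtain ⟨v, hv, rfl⟩ := Finset.mem_image.1 hI'
      refine (Finset.card_le_card ?_).trans (hI (d v) (Finset.mem_filter.1 hv).2)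
      intro w hw
      refine Finset.mem_filter.2 ⟨Finset.mem_univ _, fun k hk => ?_⟩
      rw [← (Finset.mem_filter.1 hw).2] at hk
      exact (Finset.mem_filter.1 hk).2)
    refine h1.trans (Nat.mul_le_mul_left _ ?_)
    refine (Finset.card_le_univ _).trans ?_
    simp
  have hsum : ∑ k, (N k).card = ∑ v, (d v).card := by
    have := Finset.sum_card_bipartiteAbove_eq_sum_card_bipartiteBelow
      (s := (Finset.univ : Finset (Fin M))) (t := (Finset.univ : Finset ι)) (fun k v => v ∈ N k)
    simpa [Finset.bipartiteAbove, Finset.bipartiteBelow] using this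
  have h1 : M * Fintype.card ι ≤ (∑ k, (N k).card) * D := by
    rw [Finset.sum_mul]
    have := Finset.sum_le_sum fun k (_ : k ∈ Finset.univ) => hN k
    simpa using this
  have h2 : ∑ v, (d v).card ≤ G.card * M + Fintype.card ι * t := by
    rw [← Finset.sum_filter_add_sum_filter_not Finset.univ (fun v => t ≤ (d v).card)]
    refine add_le_add ?_ ?_
    · rw [← smul_eq_mul]
      refine Finset.sum_le_card_nsmul _ _ _ fun v _ => ?_
      exact (Finset.card_le_univ _).trans (by simp)
    · have := Finset.sum_le_card_nsmul (Finset.univ.filter fun v => ¬ t ≤ (d v).card)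
        (fun v => (d v).card) t fun v hv => by
          have := (Finset.mem_filter.1 hv).2
          omega
      refine this.trans ?_
      rw [smul_eq_mul]
      exact Nat.mul_le_mul_right _ (Finset.card_le_univ _)
  rw [hsum] at h1
  have h3 : M * Fintype.card ι ≤ (q * 2 ^ M * M + Fintype.card ι * t) * D :=
    h1.trans (Nat.mul_le_mul_right _ (h2.trans (Nat.add_le_add_right
      (Nat.mul_le_mul_right _ hG) _)))
  obtain ⟨E, hE⟩ : ∃ E, E = 2 ^ M := ⟨_, rfl⟩
  rw [← hE] at h3 hq
  have h4 : t * D * (2 * D * E * q) < t * D * Fintype.card ι :=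
    Nat.mul_lt_mul_of_pos_left hq (Nat.mul_pos ht hD)
  rw [hM] at h3
  nlinarith

/-- Two independent systems with the same image, differing in at least `f` places, whose images
sum to a signed unit vector at `v`. -/
def Trail (S : Set V) (c : V →ₗ[ℚ] (ι → ℚ)) (T : Finset ι) (v : ι) (f : ℕ) : Prop :=
  ∃ (n : ℕ) (b b' : Fin n → V), (∀ i, b i ∈ S) ∧ (∀ i, b' i ∈ S) ∧ (∀ i, c (b' i) = c (b i)) ∧
    (∀ i, ∀ k, k ∉ T → c (b i) k = 0) ∧ LinearIndependent ℚ (c ∘ b) ∧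
    (∃ σ : ℚ, (σ = 1 ∨ σ = -1) ∧ (∑ i, c (b i)) v = σ ∧ ∀ k, k ≠ v → (∑ i, c (b i)) k = 0) ∧
    ∃ F : Finset (Fin n), f ≤ F.card ∧ ∀ i ∈ F, b' i ≠ b i

variable {S : Set V} [DecidableEq ι] {c : V →ₗ[ℚ] (ι → ℚ)}

lemma Frame.trail_singleton (hF : Frame S c) (v : ι) : Trail S c {v} v 0 := by
  obtain ⟨s, hs, hcs⟩ := hF.star v
  refine ⟨1, fun _ => s, fun _ => s, fun _ => hs, fun _ => hs, fun _ => rfl, fun _ k hk => ?_,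
    ?_, ⟨1, Or.inl rfl, ?_, fun k hk => ?_⟩, ∅, le_rfl, by simp⟩
  · rw [hcs, Pi.single_apply, if_neg (by simpa using hk)]
  · refine linearIndependent_unique_iff.2 ?_
    simp [hcs]
  · simp [hcs]
  · simp [hcs, hk]

lemma Frame.trail_extend (hF : Frame S c) (hneg : ∀ x ∈ S, -x ∈ S) {T : Finset ι} {v w : ι}
    {f : ℕ} (h : Trail S c T v f) (hv : v ∈ T) (hw : w ∉ T) {a a' : V} (ha : a ∈ S) (ha' : a' ∈ S)
    (haa : c a' = c a) (hav : c a v ≠ 0) (haw : c a w ≠ 0) :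
    Trail S c (insert w T) w f ∧ (a' ≠ a → Trail S c (insert w T) w (f + 1)) := by
  classical
  obtain ⟨n, b, b', hb, hb', hbb, hT, hli, ⟨σ, hσ, hσv, hσk⟩, F, hf, hFb⟩ := h
  have hvw : v ≠ w := fun h => hw (h ▸ hv)
  have hv1 := (hF.coef a ha v).resolve_left hav
  have hw1 := (hF.coef a ha w).resolve_left haw
  have hak : ∀ k, k ≠ v → k ≠ w → c a k = 0 := fun k hkv hkw => by
    rcases hF.supp a ha v w k hvw hkv.symm hkw.symm with h | h | h
    exacts [absurd h hav, absurd h haw, h]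
  obtain ⟨ε, hε, hεσ⟩ : ∃ ε : ℚ, (ε = 1 ∨ ε = -1) ∧ ε * c a v + σ = 0 := by
    rcases hσ with rfl | rfl <;> rcases hv1 with h | h <;> rw [h]
    · exact ⟨-1, by norm_num⟩
    · exact ⟨1, by norm_num⟩
    · exact ⟨1, by norm_num⟩
    · exact ⟨-1, by norm_num⟩
  have hε0 : ε ≠ 0 := by rcases hε with rfl | rfl <;> norm_num
  have hεS : ∀ x ∈ S, ε • x ∈ S := by
    intro x hx
    rcases hε with rfl | rfl
    · rwa [one_smul]
    · rw [neg_one_smul]; exact hneg x hx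
  obtain ⟨B, hB⟩ : ∃ B : Fin (n + 1) → V, B = Fin.cons (ε • a) b := ⟨_, rfl⟩
  obtain ⟨B', hB'⟩ : ∃ B' : Fin (n + 1) → V, B' = Fin.cons (ε • a') b' := ⟨_, rfl⟩
  have hB0 : B 0 = ε • a := by rw [hB]; rfl
  have hBs : ∀ i : Fin n, B i.succ = b i := fun i => by rw [hB]; rfl
  have hB0' : B' 0 = ε • a' := by rw [hB']; rfl
  have hBs' : ∀ i : Fin n, B' i.succ = b' i := fun i => by rw [hB']; rfl
  have hsumB : ∀ k, (∑ i, c (B i)) k = ε * c a k + (∑ i, c (b i)) k := by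
    intro k
    rw [Fin.sum_univ_succ, hB0]
    simp only [hBs]
    rw [map_smul]; rfl
  have hliB : LinearIndependent ℚ (c ∘ B) := by
    have hnot : ε • c a ∉ span ℚ (Set.range (c ∘ b)) := by
      intro hmem
      have hle : span ℚ (Set.range (c ∘ b)) ≤
          LinearMap.ker (LinearMap.proj w : (ι → ℚ) →ₗ[ℚ] ℚ) := by
        rw [span_le]
        rintro _ ⟨i, rfl⟩
        exact hT i w hw
      have : ε * c a w = 0 := hle hmem
      exact (mul_ne_zero hε0 haw) this
    have h2 : (c ∘ B) = Fin.cons (ε • c a) (c ∘ b) := by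
      ext i : 1
      refine Fin.cases ?_ (fun i => ?_) i
      · simp [hB0]
      · simp [hBs]
    rw [h2]
    exact linearIndependent_finCons.2 ⟨hli, hnot⟩
  have hBS : ∀ i, B i ∈ S := fun i => by
    refine Fin.cases ?_ (fun i => ?_) i
    · rw [hB0]; exact hεS a ha
    · rw [hBs]; exact hb i
  have hBS' : ∀ i, B' i ∈ S := fun i => by
    refine Fin.cases ?_ (fun i => ?_) i
    · rw [hB0']; exact hεS a' ha'
    · rw [hBs']; exact hb' i
  have hBB : ∀ i, c (B' i) = c (B i) := fun i => by
    refine Fin.cases ?_ (fun i => ?_) i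
    · rw [hB0, hB0', map_smul, map_smul, haa]
    · rw [hBs, hBs']; exact hbb i
  have hBT : ∀ i, ∀ k, k ∉ insert w T → c (B i) k = 0 := fun i k hk => by
    rw [Finset.mem_insert, not_or] at hk
    refine Fin.cases ?_ (fun i => ?_) i
    · rw [hB0, map_smul, Pi.smul_apply, hak k (fun h => hk.2 (h ▸ hv)) hk.1, smul_zero]
    · rw [hBs]; exact hT i k hk.2
  have hσB : ∃ σ : ℚ, (σ = 1 ∨ σ = -1) ∧ (∑ i, c (B i)) w = σ ∧
      ∀ k, k ≠ w → (∑ i, c (B i)) k = 0 := by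
    refine ⟨_, ?_, rfl, fun k hk => ?_⟩
    · rw [hsumB, hσk w hvw.symm, add_zero]
      rcases hε with rfl | rfl <;> rcases hw1 with h | h <;> rw [h] <;> norm_num
    · rw [hsumB]
      by_cases hkv : k = v
      · rw [hkv, hσv, hεσ]
      · rw [hσk k hkv, hak k hkv hk]; ring
  have hFB : ∀ i ∈ F.map (Fin.succEmb n), B' i ≠ B i := by
    intro i hi
    obtain ⟨j, hj, rfl⟩ := Finset.mem_map.1 hi
    rw [Fin.coe_succEmb, hBs, hBs']
    exact hFb j hj
  refine ⟨⟨n + 1, B, B', hBS, hBS', hBB, hBT, hliB, hσB, F.map (Fin.succEmb n), ?_, hFB⟩,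
    fun hne => ⟨n + 1, B, B', hBS, hBS', hBB, hBT, hliB, hσB,
      insert 0 (F.map (Fin.succEmb n)), ?_, ?_⟩⟩
  · rwa [Finset.card_map]
  · rw [Finset.card_insert_of_notMem (by simp), Finset.card_map]
    omega
  · intro i hi
    rcases Finset.mem_insert.1 hi with rfl | hi
    · rw [hB0, hB0']
      exact fun h => hne (smul_right_injective V hε0 h)
    · exact hFB i hi

lemma Frame.trail_le (hF : Frame S c) [Finite ι] (hneg : ∀ x ∈ S, -x ∈ S) (h : IsModular 3 S)
    (hS : span ℚ S = ⊤) {T : Finset ι} {v : ι} {f : ℕ} (hT : Trail S c T v f) :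
    f ≤ 6 * finrank ℚ (LinearMap.ker c) := by
  classical
  obtain ⟨n, b, b', hb, hb', hbb, -, hli, ⟨σ, hσ, hσv, hσk⟩, F, hf, hFb⟩ := hT
  obtain ⟨s, hs, hcs⟩ := hF.star v
  obtain ⟨z, hz, hcz⟩ : ∃ z ∈ S, c z = ∑ i, c (b i) := by
    have hsum : ∑ i, c (b i) = σ • c s := by
      ext k
      rw [hcs, Pi.smul_apply, Pi.single_apply]
      split_ifs with hk
      · rw [hk, hσv]; simp
      · rw [hσk k hk]; simp
    rcases hσ with rfl | rfl
    · exact ⟨s, hs, by rw [hsum, one_smul]⟩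
    · exact ⟨-s, hneg s hs, by rw [hsum, map_neg]; module⟩
  refine hf.trans (le_trans (Finset.card_le_card ?_) (card_ne_le h hS hF.ker_eq hb hb' hbb hli hz hcz))
  intro i hi
  exact Finset.mem_filter.2 ⟨Finset.mem_univ _, hFb i hi⟩

/-- Two different elements of `S` with the same image supported at both `i` and `j`. -/
def FatEdge (S : Set V) (c : V →ₗ[ℚ] (ι → ℚ)) (i j : ι) : Prop :=
  ∃ a ∈ S, ∃ a' ∈ S, c a' = c a ∧ a' ≠ a ∧ c a i ≠ 0 ∧ c a j ≠ 0

lemma FatEdge.isEdge {i j : ι} (h : FatEdge S c i j) : IsEdge S c i j := by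
  obtain ⟨a, ha, -, -, -, -, h1, h2⟩ := h
  exact ⟨a, ha, h1, h2⟩

lemma Frame.exists_trail (hF : Frame S c) (hneg : ∀ x ∈ S, -x ∈ S) {M : ℕ} {x y : Fin M → ι}
    (hxy : Injective (Sum.elim x y)) (hfat : ∀ k, FatEdge S c (x k) (y k)) {I : Finset (Fin M)}
    {H : Finset ι} (hH : ∀ h ∈ H, ∀ k ∈ I, IsEdge S c (x k) h ∧ IsEdge S c (y k) h)
    (hc : 5 * M + 1 < H.card) (J : Finset (Fin M)) (hJ : J ⊆ I) :
    ∃ (T : Finset ι) (v : ι), Trail S c T v J.card ∧ T.card ≤ 3 * J.card + 1 ∧ v ∈ T ∧ v ∈ H ∧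
      ∀ k, k ∉ J → x k ∉ T ∧ y k ∉ T := by
  classical
  let P : Finset ι := Finset.univ.image (Sum.elim x y)
  have hPc : P.card ≤ 2 * M := Finset.card_image_le.trans (by simp; omega)
  have hPx : ∀ k, x k ∈ P := fun k => Finset.mem_image.2 ⟨Sum.inl k, Finset.mem_univ _, rfl⟩
  have hPy : ∀ k, y k ∈ P := fun k => Finset.mem_image.2 ⟨Sum.inr k, Finset.mem_univ _, rfl⟩
  have hfresh : ∀ T : Finset ι, T.card ≤ 3 * M + 1 → ∃ h ∈ H, h ∉ T ∧ h ∉ P := by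
    intro T hT
    have : (T ∪ P).card < H.card := by
      have := Finset.card_union_le T P
      omega
    obtain ⟨h, hh, hn⟩ := Finset.exists_mem_notMem_of_card_lt_card this
    rw [Finset.mem_union, not_or] at hn
    exact ⟨h, hh, hn.1, hn.2⟩
  have hx : ∀ k l, k ≠ l → x k ≠ x l := fun k l hkl h =>
    hkl (Sum.inl_injective (hxy (a₁ := Sum.inl k) (a₂ := Sum.inl l) h))
  have hy : ∀ k l, k ≠ l → y k ≠ y l := fun k l hkl h =>
    hkl (Sum.inr_injective (hxy (a₁ := Sum.inr k) (a₂ := Sum.inr l) h))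
  have hxy' : ∀ k l, x k ≠ y l := fun k l h =>
    Sum.inl_ne_inr (hxy (a₁ := Sum.inl k) (a₂ := Sum.inr l) h)
  induction J using Finset.induction_on with
  | empty =>
    obtain ⟨h, hh, -, hhP⟩ := hfresh ∅ (by simp)
    refine ⟨{h}, h, hF.trail_singleton h, by simp, by simp, hh, fun k _ => ?_⟩
    constructor
    · rw [Finset.mem_singleton]; rintro rfl; exact hhP (hPx k)
    · rw [Finset.mem_singleton]; rintro rfl; exact hhP (hPy k)
  | insert k J hkJ ih =>
    obtain ⟨T, v, hTr, hTc, hvT, hvH, hT⟩ := ih ((Finset.subset_insert _ _).trans hJ)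
    have hkI : k ∈ I := hJ (Finset.mem_insert_self _ _)
    have hcJ : (insert k J).card = J.card + 1 := Finset.card_insert_of_notMem hkJ
    have hJM : J.card + 1 ≤ M := by
      rw [← hcJ]
      exact (Finset.card_le_univ _).trans (by simp)
    obtain ⟨a, ha, h1, h2⟩ := (hH v hvH k hkI).1
    have t1 := (hF.trail_extend hneg hTr hvT (hT k hkJ).1 ha ha rfl h2 h1).1
    have hyT : y k ∉ insert (x k) T := by
      rw [Finset.mem_insert, not_or]
      exact ⟨(hxy' k k).symm, (hT k hkJ).2⟩
    obtain ⟨a, ha, a', ha', h3, h4, h5, h6⟩ := hfat k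
    have t2 := (hF.trail_extend hneg t1 (Finset.mem_insert_self _ _) hyT ha ha' h3 h5 h6).2 h4
    have c1 := Finset.card_insert_le (x k) T
    have c2 := Finset.card_insert_le (y k) (insert (x k) T)
    obtain ⟨h, hh, hhT, hhP⟩ := hfresh (insert (y k) (insert (x k) T)) (by omega)
    obtain ⟨a, ha, h1, h2⟩ := (hH h hh k hkI).2
    have t3 := (hF.trail_extend hneg t2 (Finset.mem_insert_self _ _) hhT ha ha rfl h1 h2).1
    have c3 := Finset.card_insert_le h (insert (y k) (insert (x k) T))
    refine ⟨_, h, hcJ ▸ t3, by omega, Finset.mem_insert_self _ _, hh, fun l hl => ?_⟩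
    rw [Finset.mem_insert, not_or] at hl
    simp only [Finset.mem_insert, not_or]
    refine ⟨⟨?_, hxy' l k, hx l k hl.1, (hT l hl.2).1⟩, ⟨?_, hy l k hl.1, (hxy' k l).symm, (hT l hl.2).2⟩⟩
    · rintro rfl; exact hhP (hPx l)
    · rintro rfl; exact hhP (hPy l)

/-- A bound on the number of pages forced by a fat matching. -/
def matchBound (κ : ℕ) : ℕ := 2 * (6 * κ + 1) * (2 * 7 ^ (κ + 3))

/-- The number of pages beyond which no fat matching of size `matchBound κ` exists. -/
def pageBound (κ : ℕ) : ℕ :=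
  2 * (2 * 7 ^ (κ + 3)) * 2 ^ matchBound κ * (5 * matchBound κ + 1) + 2 * 7 ^ (κ + 3)

lemma Rich.card_le_of_matching {A : Finset V} (hA : Rich A) [Fintype ι] (hF : Frame (sym A) c)
    {κ : ℕ} (hκ : finrank ℚ (LinearMap.ker c) ≤ κ) (hm : Fintype.card ι ≤ finrank ℚ V)
    {x y : Fin (matchBound κ) → ι} (hxy : Injective (Sum.elim x y))
    (hfat : ∀ k, FatEdge (sym A) c (x k) (y k)) : Fintype.card ι ≤ pageBound κ := by
  classical
  by_contra! hlt
  have hne : ∀ k, x k ≠ y k := fun k h =>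
    Sum.inl_ne_inr (hxy (a₁ := Sum.inl k) (a₂ := Sum.inr k) h)
  obtain ⟨D, hD⟩ : ∃ D, D = 7 ^ (κ + 3) := ⟨_, rfl⟩
  have hD0 : 0 < D := by rw [hD]; positivity
  rw [pageBound, ← hD] at hlt
  obtain ⟨I, hI, hq⟩ := exists_common (D := 2 * D) (t := 6 * κ + 1) (q := 5 * matchBound κ + 1)
    (fun k => Finset.univ.filter fun l => l ≠ x k ∧ l ≠ y k ∧ IsEdge (sym A) c (x k) l ∧
      IsEdge (sym A) c (y k) l) (by rw [hD, matchBound]) (by omega) (by omega) (by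
      intro k
      have h1 := card_common_le hA hF (hne k) (hfat k).isEdge
      have h2 : 7 ^ (finrank ℚ (LinearMap.ker c) + 3) ≤ D := by
        rw [hD]; exact Nat.pow_le_pow_right (by norm_num) (by omega)
      have h3 := h1.trans (Nat.mul_le_mul_left _ h2)
      have h4 : 2 * D ≤ Fintype.card ι := by omega
      rw [add_mul, one_mul] at h3
      nlinarith) (by omega)
  obtain ⟨T, v, hT, -⟩ := hF.exists_trail (fun x => neg_mem_sym) hxy hfat (I := I) (by
    intro h hh k hk
    exact (Finset.mem_filter.1 ((Finset.mem_filter.1 hh).2 k hk)).2.2.2) hq I le_rfl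
  have := hF.trail_le (fun x => neg_mem_sym) hA.modular hA.span_eq hT
  omega

end

section

variable {V : Type*} [AddCommGroup V] [Module ℚ V] [FiniteDimensional ℚ V]
variable {V' : Type*} [AddCommGroup V'] [Module ℚ V'] [FiniteDimensional ℚ V']
variable {ι α β : Type*}
variable {S : Set V} [DecidableEq ι] {c : V →ₗ[ℚ] (ι → ℚ)}

lemma Frame.finrank_ker_add (hF : Frame S c) [Fintype ι] :
    finrank ℚ (LinearMap.ker c) + Fintype.card ι = finrank ℚ V := by
  have hr : LinearMap.range c = ⊤ := by
    rw [eq_top_iff, ← (Pi.basisFun ℚ ι).span_eq, span_le]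
    rintro _ ⟨i, rfl⟩
    obtain ⟨s, -, hs⟩ := hF.star i
    exact ⟨s, by rw [hs, Pi.basisFun_apply]⟩
  have := LinearMap.finrank_range_add_finrank_ker c
  rw [hr, finrank_top, finrank_pi] at this
  omega

/-- A frame all of whose edges are covered by a single element of `S` up to sign. -/
structure CleanFrame (S : Set V) (c : V →ₗ[ℚ] (ι → ℚ)) : Prop extends Frame S c where
  clean : ∀ a ∈ S, ∀ a' ∈ S, ∀ i j, i ≠ j → c a i ≠ 0 → c a j ≠ 0 → c a' = c a → a' = a

lemma Frame.restrict (hF : Frame S c) [Finite ι] (P : Finset ι)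
    (hP : ∀ i j, i ≠ j → i ∉ P → j ∉ P → ¬ FatEdge S c i j) :
    CleanFrame S ((LinearMap.funLeft ℚ ℚ ((↑) : {i // i ∉ P} → ι)).comp c) := by
  classical
  obtain ⟨c', hc'⟩ : ∃ c', c' = (LinearMap.funLeft ℚ ℚ ((↑) : {i // i ∉ P} → ι)).comp c :=
    ⟨_, rfl⟩
  have hcc : ∀ v i, c' v i = c v i.1 := fun v i => by rw [hc']; rfl
  rw [← hc']
  have hne : ∀ {i j : {i // i ∉ P}}, i ≠ j → i.1 ≠ j.1 := fun h h' => h (Subtype.ext h')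
  refine ⟨⟨?_, ?_, ?_, ?_, ?_⟩, ?_⟩
  · intro i
    obtain ⟨s, hs, hcs⟩ := hF.star i.1
    refine ⟨s, hs, ?_⟩
    ext j
    rw [hcc, hcs, Pi.single_apply, Pi.single_apply]
    simp only [Subtype.ext_iff]
  · intro a ha i
    rw [hcc]; exact hF.coef a ha i
  · intro a ha i j k hij hik hjk
    simp only [hcc]
    exact hF.supp a ha _ _ _ (hne hij) (hne hik) (hne hjk)
  · intro a ha b hb i j hij
    simp only [hcc]
    exact hF.minor a ha b hb _ _ (hne hij)
  · refine le_antisymm ?_ (span_le.2 fun x hx => hx.2)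
    choose s hs hcs using hF.star
    intro v hv
    have hker : v - ∑ p ∈ P, c v p • s p ∈ LinearMap.ker c := by
      rw [LinearMap.mem_ker]
      ext k
      rw [map_sub, map_sum, Pi.sub_apply, Finset.sum_apply]
      simp only [map_smul, hcs, Pi.smul_apply, Pi.single_apply, smul_eq_mul, mul_ite, mul_one,
        mul_zero, Finset.sum_ite_eq]
      split_ifs with hk
      · simp
      · have := congrFun (LinearMap.mem_ker.1 hv) ⟨k, hk⟩
        rw [hcc] at this
        simpa using this
    have hle : LinearMap.ker c ≤ span ℚ (S ∩ LinearMap.ker c') := by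
      rw [hF.ker_eq]
      refine span_mono fun x hx => ⟨hx.1, ?_⟩
      rw [SetLike.mem_coe, LinearMap.mem_ker]
      ext k
      rw [hcc, LinearMap.mem_ker.1 hx.2]; rfl
    rw [← sub_add_cancel v (∑ p ∈ P, c v p • s p)]
    refine add_mem (hle hker) (sum_mem fun p hp => smul_mem _ _ (subset_span ⟨hs p, ?_⟩))
    rw [SetLike.mem_coe, LinearMap.mem_ker]
    ext k
    rw [hcc, hcs, Pi.single_apply, if_neg (by rintro rfl; exact k.2 hp)]; rfl
  · intro a ha a' ha' i j hij hi hj h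
    by_contra haa
    refine hP i j (hne hij) i.2 j.2 ⟨a, ha, a', ha', ?_, haa, by rwa [← hcc], by rwa [← hcc]⟩
    ext k
    by_cases hk : k ∈ P
    · have h0 : ∀ x ∈ S, c' x i ≠ 0 → c' x j ≠ 0 → c x k = 0 := by
        intro x hx hxi hxj
        rw [hcc] at hxi hxj
        rcases hF.supp x hx i j k (hne hij) (by rintro rfl; exact i.2 hk)
          (by rintro rfl; exact j.2 hk) with h | h | h
        exacts [absurd h hxi, absurd h hxj, h]
      rw [h0 a ha hi hj, h0 a' ha' (by rwa [h]) (by rwa [h])]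
    · have := congrFun h ⟨k, hk⟩
      rwa [hcc, hcc] at this

/-- A bound on the kernel dimension of a clean frame. -/
def kerBound (K : ℕ) : ℕ := K + 2 * matchBound K

lemma exists_fat_cover {ι : Type*} [Finite ι] (E : ι → ι → Prop) {M : ℕ}
    (h : ¬ ∃ x y : Fin M → ι, Injective (Sum.elim x y) ∧ ∀ k, E (x k) (y k)) :
    ∃ P : Finset ι, P.card ≤ 2 * M ∧ ∀ i j, i ≠ j → i ∉ P → j ∉ P → ¬ E i j := by
  classical
  let Q : ℕ → Prop := fun n => ∃ x y : Fin n → ι, Injective (Sum.elim x y) ∧ ∀ k, E (x k) (y k)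
  have h0 : Q 0 := ⟨Fin.elim0, Fin.elim0, by rintro (i | i) <;> exact i.elim0, fun k => k.elim0⟩
  obtain ⟨n, hn, hQ, hQ'⟩ : ∃ n < M, Q n ∧ ¬ Q (n + 1) := by
    by_contra! hall
    have : ∀ n, n ≤ M → Q n := by
      intro n
      induction n with
      | zero => exact fun _ => h0
      | succ n ih => exact fun hn => hall n (by omega) (ih (by omega))
    exact h (this M le_rfl)
  obtain ⟨x, y, hxy, hE⟩ := hQ
  refine ⟨Finset.univ.image (Sum.elim x y), Finset.card_image_le.trans (by simp; omega), ?_⟩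
  intro i j hij hi hj hEij
  have hnot : ∀ i, i ∉ Finset.univ.image (Sum.elim x y) → i ∉ Set.range x ∧ i ∉ Set.range y := by
    intro i hi
    constructor
    · rintro ⟨k, rfl⟩
      exact hi (Finset.mem_image.2 ⟨Sum.inl k, Finset.mem_univ _, rfl⟩)
    · rintro ⟨k, rfl⟩
      exact hi (Finset.mem_image.2 ⟨Sum.inr k, Finset.mem_univ _, rfl⟩)
  refine hQ' ⟨Fin.cons i x, Fin.cons j y, ?_, fun k => ?_⟩
  · refine Injective.sumElim
      (Fin.cons_injective_iff.2 ⟨(hnot i hi).1, fun a b h => Sum.inl_injective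
        (hxy (a₁ := Sum.inl a) (a₂ := Sum.inl b) h)⟩)
      (Fin.cons_injective_iff.2 ⟨(hnot j hj).2, fun a b h => Sum.inr_injective
        (hxy (a₁ := Sum.inr a) (a₂ := Sum.inr b) h)⟩) ?_
    intro a b
    refine Fin.cases ?_ (fun a => ?_) a <;> refine Fin.cases ?_ (fun b => ?_) b
    · exact hij
    · exact fun h => (hnot i hi).2 ⟨b, h.symm⟩
    · exact fun h => (hnot j hj).1 ⟨a, h⟩
    · exact fun h => Sum.inl_ne_inr (hxy (a₁ := Sum.inl a) (a₂ := Sum.inr b) h)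
  · refine Fin.cases ?_ (fun k => ?_) k
    · exact hEij
    · exact hE k

lemma exists_cleanFrame {A : Finset V} (hA : Rich A) {K : ℕ} (hK : K = 7 ^ 50)
    (h0 : 8 + K + pageBound K ≤ finrank ℚ V) :
    ∃ (ι : Type) (_ : Fintype ι) (_ : DecidableEq ι) (c : V →ₗ[ℚ] (ι → ℚ)),
      CleanFrame (sym A) c ∧ finrank ℚ (LinearMap.ker c) ≤ kerBound K := by
  obtain ⟨n, c, hF, hn⟩ := exists_frame hA (by omega)
  rw [← hK] at hn
  have hfr := hF.finrank_ker_add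
  rw [Fintype.card_fin] at hfr
  obtain ⟨P, hPc, hP⟩ := exists_fat_cover (FatEdge (sym A) c) (M := matchBound K) (by
    rintro ⟨x, y, hxy, hE⟩
    have := hA.card_le_of_matching hF (κ := K) (by omega) (by rw [Fintype.card_fin]; omega) hxy hE
    rw [Fintype.card_fin] at this
    omega)
  have hC := hF.restrict P hP
  refine ⟨_, inferInstance, inferInstance, _, hC, ?_⟩
  have h1 := hC.toFrame.finrank_ker_add
  have h2 : Fintype.card {i // i ∉ P} + P.card = n := by
    have := Fintype.card_subtype_compl (fun i => i ∈ P)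
    rw [Fintype.card_coe, Fintype.card_fin] at this
    have h3 : P.card ≤ n := (Finset.card_le_univ P).trans (by simp)
    omega
  rw [kerBound]
  omega

end

section

variable {V : Type*} [AddCommGroup V] [Module ℚ V] [FiniteDimensional ℚ V]
variable {V' : Type*} [AddCommGroup V'] [Module ℚ V'] [FiniteDimensional ℚ V']
variable {ι α β : Type*}
variable {S : Set V} {A : Finset V} [DecidableEq ι] {c : V →ₗ[ℚ] (ι → ℚ)}

lemma CleanFrame.eq_or_eq_neg (hF : CleanFrame S c) (hneg : ∀ x ∈ S, -x ∈ S) {x z : V} (hx : x ∈ S)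
    (hz : z ∈ S) {i l : ι} (hil : i ≠ l) (hxi : c x i ≠ 0) (hxl : c x l ≠ 0) (hzi : c z i ≠ 0)
    (hzl : c z l ≠ 0) : z = x ∨ z = -x := by
  have hk : ∀ w ∈ S, c w i ≠ 0 → c w l ≠ 0 → ∀ k, k ≠ i → k ≠ l → c w k = 0 := by
    intro w hw hwi hwl k hki hkl
    rcases hF.supp w hw i l k hil hki.symm hkl.symm with h | h | h
    exacts [absurd h hwi, absurd h hwl, h]
  have hm := hF.minor x hx z hz i l hil hxi hxl hzi hzl
  have hor : c z i = c x i ∨ c z i = -c x i := by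
    rcases (hF.coef x hx i).resolve_left hxi with h | h <;>
      rcases (hF.coef z hz i).resolve_left hzi with h' | h' <;> rw [h, h'] <;> norm_num
  rcases hor with h | h
  · refine Or.inl (hF.clean x hx z hz i l hil hxi hxl ?_)
    rw [h, mul_comm] at hm
    ext k
    by_cases h1 : k = i
    · rw [h1, h]
    · by_cases h2 : k = l
      · rw [h2]; exact mul_right_cancel₀ hxi hm
      · rw [hk x hx hxi hxl k h1 h2, hk z hz hzi hzl k h1 h2]
  · refine Or.inr (hF.clean _ (hneg x hx) z hz i l hil ?_ ?_ ?_)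
    · rw [map_neg]; exact neg_ne_zero.2 hxi
    · rw [map_neg]; exact neg_ne_zero.2 hxl
    have hm' : c z l * c x i = -c x l * c x i := by rw [mul_comm, hm, h]; ring
    ext k
    rw [map_neg, Pi.neg_apply]
    by_cases h1 : k = i
    · rw [h1, h]
    · by_cases h2 : k = l
      · rw [h2]; exact mul_right_cancel₀ hxi hm'
      · rw [hk x hx hxi hxl k h1 h2, hk z hz hzi hzl k h1 h2, neg_zero]

lemma Frame.eq_single_or_neg (hF : Frame S c) {x : V} (hx : x ∈ S) {i : ι} (hi : c x i ≠ 0)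
    (h : ∀ l, l ≠ i → c x l = 0) : c x = Pi.single i 1 ∨ c x = -Pi.single i 1 := by
  rcases (hF.coef x hx i).resolve_left hi with h1 | h1
  · left
    ext k
    rw [Pi.single_apply]
    split_ifs with hk
    · rw [hk, h1]
    · exact h k hk
  · right
    ext k
    rw [Pi.neg_apply, Pi.single_apply]
    split_ifs with hk
    · rw [hk, h1]
    · rw [h k hk, neg_zero]

open Classical in
/-- The elements of `sym A` lying over the unit vector at `i`. -/
noncomputable def page (A : Finset V) (c : V →ₗ[ℚ] (ι → ℚ)) (i : ι) : Finset V :=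
  (A ∪ A.image fun x => -x).filter fun x => c x = Pi.single i 1

lemma mem_page {i : ι} {x : V} : x ∈ page A c i ↔ x ∈ sym A ∧ c x = Pi.single i 1 := by
  classical
  unfold page sym
  rw [Finset.mem_filter, Finset.mem_union, Finset.mem_image, Set.mem_ofPred_eq]
  refine and_congr_left' (or_congr_right ⟨?_, fun h => ⟨-x, h, neg_neg x⟩⟩)
  rintro ⟨y, hy, rfl⟩
  rwa [neg_neg]

open Classical in
/-- The elements of `A` lying over a signed unit vector at `i`. -/
noncomputable def pageIn (A : Finset V) (c : V →ₗ[ℚ] (ι → ℚ)) (i : ι) : Finset V :=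
  A.filter fun x => c x = Pi.single i 1 ∨ c x = -Pi.single i 1

lemma mem_pageIn {i : ι} {x : V} :
    x ∈ pageIn A c i ↔ x ∈ A ∧ (c x = Pi.single i 1 ∨ c x = -Pi.single i 1) := by
  classical
  unfold pageIn
  exact Finset.mem_filter

lemma pageIn_subset (i : ι) : pageIn A c i ⊆ A := fun _ hx => (mem_pageIn.1 hx).1

lemma card_pageIn_le (hA : Nonpar A) (i : ι) : (pageIn A c i).card ≤ (page A c i).card := by
  classical
  refine Finset.card_le_card_of_injOn (fun x => if c x = Pi.single i 1 then x else -x) ?_ ?_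
  · intro x hx
    obtain ⟨hxA, hx⟩ := mem_pageIn.1 hx
    simp only [Finset.mem_coe]
    split_ifs with h
    · exact mem_page.2 ⟨mem_sym_of_mem hxA, h⟩
    · refine mem_page.2 ⟨neg_mem_sym (mem_sym_of_mem hxA), ?_⟩
      rw [map_neg, hx.resolve_left h, neg_neg]
  · intro x hx y hy hxy
    have hxA := (mem_pageIn.1 hx).1
    have hyA := (mem_pageIn.1 hy).1
    simp only at hxy
    split_ifs at hxy with h1 h2 h2
    · exact hxy
    · exact (hA.2 x hxA y hyA (-1) (by rw [hxy]; module)).symm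
    · exact (hA.2 x hxA y hyA (-1) (by rw [← hxy]; module)).symm
    · exact neg_injective hxy

lemma rep_mem_pageIn {i : ι} {x : V} (hx : x ∈ sym A) (h : c x = Pi.single i 1) :
    rep A x ∈ pageIn A c i := by
  refine mem_pageIn.2 ⟨rep_mem hx, ?_⟩
  unfold rep
  split_ifs
  · exact Or.inl h
  · exact Or.inr (by rw [map_neg, h])

open Classical in
/-- The pages to which `s` is carried by adding an element of `sym A`. -/
noncomputable def links [Fintype ι] (A : Finset V) (c : V →ₗ[ℚ] (ι → ℚ)) (i : ι) (s : V) :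
    Finset ι :=
  Finset.univ.filter fun j => j ≠ i ∧ ∃ a ∈ sym A, c a i = -1 ∧ c a j ≠ 0 ∧ s + a ∈ sym A

lemma mem_links [Fintype ι] {i j : ι} {s : V} : j ∈ links A c i s ↔
    j ≠ i ∧ ∃ a ∈ sym A, c a i = -1 ∧ c a j ≠ 0 ∧ s + a ∈ sym A := by
  classical
  unfold links
  rw [Finset.mem_filter]
  exact and_iff_right (Finset.mem_univ _)

lemma Rich.le_card_page_add_card_links (hA : Rich A) [Fintype ι] (hF : CleanFrame (sym A) c)
    {i : ι} {s : V} (hs : s ∈ sym A) (hsi : c s = Pi.single i 1) :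
    finrank ℚ V + 2 ≤ (page A c i).card + (links A c i s).card := by
  classical
  have hneg : ∀ x ∈ sym A, -x ∈ sym A := fun x => neg_mem_sym
  have hex : ∀ j, ∃ a, j ∈ links A c i s → a ∈ sym A ∧ c a i = -1 ∧ c a j ≠ 0 := fun j => by
    by_cases hj : j ∈ links A c i s
    · obtain ⟨a, ha, h1, h2, -⟩ := (mem_links.1 hj).2
      exact ⟨a, fun _ => ⟨ha, h1, h2⟩⟩
    · exact ⟨0, fun h => absurd h hj⟩
  choose a ha using hex
  obtain ⟨R, hR⟩ : ∃ R, R = pageIn A c i ∪ (links A c i s).image fun j => rep A (a j) := ⟨_, rfl⟩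
  have hout : ∀ x ∈ A, x ∉ R → c x i ≠ 0 → ∃ l, l ≠ i ∧ c x l ≠ 0 := by
    intro x hx hxR hxi
    by_contra! h
    refine hxR (hR ▸ Finset.mem_union_left _ (mem_pageIn.2 ⟨hx, ?_⟩))
    exact hF.eq_single_or_neg (mem_sym_of_mem hx) hxi h
  have hcase : ∀ x ∈ A, ∀ y ∈ A, x ∉ R → y ∉ R → ∀ p q : ℚ, p ≠ 0 → s = p • x + q • y →
      c x i = 0 → False := by
    intro x hx y hy hxR hyR p q hp hpq hxi
    have hcoord : ∀ k, (Pi.single i 1 : ι → ℚ) k = p * c x k + q * c y k := fun k => by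
      rw [← hsi, hpq]; simp
    have h1 := hcoord i
    rw [Pi.single_eq_same, hxi, mul_zero, zero_add] at h1
    have hq0 : q ≠ 0 := by rintro rfl; norm_num at h1
    have hyi : c y i ≠ 0 := by intro h; rw [h] at h1; norm_num at h1
    obtain ⟨l, hli, hyl⟩ := hout y hy hyR hyi
    have hl := hcoord l
    rw [Pi.single_eq_of_ne hli] at hl
    have hxl : c x l ≠ 0 := by
      intro h
      rw [h, mul_zero, zero_add] at hl
      exact mul_ne_zero hq0 hyl hl.symm
    have hys := mem_sym_of_mem hy
    have hxs := mem_sym_of_mem hx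
    have hq : q = 1 ∨ q = -1 := by
      rcases (hF.coef y hys i).resolve_left hyi with h | h <;> rw [h] at h1
      · left; linarith
      · right; linarith
    have hp1 : p = 1 ∨ p = -1 := by
      rcases (hF.coef y hys l).resolve_left hyl with h | h <;>
        rcases (hF.coef x hxs l).resolve_left hxl with h' | h' <;>
        rcases hq with rfl | rfl <;> rw [h, h'] at hl <;>
        first
        | exact Or.inl (by linarith)
        | exact Or.inr (by linarith)
    have hsg : ∀ t : ℚ, (t = 1 ∨ t = -1) → ∀ x ∈ sym A, t • x ∈ sym A := by
      rintro t (rfl | rfl) x hx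
      · rwa [one_smul]
      · rw [neg_one_smul]; exact hneg x hx
    have hlink : l ∈ links A c i s := by
      refine mem_links.2 ⟨hli, (-q) • y, hsg _ ?_ y hys, ?_, ?_, ?_⟩
      · rcases hq with rfl | rfl <;> norm_num
      · rw [map_smul, Pi.smul_apply, smul_eq_mul, neg_mul, ← h1]
      · rw [map_smul, Pi.smul_apply, smul_eq_mul]
        exact mul_ne_zero (neg_ne_zero.2 hq0) hyl
      · rw [show s + (-q) • y = p • x by rw [hpq]; module]
        exact hsg p hp1 x hxs
    obtain ⟨ha1, ha2, ha3⟩ := ha l hlink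
    refine hyR (hR ▸ Finset.mem_union_right _ (Finset.mem_image.2 ⟨l, hlink, ?_⟩))
    refine (hA.nonpar.eq_rep hy (hF.eq_or_eq_neg hneg ha1 hys hli.symm ?_ ha3 hyi hyl)).symm
    rw [ha2]; norm_num
  have key := hA.le_card (R := R) hs (by
      rw [hR]
      refine Finset.union_subset (pageIn_subset i) fun x hx => ?_
      obtain ⟨j, hj, rfl⟩ := Finset.mem_image.1 hx
      exact rep_mem (ha j hj).1)
    (hR ▸ Finset.mem_union_left _ (rep_mem_pageIn hs hsi)) (by
      intro x hx y hy hxR hyR hxy p q hpq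
      have hcoord : ∀ k, (Pi.single i 1 : ι → ℚ) k = p * c x k + q * c y k := fun k => by
        rw [← hsi, hpq]; simp
      have hnz : ∀ x ∈ A, x ∉ R → ∀ t : ℚ, s ≠ t • x := by
        intro x hx hxR t hst
        have h1 : ∀ k, (Pi.single i 1 : ι → ℚ) k = t * c x k := fun k => by
          rw [← hsi, hst]; simp
        have h2 := h1 i
        rw [Pi.single_eq_same] at h2
        have ht0 : t ≠ 0 := by rintro rfl; norm_num at h2
        obtain ⟨l, hli, hxl⟩ := hout x hx hxR (by intro h; rw [h] at h2; norm_num at h2)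
        have h3 := h1 l
        rw [Pi.single_eq_of_ne hli] at h3
        exact mul_ne_zero ht0 hxl h3.symm
      have hp : p ≠ 0 := by rintro rfl; exact hnz y hy hyR q (by rw [hpq]; simp)
      have hq : q ≠ 0 := by rintro rfl; exact hnz x hx hxR p (by rw [hpq]; simp)
      have hxi : c x i ≠ 0 := fun h => hcase x hx y hy hxR hyR p q hp hpq h
      have hyi : c y i ≠ 0 := fun h => hcase y hy x hx hyR hxR q p hq (by rw [hpq]; abel) h
      obtain ⟨l, hli, hxl⟩ := hout x hx hxR hxi
      have hyl : c y l ≠ 0 := by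
        intro h
        have h1 := hcoord l
        rw [Pi.single_eq_of_ne hli, h, mul_zero, add_zero] at h1
        exact mul_ne_zero hp hxl h1.symm
      have := hF.eq_or_eq_neg hneg (mem_sym_of_mem hx) (mem_sym_of_mem hy) hli.symm hxi hxl hyi hyl
      rcases this with h | h
      · exact hxy h.symm
      · exact hxy (hA.nonpar.2 x hx y hy (-1) (by rw [h]; module)).symm)
  have h1 := Finset.card_union_le (pageIn A c i) ((links A c i s).image fun j => rep A (a j))
  have h2 : ((links A c i s).image fun j => rep A (a j)).card ≤ _ := Finset.card_image_le
  have h3 := card_pageIn_le (c := c) hA.nonpar i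
  rw [hR] at key
  omega

lemma card_links_lt [Fintype ι] (i : ι) (s : V) : (links A c i s).card + 1 ≤ Fintype.card ι := by
  have h : links A c i s ⊆ Finset.univ.erase i := fun j hj =>
    Finset.mem_erase.2 ⟨(mem_links.1 hj).1, Finset.mem_univ _⟩
  have h1 := Finset.card_le_card h
  rw [Finset.card_erase_of_mem (Finset.mem_univ _), Finset.card_univ] at h1
  have : 0 < Fintype.card ι := Fintype.card_pos_iff.2 ⟨i⟩
  omega

lemma Frame.exists_mem_page (hF : Frame (sym A) c) (i : ι) : ∃ s, s ∈ page A c i := by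
  obtain ⟨s, hs, hsi⟩ := hF.star i
  exact ⟨s, mem_page.2 ⟨hs, hsi⟩⟩

lemma Rich.le_card_page (hA : Rich A) [Fintype ι] (hF : CleanFrame (sym A) c) (i : ι) :
    finrank ℚ (LinearMap.ker c) + 3 ≤ (page A c i).card := by
  obtain ⟨s, hs⟩ := hF.exists_mem_page i
  have h1 := hA.le_card_page_add_card_links hF (mem_page.1 hs).1 (mem_page.1 hs).2
  have h2 := card_links_lt (A := A) (c := c) i s
  have h3 := hF.finrank_ker_add
  omega

lemma Rich.exists_common_links (hA : Rich A) [Fintype ι] (hF : CleanFrame (sym A) c) (i : ι)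
    {C : ℕ} (hC : (page A c i).card ≤ C) :
    ∃ J : Finset ι, Fintype.card ι ≤ J.card + C * C ∧ ∀ j ∈ J, j ≠ i ∧
      ∃ a ∈ sym A, c a i = -1 ∧ c a j ≠ 0 ∧ ∀ s ∈ page A c i, s + a ∈ sym A := by
  classical
  refine ⟨Finset.univ.filter fun j => ∀ s ∈ page A c i, j ∈ links A c i s, ?_, ?_⟩
  · have hsub : (Finset.univ : Finset ι) ⊆
        (Finset.univ.filter fun j => ∀ s ∈ page A c i, j ∈ links A c i s) ∪
          (page A c i).biUnion fun s => (links A c i s)ᶜ := by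
      intro j _
      rw [Finset.mem_union, Finset.mem_filter, Finset.mem_biUnion]
      by_cases h : ∀ s ∈ page A c i, j ∈ links A c i s
      · exact Or.inl ⟨Finset.mem_univ _, h⟩
      · push Not at h
        obtain ⟨s, hs, hj⟩ := h
        exact Or.inr ⟨s, hs, Finset.mem_compl.2 hj⟩
    have h1 := (Finset.card_le_card hsub).trans (Finset.card_union_le _ _)
    have h2 : ((page A c i).biUnion fun s => (links A c i s)ᶜ).card ≤ (page A c i).card * C := by
      refine Finset.card_biUnion_le_card_mul _ _ _ fun s hs => ?_
      have h3 := hA.le_card_page_add_card_links hF (mem_page.1 hs).1 (mem_page.1 hs).2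
      have h4 := hF.finrank_ker_add
      rw [Finset.card_compl]
      omega
    have h3 : (page A c i).card * C ≤ C * C := Nat.mul_le_mul_right _ hC
    rw [Finset.card_univ] at h1
    omega
  · intro j hj
    have hj' := (Finset.mem_filter.1 hj).2
    obtain ⟨s, hs⟩ := hF.exists_mem_page i
    obtain ⟨hji, a, ha, hai, haj, -⟩ := mem_links.1 (hj' s hs)
    refine ⟨hji, a, ha, hai, haj, fun s' hs' => ?_⟩
    obtain ⟨-, a', ha', hai', haj', hsa⟩ := mem_links.1 (hj' s' hs')
    rcases hF.eq_or_eq_neg (fun x => neg_mem_sym) ha ha' hji.symm (by rw [hai]; norm_num) haj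
      (by rw [hai']; norm_num) haj' with h | h
    · rwa [← h]
    · rw [h, map_neg, Pi.neg_apply, hai] at hai'
      norm_num at hai'

lemma Frame.map_add_link (hF : Frame S c) {i j : ι} (hij : j ≠ i) {s a : V}
    (hs : c s = Pi.single i 1) (ha : a ∈ S) (hai : c a i = -1) (haj : c a j ≠ 0) :
    c (s + a) = c a j • Pi.single j 1 := by
  ext k
  rw [map_add, hs, Pi.add_apply, Pi.smul_apply, Pi.single_apply, Pi.single_apply]
  by_cases hki : k = i
  · rw [hki, hai, if_pos rfl, if_neg hij.symm]; norm_num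
  · by_cases hkj : k = j
    · rw [hkj, if_neg hij, if_pos rfl]; simp
    · rw [if_neg hki, if_neg hkj]
      rcases hF.supp a ha i j k hij.symm (Ne.symm hki) (Ne.symm hkj) with h | h | h
      · rw [hai] at h; norm_num at h
      · exact absurd h haj
      · rw [h]; simp

lemma smul_mem_sym {x : V} (hx : x ∈ sym A) {t : ℚ} (ht : t = 1 ∨ t = -1) : t • x ∈ sym A := by
  rcases ht with rfl | rfl
  · rwa [one_smul]
  · rw [neg_one_smul]; exact neg_mem_sym hx

lemma Frame.link_mem_page (hF : Frame (sym A) c) {i j : ι} (hij : j ≠ i) {s a : V}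
    (hs : s ∈ page A c i) (ha : a ∈ sym A) (hai : c a i = -1) (haj : c a j ≠ 0)
    (hsa : s + a ∈ sym A) : c a j • (s + a) ∈ page A c j := by
  have h1 := (hF.coef a ha j).resolve_left haj
  refine mem_page.2 ⟨smul_mem_sym hsa h1, ?_⟩
  rw [map_smul, hF.map_add_link hij (mem_page.1 hs).2 ha hai haj, smul_smul]
  rcases h1 with h | h <;> rw [h] <;> norm_num

/-- The elements of `S` in the kernel, together with the differences of the page at `i`. -/
def kerDiff (A : Finset V) (c : V →ₗ[ℚ] (ι → ℚ)) (i : ι) : Set (LinearMap.ker c) :=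
  {x | (x : V) ∈ sym A ∨ ∃ f ∈ page A c i, ∃ g ∈ page A c i, (x : V) = f - g}

lemma Frame.span_kerDiff (hF : Frame (sym A) c) (i : ι) : span ℚ (kerDiff A c i) = ⊤ := by
  apply Submodule.map_injective_of_injective (LinearMap.ker c).injective_subtype
  rw [Submodule.map_top, Submodule.range_subtype]
  refine le_antisymm ?_ ?_
  · rintro _ ⟨x, -, rfl⟩
    exact x.2
  · rw [Submodule.map_span]
    conv_lhs => rw [hF.ker_eq]
    refine span_mono fun x hx => ⟨⟨x, hx.2⟩, Or.inl hx.1, rfl⟩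

lemma Frame.isModular_kerDiff [Fintype ι] (hF : Frame (sym A) c) (h : IsModular 3 (sym A)) {i : ι}
    {J : Finset ι} (hJ : finrank ℚ (LinearMap.ker c) ≤ J.card) (hJa : ∀ j ∈ J, j ≠ i ∧
      ∃ a ∈ sym A, c a i = -1 ∧ c a j ≠ 0 ∧ ∀ s ∈ page A c i, s + a ∈ sym A) :
    IsModular 3 (kerDiff A c i) := by
  classical
  obtain ⟨κ, hκ⟩ : ∃ κ, κ = finrank ℚ (LinearMap.ker c) := ⟨_, rfl⟩
  rw [← hκ] at hJ
  have hfr := hF.finrank_ker_add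
  rw [← hκ] at hfr
  obtain ⟨ω, hω0, hω⟩ := h.exists_form (ι := Fin κ ⊕ ι) (by
    rw [Fintype.card_sum, Fintype.card_fin, hfr])
  choose s hs hcs using hF.star
  have hcli : LinearIndependent ℚ (c ∘ s) := by
    have : c ∘ s = fun i => Pi.single i 1 := funext hcs
    rw [this]
    have h2 := (Pi.basisFun ℚ ι).linearIndependent
    have h3 : ⇑(Pi.basisFun ℚ ι) = fun i => Pi.single i 1 := funext fun i => by
      rw [Pi.basisFun_apply]
    rwa [h3] at h2
  refine IsModular.of_form (ι := Fin κ)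
    (ω := (freezeRight ω s).compLinearMap (LinearMap.ker c).subtype) ?_ ?_ (by
      rw [Fintype.card_fin, hκ])
  · obtain ⟨x, hx, hxli, hxK⟩ := exists_basis_of_span hF.ker_eq
    have hxk : ∀ t, x t ∈ LinearMap.ker c := fun t => hxK ▸ subset_span ⟨t, rfl⟩
    subst hκ
    have hli := linearIndependent_elim_of_ker (π := c) hxli
      (fun t => LinearMap.mem_ker.1 (hxk t)) hcli
    have hne := (map_ne_zero_iff_linearIndependent hω0 (by
      rw [Fintype.card_sum, Fintype.card_fin, hfr])).2 hli
    intro h0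
    apply hne
    have := congrArg (fun f => f fun t => (⟨x t, hxk t⟩ : LinearMap.ker c)) h0
    exact this
  · intro v hv
    let e : Fin κ → ι := fun t => (J.equivFin.symm (Fin.castLE hJ t)).1
    have heJ : ∀ t, e t ∈ J := fun t => (J.equivFin.symm (Fin.castLE hJ t)).2
    have he : Injective e := fun a b hab => by
      have := J.equivFin.symm.injective (Subtype.ext hab)
      exact Fin.castLE_injective hJ this
    have hex : ∀ t, ∃ d ∈ sym A, ∃ w ∈ sym A, c w = Pi.single (e t) 1 ∧
        ∃ q : ℚ, d - v t = q • w := by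
      intro t
      rcases hv t with h1 | ⟨f, hf, g, hg, hfg⟩
      · exact ⟨v t, h1, s (e t), hs _, hcs _, 0, by simp⟩
      · obtain ⟨hne, a, ha, hai, haj, haS⟩ := hJa _ (heJ t)
        have hw := mem_page.1 (hF.link_mem_page hne hg ha hai haj (haS g hg))
        refine ⟨f + a, haS f hf, _, hw.1, hw.2, c a (e t), ?_⟩
        rw [hfg, smul_smul]
        have : c a (e t) * c a (e t) = 1 := by
          rcases (hF.coef a ha (e t)).resolve_left haj with h | h <;> rw [h] <;> norm_num
        rw [this]; module
    choose d hd w hw hcw q hq using hex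
    have hcs' : ∀ l, c (extend e w s l) = Pi.single l 1 := by
      intro l
      by_cases hl : ∃ t, e t = l
      · obtain ⟨t, rfl⟩ := hl
        rw [he.extend_apply, hcw]
      · rw [extend_apply' _ _ _ hl, hcs]
    have hs' : ∀ l, extend e w s l ∈ sym A := by
      intro l
      by_cases hl : ∃ t, e t = l
      · obtain ⟨t, rfl⟩ := hl
        rw [he.extend_apply]; exact hw t
      · rw [extend_apply' _ _ _ hl]; exact hs l
    obtain ⟨z, hz, hz3⟩ := hω (Sum.elim d (extend e w s)) (by
      rintro (t | l)
      exacts [hd t, hs' l])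
    refine ⟨z, ?_, hz3⟩
    rw [← hz, AlternatingMap.compLinearMap_apply, freezeRight_apply]
    symm
    refine map_elim_eq ω (LinearMap.ker c) (fun t => ?_) (fun t => (v t).2) (by
      rw [Fintype.card_fin, hκ]) (fun l => ?_)
    · simp only [Submodule.subtype_apply]
      rw [hq]
      exact smul_mem _ _ (subset_span ⟨e t, by rw [he.extend_apply]⟩)
    · rw [LinearMap.mem_ker, map_sub, hcs', hcs, sub_self]

lemma Frame.exists_translate (hF : Frame (sym A) c) (i : ι) :
    ∃ F : Finset (LinearMap.ker c), F.card = (page A c i).card ∧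
      (∀ x ∈ F, ∀ y ∈ F, x - y ∈ kerDiff A c i) ∧
      ∀ f ∈ page A c i, ∀ g ∈ page A c i, ∃ x ∈ F, ∃ y ∈ F, f - g = ((x - y : LinearMap.ker c) : V) := by
  classical
  obtain ⟨s, hs⟩ := hF.exists_mem_page i
  have hker : ∀ f ∈ page A c i, f - s ∈ LinearMap.ker c := fun f hf => by
    rw [LinearMap.mem_ker, map_sub, (mem_page.1 hf).2, (mem_page.1 hs).2, sub_self]
  refine ⟨(page A c i).attach.image fun f => ⟨f.1 - s, hker f.1 f.2⟩, ?_, ?_, ?_⟩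
  · rw [Finset.card_image_of_injective, Finset.card_attach]
    intro f g hfg
    exact Subtype.ext (sub_left_injective (congrArg Subtype.val hfg))
  · intro x hx y hy
    obtain ⟨f, -, rfl⟩ := Finset.mem_image.1 hx
    obtain ⟨g, -, rfl⟩ := Finset.mem_image.1 hy
    refine Or.inr ⟨f.1, f.2, g.1, g.2, ?_⟩
    simp
  · intro f hf g hg
    refine ⟨_, Finset.mem_image.2 ⟨⟨f, hf⟩, Finset.mem_attach _ _, rfl⟩, _,
      Finset.mem_image.2 ⟨⟨g, hg⟩, Finset.mem_attach _ _, rfl⟩, ?_⟩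
    simp

lemma Rich.card_page_le_pow (hA : Rich A) [Fintype ι] (i : ι) :
    (page A c i).card ≤ 7 ^ (finrank ℚ (LinearMap.ker c) + 1) := by
  refine (card_supported_le hA.modular hA.span_eq c {i} (fun x hx => (mem_page.1 hx).1)
    fun x hx k hk => ?_)
  rw [(mem_page.1 hx).2, Pi.single_eq_of_ne (by simpa using hk)]

open Classical in
/-- The elements of `A` in the kernel of `c`. -/
noncomputable def kerPart (A : Finset V) (c : V →ₗ[ℚ] (ι → ℚ)) : Finset V :=
  A.filter fun x => c x = 0

lemma mem_kerPart {x : V} : x ∈ kerPart A c ↔ x ∈ A ∧ c x = 0 := by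
  classical
  unfold kerPart
  exact Finset.mem_filter

lemma Rich.card_kerPart_le_pow (hA : Rich A) [Fintype ι] :
    (kerPart A c).card ≤ 7 ^ (finrank ℚ (LinearMap.ker c) + 1) := by
  refine (card_supported_le hA.modular hA.span_eq c ∅
    (fun x hx => mem_sym_of_mem (mem_kerPart.1 hx).1) fun x hx k _ => ?_).trans
    (Nat.pow_le_pow_right (by norm_num) (by simp))
  rw [(mem_kerPart.1 hx).2]; rfl

open Classical in
/-- The pages with two elements differing by a multiple of `y`. -/
noncomputable def parallelPages [Fintype ι] (A : Finset V) (c : V →ₗ[ℚ] (ι → ℚ)) (y : V) :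
    Finset ι :=
  Finset.univ.filter fun i => ∃ f ∈ page A c i, ∃ g ∈ page A c i, ∃ t : ℚ, y = t • (f - g)

lemma mem_parallelPages [Fintype ι] {y : V} {i : ι} : i ∈ parallelPages A c y ↔
    ∃ f ∈ page A c i, ∃ g ∈ page A c i, ∃ t : ℚ, y = t • (f - g) := by
  classical
  unfold parallelPages
  rw [Finset.mem_filter]
  exact and_iff_right (Finset.mem_univ _)

lemma exists_page_smul {i : ι} {x : V} (hx : x ∈ pageIn A c i) :
    ∃ f ∈ page A c i, ∃ ε : ℚ, (ε = 1 ∨ ε = -1) ∧ x = ε • f := by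
  obtain ⟨hxA, h⟩ := mem_pageIn.1 hx
  rcases h with h | h
  · exact ⟨x, mem_page.2 ⟨mem_sym_of_mem hxA, h⟩, 1, Or.inl rfl, by simp⟩
  · exact ⟨-x, mem_page.2 ⟨neg_mem_sym (mem_sym_of_mem hxA), by rw [map_neg, h, neg_neg]⟩, -1,
      Or.inr rfl, by simp⟩

lemma Rich.le_card_kerPart_add (hA : Rich A) [Fintype ι] (hF : CleanFrame (sym A) c) {y : V}
    (hy : y ∈ A) (hcy : c y = 0) : finrank ℚ V + 2 ≤
      (kerPart A c).card + ∑ i ∈ parallelPages A c y, (page A c i).card := by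
  classical
  obtain ⟨R, hR⟩ : ∃ R, R = kerPart A c ∪ (parallelPages A c y).biUnion (pageIn A c) := ⟨_, rfl⟩
  have hout : ∀ x ∈ A, x ∉ R → c x ≠ 0 ∧ ∀ i ∈ parallelPages A c y, x ∉ pageIn A c i := by
    intro x hx hxR
    rw [hR, Finset.mem_union, not_or, Finset.mem_biUnion] at hxR
    exact ⟨fun h => hxR.1 (mem_kerPart.2 ⟨hx, h⟩), fun i hi h => hxR.2 ⟨i, hi, h⟩⟩
  have hy0 : y ≠ 0 := hA.nonpar.1 y hy
  have key := hA.rich y hy R (by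
      rw [hR]
      refine Finset.union_subset (fun x hx => (mem_kerPart.1 hx).1) ?_
      exact Finset.biUnion_subset.2 fun i _ => pageIn_subset i)
    (hR ▸ Finset.mem_union_left _ (mem_kerPart.2 ⟨hy, hcy⟩)) (by
    intro x hx z hz hxR hzR hxz p q hpq
    have hcoord : ∀ k, p * c x k + q * c z k = 0 := fun k => by
      have : c y k = p * c x k + q * c z k := by rw [hpq]; simp
      rw [← this, hcy]; rfl
    obtain ⟨hx0, hxp⟩ := hout x hx hxR
    obtain ⟨hz0, -⟩ := hout z hz hzR
    obtain ⟨i, hxi⟩ : ∃ i, c x i ≠ 0 := Function.ne_iff.1 hx0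
    obtain ⟨i', hzi'⟩ : ∃ i, c z i ≠ 0 := Function.ne_iff.1 hz0
    have hp : p ≠ 0 := by
      rintro rfl
      have h1 := hcoord i'
      rw [zero_mul, zero_add] at h1
      have hq := (mul_eq_zero.1 h1).resolve_right hzi'
      exact hy0 (by rw [hpq, hq]; simp)
    have hq : q ≠ 0 := by
      rintro rfl
      have h1 := hcoord i
      rw [zero_mul, add_zero] at h1
      exact hp ((mul_eq_zero.1 h1).resolve_right hxi)
    have hsupp : ∀ k, c x k ≠ 0 → c z k ≠ 0 := fun k hk h => by
      have h1 := hcoord k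
      rw [h, mul_zero, add_zero] at h1
      exact mul_ne_zero hp hk h1
    have hsupp' : ∀ k, c x k = 0 → c z k = 0 := fun k hk => by
      have h1 := hcoord k
      rw [hk, mul_zero, zero_add] at h1
      exact (mul_eq_zero.1 h1).resolve_left hq
    by_cases hl : ∃ l, l ≠ i ∧ c x l ≠ 0
    · obtain ⟨l, hli, hxl⟩ := hl
      rcases hF.eq_or_eq_neg (fun x => neg_mem_sym) (mem_sym_of_mem hx) (mem_sym_of_mem hz)
        hli.symm hxi hxl (hsupp i hxi) (hsupp l hxl) with h | h
      · exact hxz h.symm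
      · exact hxz (hA.nonpar.2 x hx z hz (-1) (by rw [h]; module)).symm
    · push Not at hl
      have hxi' : x ∈ pageIn A c i :=
        mem_pageIn.2 ⟨hx, hF.eq_single_or_neg (mem_sym_of_mem hx) hxi hl⟩
      have hzi : z ∈ pageIn A c i :=
        mem_pageIn.2 ⟨hz, hF.eq_single_or_neg (mem_sym_of_mem hz) (hsupp i hxi)
          fun k hk => hsupp' k (hl k hk)⟩
      refine hxp i (mem_parallelPages.2 ?_) hxi'
      obtain ⟨f, hf, ε, -, rfl⟩ := exists_page_smul hxi'
      obtain ⟨g, hg, δ, -, rfl⟩ := exists_page_smul hzi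
      refine ⟨f, hf, g, hg, p * ε, ?_⟩
      have h1 := hcoord i
      rw [map_smul, map_smul, (mem_page.1 hf).2, (mem_page.1 hg).2] at h1
      simp only [Pi.smul_apply, Pi.single_eq_same, smul_eq_mul, mul_one] at h1
      have h2 : q * δ = -(p * ε) := by linarith
      rw [hpq, smul_smul, smul_smul, h2]; module)
  have h1 := Finset.card_union_le (kerPart A c) ((parallelPages A c y).biUnion (pageIn A c))
  have h2 : ((parallelPages A c y).biUnion (pageIn A c)).card ≤
      ∑ i ∈ parallelPages A c y, (page A c i).card :=
    Finset.card_biUnion_le.trans (Finset.sum_le_sum fun i _ => card_pageIn_le hA.nonpar i)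
  rw [hR] at key
  omega

lemma Rich.card_page_eq (hA : Rich A) [Fintype ι] (hF : CleanFrame (sym A) c) {C : ℕ}
    (hC : C = 7 ^ (finrank ℚ (LinearMap.ker c) + 1)) (hm : C * C + C < Fintype.card ι) (i : ι) :
    (page A c i).card = finrank ℚ (LinearMap.ker c) + 3 ∧ IsModular 3 (kerDiff A c i) := by
  have h0 := hA.le_card_page hF i
  have h1 : (page A c i).card ≤ C := hC ▸ hA.card_page_le_pow i
  obtain ⟨J, hJ, hJa⟩ := hA.exists_common_links hF i h1
  have hmod := hF.toFrame.isModular_kerDiff hA.modular (J := J) (by omega) hJa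
  refine ⟨le_antisymm ?_ h0, hmod⟩
  obtain ⟨F, hFc, hFS, -⟩ := hF.toFrame.exists_translate i
  rw [← hFc]
  exact card_le_of_differences hmod (hF.toFrame.span_kerDiff i) hFS

lemma Rich.parallel_of_mem_kerPart (hA : Rich A) [Fintype ι] (hF : CleanFrame (sym A) c) {C : ℕ}
    (hC : C = 7 ^ (finrank ℚ (LinearMap.ker c) + 1))
    (hm : C * (C * C + 2) < Fintype.card ι) (i : ι) {y : V} (hy : y ∈ kerPart A c) :
    ∃ f ∈ page A c i, ∃ g ∈ page A c i, ∃ t : ℚ, y = t • (f - g) := by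
  classical
  have hC1 : 1 ≤ C := hC ▸ Nat.one_le_pow _ _ (by norm_num)
  have hm' : C * C + C < Fintype.card ι := by nlinarith
  have h1 : ∀ i, (page A c i).card ≤ C := fun i => hC ▸ hA.card_page_le_pow i
  obtain ⟨J, hJ, hJa⟩ := hA.exists_common_links hF i (h1 i)
  have hk := hA.le_card_kerPart_add hF (mem_kerPart.1 hy).1 (mem_kerPart.1 hy).2
  have h2 : (kerPart A c).card ≤ C := hC ▸ hA.card_kerPart_le_pow
  have h3 : ∑ i ∈ parallelPages A c y, (page A c i).card ≤ (parallelPages A c y).card * C := by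
    rw [← smul_eq_mul]
    exact Finset.sum_le_card_nsmul _ _ _ fun i _ => h1 i
  have h4 := hF.finrank_ker_add
  have h5 : C * C < (parallelPages A c y).card := by
    by_contra! h
    have := Nat.mul_le_mul_right C h
    nlinarith
  obtain ⟨j, hj, hjJ⟩ : ∃ j ∈ parallelPages A c y, j ∈ J := by
    by_contra! h
    have hd : Disjoint (parallelPages A c y) J := Finset.disjoint_left.2 h
    have := Finset.card_le_univ (parallelPages A c y ∪ J)
    rw [Finset.card_union_of_disjoint hd] at this
    omega
  obtain ⟨hji, a, ha, hai, haj, hS⟩ := hJa j hjJ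
  have hβ := (hF.coef a ha j).resolve_left haj
  have hβ0 : c a j ≠ 0 := haj
  have himg : (page A c i).image (fun s => c a j • (s + a)) = page A c j := by
    apply Finset.eq_of_subset_of_card_le
    · intro x hx
      obtain ⟨s, hs, rfl⟩ := Finset.mem_image.1 hx
      exact hF.toFrame.link_mem_page hji hs ha hai haj (hS s hs)
    · rw [Finset.card_image_of_injective, (hA.card_page_eq hF hC hm' i).1,
        (hA.card_page_eq hF hC hm' j).1]
      intro s s' hss
      exact add_left_injective a (smul_right_injective V hβ0 hss)
  obtain ⟨f, hf, g, hg, t, hyt⟩ := mem_parallelPages.1 hj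
  rw [← himg] at hf hg
  obtain ⟨f', hf', rfl⟩ := Finset.mem_image.1 hf
  obtain ⟨g', hg', rfl⟩ := Finset.mem_image.1 hg
  exact ⟨f', hf', g', hg', t * c a j, by rw [hyt]; module⟩

lemma Rich.card_kerPart_le (hA : Rich A) [Fintype ι] (hF : CleanFrame (sym A) c) {C : ℕ}
    (hC : C = 7 ^ (finrank ℚ (LinearMap.ker c) + 1)) (hm : C * (C * C + 2) < Fintype.card ι) :
    2 * ((kerPart A c).card : ℤ) ≤ finrank ℚ (LinearMap.ker c) *
      (finrank ℚ (LinearMap.ker c) - 1) + 6 * (finrank ℚ (LinearMap.ker c) - 1) + 2 := by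
  classical
  have hC1 : 1 ≤ C := hC ▸ Nat.one_le_pow _ _ (by norm_num)
  have hm' : C * C + C < Fintype.card ι := by nlinarith
  obtain ⟨i⟩ : Nonempty ι := Fintype.card_pos_iff.1 (by omega)
  obtain ⟨F, hFc, hFS, hFd⟩ := hF.toFrame.exists_translate i
  obtain ⟨hcard, hmod⟩ := hA.card_page_eq hF hC hm' i
  have hsub : ∀ x, x ∈ (kerPart A c).subtype (· ∈ LinearMap.ker c) ↔ (x : V) ∈ kerPart A c :=
    fun x => Finset.mem_subtype
  have hcY : ((kerPart A c).subtype (· ∈ LinearMap.ker c)).card = (kerPart A c).card := by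
    rw [Finset.card_subtype, Finset.filter_true_of_mem]
    intro x hx
    exact LinearMap.mem_ker.2 (mem_kerPart.1 hx).2
  rw [← hcY]
  refine card_directions_le hmod (hF.toFrame.span_kerDiff i) hFS (by omega) ⟨?_, ?_⟩ ?_
  · intro x hx h0
    exact hA.nonpar.1 _ (mem_kerPart.1 ((hsub x).1 hx)).1 (congrArg Subtype.val h0)
  · intro x hx y hy t hxy
    exact Subtype.ext (hA.nonpar.2 _ (mem_kerPart.1 ((hsub x).1 hx)).1 _
      (mem_kerPart.1 ((hsub y).1 hy)).1 t (congrArg Subtype.val hxy))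
  · intro y hy
    obtain ⟨f, hf, g, hg, t, hyt⟩ := hA.parallel_of_mem_kerPart hF hC hm i ((hsub y).1 hy)
    obtain ⟨x, hx, x', hx', hxx⟩ := hFd f hf g hg
    exact ⟨x, hx, x', hx', t, Subtype.ext (by rw [hyt, hxx]; rfl)⟩

lemma Rich.card_le_of_cleanFrame (hA : Rich A) [Fintype ι] (hF : CleanFrame (sym A) c) {C : ℕ}
    (hC : C = 7 ^ (finrank ℚ (LinearMap.ker c) + 1)) (hm : C * (C * C + 2) < Fintype.card ι) :
    2 * (A.card : ℤ) ≤ finrank ℚ V * (finrank ℚ V + 1) + 4 * (finrank ℚ V - 1) := by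
  classical
  have hC1 : 1 ≤ C := hC ▸ Nat.one_le_pow _ _ (by norm_num)
  have hm' : C * C + C < Fintype.card ι := by nlinarith
  let P : Finset V := A.filter fun x => ∃ i j, i ≠ j ∧ c x i ≠ 0 ∧ c x j ≠ 0
  have hcover : A ⊆ (kerPart A c ∪ Finset.univ.biUnion (pageIn A c)) ∪ P := by
    intro x hx
    rw [Finset.mem_union, Finset.mem_union]
    by_cases h0 : c x = 0
    · exact Or.inl (Or.inl (mem_kerPart.2 ⟨hx, h0⟩))
    obtain ⟨i, hi⟩ := Function.ne_iff.1 h0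
    by_cases hl : ∃ l, l ≠ i ∧ c x l ≠ 0
    · obtain ⟨l, hli, hl⟩ := hl
      exact Or.inr (Finset.mem_filter.2 ⟨hx, i, l, hli.symm, hi, hl⟩)
    · push Not at hl
      exact Or.inl (Or.inr (Finset.mem_biUnion.2 ⟨i, Finset.mem_univ _, mem_pageIn.2 ⟨hx,
        hF.eq_single_or_neg (mem_sym_of_mem hx) hi hl⟩⟩))
  have hP : P.card ≤ (Fintype.card ι).choose 2 := by
    rw [← Finset.card_univ, ← Finset.card_powersetCard]
    have hsupp : ∀ x ∈ A, ∀ i j, i ≠ j → c x i ≠ 0 → c x j ≠ 0 →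
        (Finset.univ.filter fun k => c x k ≠ 0) = {i, j} := by
      intro x hx i j hij hi hj
      ext k
      simp only [Finset.mem_filter, Finset.mem_univ, true_and, Finset.mem_insert,
        Finset.mem_singleton]
      constructor
      · intro hk
        by_contra! h
        rcases hF.supp x (mem_sym_of_mem hx) i j k hij (Ne.symm h.1) (Ne.symm h.2) with h | h | h
        exacts [hi h, hj h, hk h]
      · rintro (rfl | rfl) <;> assumption
    refine Finset.card_le_card_of_injOn (fun x => Finset.univ.filter fun k => c x k ≠ 0) ?_ ?_
    · intro x hx
      obtain ⟨hxA, i, j, hij, hi, hj⟩ := Finset.mem_filter.1 hx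
      refine Finset.mem_powersetCard.2 ⟨Finset.subset_univ _, ?_⟩
      exact (congrArg Finset.card (hsupp x hxA i j hij hi hj)).trans (Finset.card_pair hij)
    · intro x hx z hz hxz
      obtain ⟨hxA, i, j, hij, hi, hj⟩ := Finset.mem_filter.1 hx
      obtain ⟨hzA, -⟩ := Finset.mem_filter.1 hz
      have hxz' : (Finset.univ.filter fun k => c x k ≠ 0) =
        Finset.univ.filter fun k => c z k ≠ 0 := hxz
      have hiff : ∀ k, c x k ≠ 0 → c z k ≠ 0 := fun k hk => by
        have h1 : k ∈ Finset.univ.filter fun k => c x k ≠ 0 :=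
          Finset.mem_filter.2 ⟨Finset.mem_univ _, hk⟩
        have h2 : k ∈ Finset.univ.filter fun k => c z k ≠ 0 := hxz' ▸ h1
        exact (Finset.mem_filter.1 h2).2
      rcases hF.eq_or_eq_neg (fun x => neg_mem_sym) (mem_sym_of_mem hxA) (mem_sym_of_mem hzA) hij
        hi hj (hiff i hi) (hiff j hj) with h | h
      · exact h.symm
      · exact (hA.nonpar.2 x hxA z hzA (-1) (by rw [h]; module)).symm
  have h1 := (Finset.card_le_card hcover).trans (Finset.card_union_le _ _)
  have h2 := Finset.card_union_le (kerPart A c) (Finset.univ.biUnion (pageIn A c))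
  have h3 : (Finset.univ.biUnion (pageIn A c)).card ≤
      Fintype.card ι * (finrank ℚ (LinearMap.ker c) + 3) := by
    rw [← Finset.card_univ]
    refine Finset.card_biUnion_le_card_mul _ _ _ fun i _ => ?_
    rw [← (hA.card_page_eq hF hC hm' i).1]
    exact card_pageIn_le hA.nonpar i
  have h4 := hA.card_kerPart_le hF hC hm
  have h5 := hF.finrank_ker_add
  have h6 : 2 * (((Fintype.card ι).choose 2 : ℕ) : ℤ) = Fintype.card ι * (Fintype.card ι - 1) := by
    have h := Nat.cast_choose_two ℚ (Fintype.card ι)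
    have h' : (2 : ℚ) * (((Fintype.card ι).choose 2 : ℕ) : ℚ) =
        Fintype.card ι * (Fintype.card ι - 1) := by rw [h]; ring
    exact_mod_cast h'
  obtain ⟨κ, hκ⟩ : ∃ κ, κ = finrank ℚ (LinearMap.ker c) := ⟨_, rfl⟩
  obtain ⟨m, hm0⟩ : ∃ m, m = Fintype.card ι := ⟨_, rfl⟩
  rw [← hκ, ← hm0] at h5
  rw [← hκ] at h4
  rw [← hκ, ← hm0] at h3
  rw [← hm0] at h6 hP
  rw [← h5]
  push_cast
  have h7 : (A.card : ℤ) ≤ (kerPart A c).card + m * (κ + 3) + (m.choose 2 : ℕ) := by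
    have : A.card ≤ (kerPart A c).card + m * (κ + 3) + m.choose 2 := by omega
    exact_mod_cast this
  nlinarith

/-- Rich configurations of large rank satisfy the column bound. -/
theorem exists_card_le_of_rich : ∃ r₁ : ℕ, 1 ≤ r₁ ∧
    ∀ (V : Type) [AddCommGroup V] [Module ℚ V] [FiniteDimensional ℚ V] (A : Finset V), Rich A →
      r₁ ≤ finrank ℚ V →
      2 * (A.card : ℤ) ≤ finrank ℚ V * (finrank ℚ V + 1) + 4 * (finrank ℚ V - 1) := by
  obtain ⟨K, hK⟩ : ∃ K : ℕ, K = 7 ^ 50 := ⟨_, rfl⟩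
  obtain ⟨D, hD⟩ : ∃ D : ℕ, D = 7 ^ (kerBound K + 1) := ⟨_, rfl⟩
  refine ⟨8 + K + pageBound K + (kerBound K + D * (D * D + 2) + 1), by omega, ?_⟩
  intro V _ _ _ A hA hr
  obtain ⟨ι, _, _, c, hF, hκ⟩ := exists_cleanFrame hA hK (by omega)
  refine hA.card_le_of_cleanFrame hF rfl ?_
  have h1 := hF.toFrame.finrank_ker_add
  have h2 : 7 ^ (finrank ℚ (LinearMap.ker c) + 1) ≤ D := by
    rw [hD]
    exact Nat.pow_le_pow_right (by norm_num) (by omega)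
  have h3 := Nat.mul_le_mul h2 (Nat.add_le_add_right (Nat.mul_le_mul h2 h2) 2)
  omega

/-- A finite set contains a spanning nonparallel subset above any given nonparallel subset. -/
lemma exists_nonpar_between [DecidableEq V] {T B₀ : Finset V} (h0 : B₀ ⊆ T) (hB : Nonpar B₀) :
    ∃ B : Finset V, B₀ ⊆ B ∧ B ⊆ T ∧ Nonpar B ∧ (T : Set V) ⊆ span ℚ (B : Set V) := by
  classical
  obtain ⟨B, hBm, hmax⟩ := Finset.exists_max_image
    (T.powerset.filter fun B => B₀ ⊆ B ∧ Nonpar B) Finset.card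
    ⟨B₀, Finset.mem_filter.2 ⟨Finset.mem_powerset.2 h0, subset_rfl, hB⟩⟩
  obtain ⟨hBT, hB0, hBn⟩ := Finset.mem_filter.1 hBm
  rw [Finset.mem_powerset] at hBT
  refine ⟨B, hB0, hBT, hBn, fun t ht => ?_⟩
  by_contra hts
  have htB : t ∉ B := fun h => hts (subset_span h)
  have hn : Nonpar (insert t B) := by
    constructor
    · intro x hx
      rcases Finset.mem_insert.1 hx with rfl | hx
      · rintro rfl
        exact hts (zero_mem _)
      · exact hBn.1 x hx
    · intro x hx y hy a hxy
      rcases Finset.mem_insert.1 hx with rfl | hx' <;> rcases Finset.mem_insert.1 hy with rfl | hy'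
      · rfl
      · exfalso
        have ha : a ≠ 0 := by
          rintro rfl
          exact hBn.1 y hy' (by rw [hxy, zero_smul])
        apply hts
        have : x = a⁻¹ • y := by rw [hxy, inv_smul_smul₀ ha]
        exact this ▸ smul_mem _ _ (subset_span hy')
      · exact absurd (hxy ▸ smul_mem _ _ (subset_span hx')) hts
      · exact hBn.2 x hx' y hy' a hxy
  have := hmax (insert t B) (Finset.mem_filter.2 ⟨Finset.mem_powerset.2
    (Finset.insert_subset ht hBT), hB0.trans (Finset.subset_insert _ _), hn⟩)
  rw [Finset.card_insert_of_notMem htB] at this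
  omega

/-- Contracting an element of a configuration that is not rich. -/
lemma exists_contraction (hn : Nonpar A) (hS : span ℚ (sym A) = ⊤) (hm : IsModular 3 (sym A))
    {e : V} (he : e ∈ A) {R : Finset V} (heR : e ∈ R) (hR : R ⊆ A)
    (h : ∀ x ∈ A, ∀ y ∈ A, x ∉ R → y ∉ R → x ≠ y → ∀ a b : ℚ, e ≠ a • x + b • y) :
    ∃ B : Finset (V ⧸ span ℚ {e}), Nonpar B ∧ span ℚ (sym B) = ⊤ ∧ IsModular 3 (sym B) ∧
      A.card ≤ B.card + R.card := by
  classical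
  let π := (span ℚ {e}).mkQ
  have hπ : Surjective π := mkQ_surjective _
  have hπk : ∀ v, π v = 0 → ∃ a : ℚ, v = a • e := by
    intro v hv
    have : v ∈ span ℚ {e} := by
      rwa [← LinearMap.mem_ker, ker_mkQ] at hv
    obtain ⟨a, ha⟩ := mem_span_singleton.1 this
    exact ⟨a, ha.symm⟩
  have hinj : ∀ x ∈ A \ R, ∀ y ∈ A \ R, ∀ a : ℚ, π y = a • π x → y = x := by
    intro x hx y hy a hxy
    obtain ⟨hxA, hxR⟩ := Finset.mem_sdiff.1 hx
    obtain ⟨hyA, hyR⟩ := Finset.mem_sdiff.1 hy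
    by_contra hne
    obtain ⟨t, ht⟩ := hπk (y - a • x) (by rw [map_sub, map_smul, hxy, sub_self])
    by_cases ht0 : t = 0
    · rw [ht0, zero_smul, sub_eq_zero] at ht
      exact hne (hn.2 x hxA y hyA a ht)
    · refine h y hyA x hxA hyR hxR hne t⁻¹ (-(t⁻¹ * a)) ?_
      have : e = t⁻¹ • (y - a • x) := by rw [ht, inv_smul_smul₀ ht0]
      rw [this]
      module
  have hB₀ : Nonpar ((A \ R).image π) := by
    constructor
    · intro x hx
      obtain ⟨v, hv, rfl⟩ := Finset.mem_image.1 hx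
      obtain ⟨hvA, hvR⟩ := Finset.mem_sdiff.1 hv
      intro h0
      obtain ⟨a, ha⟩ := hπk v h0
      exact hvR (hn.2 e he v hvA a ha ▸ heR)
    · intro x hx y hy a hxy
      obtain ⟨v, hv, rfl⟩ := Finset.mem_image.1 hx
      obtain ⟨w, hw, rfl⟩ := Finset.mem_image.1 hy
      rw [hinj v hv w hw a hxy]
  obtain ⟨B, hB1, hB2, hB3, hB4⟩ := exists_nonpar_between
    (Finset.image_subset_image (f := π) (Finset.sdiff_subset : A \ R ⊆ A)) hB₀
  have hsymB : sym B ⊆ π '' sym A := by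
    rintro x (hx | hx)
    · obtain ⟨v, hv, rfl⟩ := Finset.mem_image.1 (hB2 hx)
      exact ⟨v, mem_sym_of_mem hv, rfl⟩
    · obtain ⟨v, hv, hvx⟩ := Finset.mem_image.1 (hB2 hx)
      exact ⟨-v, neg_mem_sym (mem_sym_of_mem hv), by rw [map_neg, hvx, neg_neg]⟩
  refine ⟨B, hB3, ?_, ?_, ?_⟩
  · rw [eq_top_iff, ← span_image_eq_top hπ hS, span_le]
    have hBs : span ℚ (B : Set (V ⧸ span ℚ {e})) ≤ span ℚ (sym B) :=
      span_mono fun x hx => mem_sym_of_mem hx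
    rintro _ ⟨v, hv | hv, rfl⟩
    · exact hBs (hB4 (Finset.mem_coe.2 (Finset.mem_image_of_mem π hv)))
    · have := hBs (hB4 (Finset.mem_coe.2 (Finset.mem_image_of_mem π hv)))
      rw [map_neg] at this
      exact (neg_mem_iff (S := Submodule ℚ (V ⧸ span ℚ {e}))).1 this
  · refine IsModular.mono (IsModular.quotient (α := Unit) (y := fun _ => e) hm hS hπ
      ?_ (fun _ => mem_sym_of_mem he) ?_) hsymB
    · exact linearIndependent_unique_iff.2 (hn.1 e he)
    · rw [ker_mkQ, Set.range_const]
  · have h1 : ((A \ R).image π).card = (A \ R).card := by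
      refine Finset.card_image_of_injOn fun x hx y hy hxy => ?_
      exact hinj y hy x hx 1 (by rw [one_smul]; exact hxy)
    have h2 := Finset.card_le_card hB1
    have h3 := Finset.card_sdiff_add_card_eq_card hR
    omega

/-- Each nonparallel spanning `3`-modular configuration of large rank satisfies the column
bound. -/
theorem exists_card_le : ∃ r₀ : ℕ,
    ∀ (V : Type) [AddCommGroup V] [Module ℚ V] [FiniteDimensional ℚ V] (A : Finset V),
      Nonpar A → span ℚ (sym A) = ⊤ → IsModular 3 (sym A) → r₀ ≤ finrank ℚ V →
      2 * (A.card : ℤ) ≤ finrank ℚ V * (finrank ℚ V + 1) + 4 * (finrank ℚ V - 1) := by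
  obtain ⟨r₁, hr₁, hrich⟩ := exists_card_le_of_rich
  obtain ⟨N, hN⟩ : ∃ N : ℕ, N = 7 ^ r₁ := ⟨_, rfl⟩
  have key : ∀ (d : ℕ) (V : Type) [AddCommGroup V] [Module ℚ V] [FiniteDimensional ℚ V]
      (A : Finset V), Nonpar A → span ℚ (sym A) = ⊤ → IsModular 3 (sym A) →
      finrank ℚ V = r₁ + d →
      2 * (A.card : ℤ) ≤ finrank ℚ V * (finrank ℚ V + 1) + 4 * (finrank ℚ V - 1) ∨
      2 * (A.card : ℤ) + 2 * d ≤
        finrank ℚ V * (finrank ℚ V + 1) + 4 * (finrank ℚ V - 1) + 2 * N := by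
    intro d
    induction d with
    | zero =>
      intro V _ _ _ A hn hS hm hr
      right
      have h1 := card_le_seven_pow hm hS (T := A) (U := ⊤) (fun x hx => mem_sym_of_mem hx)
        fun x _ => mem_top
      rw [finrank_top, hr, add_zero, ← hN] at h1
      have h2 : (1 : ℤ) ≤ finrank ℚ V := by exact_mod_cast (by omega : 1 ≤ finrank ℚ V)
      have h3 : (A.card : ℤ) ≤ N := by exact_mod_cast h1
      push_cast
      nlinarith
    | succ d ih =>
      intro V _ _ _ A hn hS hm hr
      by_cases hA : Rich A
      · exact Or.inl (hrich V A hA (by omega))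
      have hnr : ∃ e ∈ A, ∃ R ⊆ A, e ∈ R ∧ (∀ x ∈ A, ∀ y ∈ A, x ∉ R → y ∉ R → x ≠ y →
          ∀ a b : ℚ, e ≠ a • x + b • y) ∧ R.card < finrank ℚ V + 2 := by
        by_contra! hcon
        exact hA ⟨hn, hS, hm, fun e he R hR heR h => hcon e he R hR heR h⟩
      obtain ⟨e, he, R, hR, heR, h, hcard⟩ := hnr
      obtain ⟨B, hB1, hB2, hB3, hB4⟩ := exists_contraction hn hS hm he heR hR h
      have h1 := finrank_quotient_add_finrank (span ℚ {e} : Submodule ℚ V)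
      rw [finrank_span_singleton (hn.1 e he)] at h1
      obtain ⟨k, hk⟩ : ∃ k, k = finrank ℚ (V ⧸ span ℚ {e}) := ⟨_, rfl⟩
      have h2 := ih _ B hB1 hB2 hB3 (by omega)
      rw [← hk] at h1 h2
      rw [← h1] at hcard ⊢
      have h3 : (A.card : ℤ) ≤ B.card + (k + 2) := by
        exact_mod_cast (by omega : A.card ≤ B.card + (k + 2))
      push_cast
      rcases h2 with h2 | h2
      · left
        linarith
      · right
        linarith
  refine ⟨r₁ + N, fun V _ _ _ A hn hS hm hr => ?_⟩
  obtain ⟨d, hd⟩ := Nat.exists_eq_add_of_le (show r₁ ≤ finrank ℚ V by omega)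
  have hNd : (N : ℤ) ≤ d := by exact_mod_cast (by omega : N ≤ d)
  rcases key d V A hn hS hm hd with h | h
  · exact h
  · linarith

end

lemma two_mul_choose_add (r : ℕ) (hr : 1 ≤ r) :
    2 * (((r + 1).choose 2 + 2 * (r - 1) : ℕ) : ℤ) = r * (r + 1) + 4 * (r - 1) := by
  obtain ⟨k, rfl⟩ := Nat.exists_eq_add_of_le' hr
  have h : 2 * (k + 1 + 1).choose 2 = (k + 2) * (k + 1) := by
    rw [Nat.choose_two_right, Nat.mul_div_cancel' (even_iff_two_dvd.1 ?_)]
    · rfl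
    · rw [mul_comm]
      exact Nat.even_mul_succ_self _
  have h' : (2 : ℤ) * ((k + 1 + 1).choose 2 : ℕ) = (k + 2) * (k + 1) := by exact_mod_cast h
  rw [Nat.add_sub_cancel]
  push_cast
  linarith

lemma bdd_det_of_deltaModular {r n : ℕ} {A : Matrix (Fin r) (Fin n) ℤ} {Δ : ℤ} (hΔ : 0 ≤ Δ)
    (hA : DeltaModular A Δ) {S : Set (Fin r → ℚ)}
    (hS : ∀ x ∈ S, ∃ j, x = (fun k => (A k j : ℚ)) ∨ x = -(fun k => (A k j : ℚ))) :
    Bdd (Matrix.detRowAlternating (n := Fin r) (R := ℚ)) S Δ := by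
  intro w hw
  have h1 : ∀ i, ∃ (j : Fin n) (σ : ℤ), |σ| = 1 ∧ w i = (σ : ℚ) • fun k => (A k j : ℚ) := by
    intro i
    obtain ⟨j, hj | hj⟩ := hS _ (hw i)
    · exact ⟨j, 1, by simp, by rw [hj]; simp⟩
    · exact ⟨j, -1, by simp, by rw [hj]; simp⟩
  choose f σ hσ hf using h1
  have hw' : w = fun i => (σ i : ℚ) • (fun i k => (A k (f i) : ℚ)) i := funext hf
  rw [hw', AlternatingMap.map_smul_univ]
  by_cases hinj : Injective f
  · refine ⟨(∏ i, σ i) * (A.submatrix id f).det, ?_, ?_⟩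
    · have h2 : Matrix.detRowAlternating (fun i k => (A k (f i) : ℚ)) =
          (((A.submatrix id f).det : ℤ) : ℚ) := by
        rw [← Matrix.det_transpose, Int.cast_det]
        rfl
      rw [h2, smul_eq_mul]
      push_cast
      rfl
    · rw [abs_mul, Finset.abs_prod, Finset.prod_congr rfl fun i _ => hσ i, Finset.prod_const_one,
        one_mul]
      exact hA f hinj
  · refine ⟨0, ?_, by simpa using hΔ⟩
    rw [AlternatingMap.map_eq_zero_of_not_injective, smul_zero, Int.cast_zero]
    intro h
    exact hinj fun i j hij => h (by simp only [hij])

/-- The upper bound on the column number, for matrices. -/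
theorem exists_column_bound : ∃ r₀ : ℕ, ∀ r : ℕ, r₀ ≤ r → ∀ (n : ℕ)
    (A : Matrix (Fin r) (Fin n) ℤ), (A.map (fun z : ℤ => (z : ℚ))).rank = r →
    DeltaModular A 3 →
    (∀ i j : Fin n, i ≠ j → ¬ IntParallel (fun k => A k i) (fun k => A k j)) →
    n ≤ (r + 1).choose 2 + 2 * (r - 1) := by
  classical
  obtain ⟨r₀, h⟩ := exists_card_le
  refine ⟨r₀ + 1, fun r hr n A hrank hA hpar => ?_⟩
  rcases Nat.lt_or_ge 1 n with hn | hn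
  swap
  · have : 1 ≤ (r + 1).choose 2 := Nat.choose_pos (by omega)
    omega
  let v : Fin n → (Fin r → ℚ) := fun j k => (A k j : ℚ)
  have hli : ∀ i j, i ≠ j → LinearIndependent ℚ ![v i, v j] := fun i j hij =>
    not_not.1 (hpar i j hij)
  have h0 : ∀ i, v i ≠ 0 := by
    intro i
    have : Nontrivial (Fin n) := Fin.nontrivial_iff_two_le.2 hn
    obtain ⟨j, hj⟩ := exists_ne i
    exact (hli i j hj.symm).ne_zero 0
  have hc : ∀ i j (a : ℚ), v j = a • v i → j = i := by
    intro i j a hij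
    by_contra hne
    exact (LinearIndependent.pair_iff' (h0 i)).1 (hli i j (Ne.symm hne)) a hij.symm
  have hinj : Injective v := fun i j hij => hc j i 1 (by rw [hij, one_smul])
  have hsub : Set.range v ⊆ sym (Finset.univ.image v) := by
    rintro _ ⟨j, rfl⟩
    exact mem_sym_of_mem (Finset.mem_image_of_mem _ (Finset.mem_univ _))
  have hcard := h (Fin r → ℚ) (Finset.univ.image v) ⟨?_, ?_⟩ ?_ ?_ ?_
  · rw [Finset.card_image_of_injective _ hinj, Finset.card_univ, Fintype.card_fin,
      finrank_fin_fun, ← two_mul_choose_add r (by omega)] at hcard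
    omega
  · intro x hx
    obtain ⟨j, -, rfl⟩ := Finset.mem_image.1 hx
    exact h0 j
  · intro x hx y hy a hxy
    obtain ⟨i, -, rfl⟩ := Finset.mem_image.1 hx
    obtain ⟨j, -, rfl⟩ := Finset.mem_image.1 hy
    rw [hc i j a hxy]
  · rw [eq_top_iff]
    refine le_trans (le_of_eq (eq_comm.1 ?_)) (span_mono hsub)
    apply eq_top_of_finrank_eq
    rw [finrank_fin_fun]
    exact (Matrix.rank_eq_finrank_span_cols _).symm.trans hrank
  · refine IsModular.of_form (ω := Matrix.detRowAlternating) ?_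
      (bdd_det_of_deltaModular (by norm_num) hA ?_) (by simp)
    · intro h1
      have h2 : Matrix.detRowAlternating (1 : Matrix (Fin r) (Fin r) ℚ) = 0 := by rw [h1]; rfl
      exact one_ne_zero ((Matrix.det_one (n := Fin r) (R := ℚ)).symm.trans h2)
    · rintro x (hx | hx)
      · obtain ⟨j, -, hj⟩ := Finset.mem_image.1 hx
        exact ⟨j, Or.inl hj.symm⟩
      · obtain ⟨j, -, hj⟩ := Finset.mem_image.1 hx
        exact ⟨j, Or.inr (by rw [← neg_neg x, ← hj])⟩
  · rw [finrank_fin_fun]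
    omega

/-- The incidence matrix of a directed graph, restricted to some of the vertices, is
unimodular. -/
lemma abs_det_network_le_one {X : Type*} [DecidableEq X] (k : ℕ) (f : Fin k → X)
    (hf : Injective f) (p q : Fin k → X) :
    |(Matrix.of fun i j => (if p j = f i then 1 else 0) - (if q j = f i then 1 else 0) :
      Matrix (Fin k) (Fin k) ℤ).det| ≤ 1 := by
  induction k with
  | zero => simp
  | succ k ih =>
    obtain ⟨M, hM⟩ : ∃ M : Matrix (Fin (k + 1)) (Fin (k + 1)) ℤ, M = Matrix.of fun i j =>
      (if p j = f i then 1 else 0) - (if q j = f i then 1 else 0) := ⟨_, rfl⟩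
    rw [← hM]
    have hMa : ∀ i j, M i j = (if p j = f i then 1 else 0) - (if q j = f i then 1 else 0) := by
      intro i j
      rw [hM]
      rfl
    have hexp : ∀ j i₀, |M i₀ j| ≤ 1 → (∀ i, i ≠ i₀ → M i j = 0) → |M.det| ≤ 1 := by
      intro j i₀ h1 h0
      rw [Matrix.det_succ_column M j, Finset.sum_eq_single i₀]
      · rw [abs_mul, abs_mul, abs_pow, abs_neg, abs_one, one_pow, one_mul]
        refine mul_le_one₀ h1 (abs_nonneg _) ?_
        have := ih (f ∘ i₀.succAbove) (hf.comp Fin.succAbove_right_injective)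
          (p ∘ j.succAbove) (q ∘ j.succAbove)
        rw [hM]
        exact this
      · intro i _ hi
        rw [h0 i hi, mul_zero, zero_mul]
      · exact fun h => absurd (Finset.mem_univ _) h
    by_cases hall : ∀ j, (∃ i, p j = f i) ∧ ∃ i, q j = f i
    · have hz : M.det = 0 := by
        refine Matrix.exists_vecMul_eq_zero_iff.1 ⟨1, one_ne_zero, ?_⟩
        ext j
        obtain ⟨⟨a, ha⟩, b, hb⟩ := hall j
        have hs : ∀ (x : X) (a : Fin (k + 1)), x = f a →
            ∑ i, (if x = f i then (1 : ℤ) else 0) = 1 := by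
          rintro _ a rfl
          simp [hf.eq_iff]
        simp only [Matrix.vecMul, dotProduct, Pi.one_apply, one_mul, hMa, Finset.sum_sub_distrib,
          hs _ a ha, hs _ b hb, sub_self, Pi.zero_apply]
      simp [hz]
    · push Not at hall
      obtain ⟨j, hj⟩ := hall
      by_cases hp : ∃ i, p j = f i
      · obtain ⟨i₀, hi₀⟩ := hp
        have hq := hj ⟨i₀, hi₀⟩
        refine hexp j i₀ ?_ fun i hi => ?_
        · rw [hMa, if_neg (hq i₀)]
          split_ifs
          all_goals simp
        · rw [hMa, if_neg (hq i), if_neg, sub_zero]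
          exact fun h => hi (hf (h.symm.trans hi₀))
      · push Not at hp
        by_cases hq : ∃ i, q j = f i
        · obtain ⟨i₀, hi₀⟩ := hq
          refine hexp j i₀ ?_ fun i hi => ?_
          · rw [hMa, if_neg (hp i₀)]
            split_ifs
            all_goals simp
          · rw [hMa, if_neg (hp i), if_neg, sub_zero]
            exact fun h => hi (hf (h.symm.trans hi₀))
        · push Not at hq
          refine hexp j 0 ?_ fun i _ => ?_
          · rw [hMa, if_neg (hp 0), if_neg (hq 0)]
            simp
          · rw [hMa, if_neg (hp i), if_neg (hq i), sub_zero]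

/-- The index set of the columns of the extremal example. -/
abbrev ExtremalIndex (m : ℕ) : Type := Unit ⊕ (Fin 4 × Fin m) ⊕ (Σ j : Fin m, Fin j)

/-- The columns `e₀`, `a • e₀ + eᵢ` for `0 ≤ a ≤ 3`, and `eᵢ - eⱼ`. -/
def extremalColumn {m : ℕ} : ExtremalIndex m → Fin (m + 1) → ℤ
  | Sum.inl _ => Fin.cons 1 0
  | Sum.inr (Sum.inl (a, i)) => Fin.cons (a : ℤ) (Pi.single i 1)
  | Sum.inr (Sum.inr ⟨j, i⟩) =>
    Fin.cons 0 (Pi.single (Fin.castLE j.2.le i) 1 - Pi.single j 1)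

lemma card_extremalIndex (m : ℕ) :
    Fintype.card (ExtremalIndex m) = (m + 1 + 1).choose 2 + 2 * (m + 1 - 1) := by
  have h1 : ∑ j : Fin m, (j : ℕ) = m.choose 2 := by
    rw [Fin.sum_univ_eq_sum_range (fun j => j) m, Finset.sum_range_id, Nat.choose_two_right]
  have h2 : (m + 1 + 1).choose 2 = m.choose 2 + 2 * m + 1 := by
    rw [Nat.choose_succ_succ' (m + 1) 1, Nat.choose_succ_succ' m 1]
    simp
    omega
  simp only [ExtremalIndex, Fintype.card_sum, Fintype.card_prod, Fintype.card_sigma,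
    Fintype.card_fin, Fintype.card_unit, h1]
  omega

/-- The part of the first row of the extremal example at level `t`. -/
def level {m : ℕ} (t : ℕ) : ExtremalIndex m → ℤ
  | Sum.inl _ => if t = 1 then 1 else 0
  | Sum.inr (Sum.inl (a, _)) => if t ≤ a then 1 else 0
  | Sum.inr (Sum.inr _) => 0

/-- The heads of the edges at level `t`. -/
def levelHead {m : ℕ} : ExtremalIndex m → Option (Fin (m + 1))
  | Sum.inl _ => none
  | Sum.inr (Sum.inl (_, i)) => some i.succ
  | Sum.inr (Sum.inr ⟨j, i⟩) => some (Fin.castLE j.2.le i).succ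

/-- The tails of the edges at level `t`. -/
def levelTail {m : ℕ} (t : ℕ) : ExtremalIndex m → Option (Fin (m + 1))
  | Sum.inl _ => if t = 1 then some 0 else none
  | Sum.inr (Sum.inl (a, _)) => if t ≤ a then some 0 else none
  | Sum.inr (Sum.inr ⟨j, _⟩) => some j.succ

lemma extremalColumn_zero {m : ℕ} (g : ExtremalIndex m) :
    extremalColumn g 0 = level 1 g + level 2 g + level 3 g := by
  rcases g with _ | ⟨a, i⟩ | ⟨j, i⟩
  · simp [extremalColumn, level]
  · fin_cases a <;> simp [extremalColumn, level]
  · simp [extremalColumn, level]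

lemma abs_det_level_le_one {m : ℕ} (f : Fin (m + 1) → ExtremalIndex m) (t : ℕ) :
    |((Matrix.of fun i j => extremalColumn (f j) i).updateRow 0
      fun j => level t (f j)).det| ≤ 1 := by
  have h := abs_det_network_le_one (m + 1) some (Option.some_injective _) (fun j => levelHead (f j))
    (fun j => levelTail t (f j))
  have hN : (Matrix.of fun i j => (if levelHead (f j) = some i then 1 else 0) -
      (if levelTail t (f j) = some i then 1 else 0) : Matrix (Fin (m + 1)) (Fin (m + 1)) ℤ) =
      (Matrix.of fun i j => extremalColumn (f j) i).updateRow 0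
        ((-1 : ℤ) • fun j => level t (f j)) := by
    ext i j
    refine Fin.cases ?_ (fun i => ?_) i
    · rw [Matrix.updateRow_self, Matrix.of_apply, Pi.smul_apply]
      rcases f j with _ | ⟨a, i⟩ | ⟨j, i⟩
      · by_cases ht : t = 1 <;> simp [levelHead, levelTail, level, ht]
      · by_cases ht : t ≤ a <;> simp [levelHead, levelTail, level, ht]
      · simp [levelHead, levelTail, level]
    · rw [Matrix.updateRow_ne (Fin.succ_ne_zero i), Matrix.of_apply, Matrix.of_apply]
      rcases f j with _ | ⟨a, k⟩ | ⟨l, k⟩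
      · by_cases ht : t = 1 <;> simp [levelHead, levelTail, extremalColumn, ht,
          (Fin.succ_ne_zero i).symm]
      · by_cases ht : t ≤ a <;> simp [levelHead, levelTail, extremalColumn, ht,
          Pi.single_apply, eq_comm]
      · simp [levelHead, levelTail, extremalColumn, Pi.single_apply, eq_comm]
  rwa [hN, Matrix.det_updateRow_smul, abs_mul, abs_neg, abs_one, one_mul] at h

lemma abs_det_extremal_le {m : ℕ} (f : Fin (m + 1) → ExtremalIndex m) :
    |(Matrix.of fun i j => extremalColumn (f j) i).det| ≤ 3 := by
  obtain ⟨M, hM⟩ : ∃ M : Matrix (Fin (m + 1)) (Fin (m + 1)) ℤ,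
    M = Matrix.of fun i j => extremalColumn (f j) i := ⟨_, rfl⟩
  have h1 := abs_det_level_le_one f 1
  have h2 := abs_det_level_le_one f 2
  have h3 := abs_det_level_le_one f 3
  rw [← hM] at h1 h2 h3 ⊢
  have h : M.det = (M.updateRow 0 fun j => level 1 (f j)).det +
      (M.updateRow 0 fun j => level 2 (f j)).det + (M.updateRow 0 fun j => level 3 (f j)).det := by
    rw [← Matrix.det_updateRow_add, ← Matrix.det_updateRow_add]
    congr 1
    have : ((fun j => level 1 (f j)) + (fun j => level 2 (f j)) + fun j => level 3 (f j)) =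
        M 0 := by
      ext j
      rw [hM]
      exact (extremalColumn_zero (f j)).symm
    rw [this, Matrix.updateRow_eq_self]
  rw [h]
  have h4 := abs_add_three (M.updateRow 0 fun j => level 1 (f j)).det
    (M.updateRow 0 fun j => level 2 (f j)).det (M.updateRow 0 fun j => level 3 (f j)).det
  omega

lemma span_extremalColumn (m : ℕ) :
    span ℚ (Set.range fun (g : ExtremalIndex m) (k : Fin (m + 1)) => (extremalColumn g k : ℚ)) =
      ⊤ := by
  rw [eq_top_iff, ← (Pi.basisFun ℚ (Fin (m + 1))).span_eq, span_le]
  rintro _ ⟨k, rfl⟩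
  refine subset_span ?_
  refine Fin.cases ⟨Sum.inl (), ?_⟩ (fun i => ⟨Sum.inr (Sum.inl (0, i)), ?_⟩) k
  · ext k
    refine Fin.cases ?_ (fun l => ?_) k <;> simp [extremalColumn]
  · ext k
    refine Fin.cases ?_ (fun l => ?_) k <;> simp [extremalColumn, Pi.single_apply]

lemma extremalColumn_ne_zero {m : ℕ} (g : ExtremalIndex m) :
    (fun k => (extremalColumn g k : ℚ)) ≠ 0 := by
  intro h
  rcases g with _ | ⟨a, i⟩ | ⟨j, i⟩
  · simpa [extremalColumn] using congrFun h 0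
  · simpa [extremalColumn] using congrFun h i.succ
  · have hne : j ≠ Fin.castLE j.2.le i := fun h => i.2.ne' (congrArg Fin.val h)
    simpa [extremalColumn, Pi.single_apply, hne] using congrFun h j.succ

lemma eq_of_smul_extremalColumn {m : ℕ} {g h : ExtremalIndex m} {a : ℚ}
    (hgh : a • (fun k => (extremalColumn g k : ℚ)) = fun k => (extremalColumn h k : ℚ)) :
    g = h := by
  have h0 : ∀ k, a * (extremalColumn g k : ℚ) = extremalColumn h k := fun k => congrFun hgh k
  have hs : a * ∑ i : Fin m, (extremalColumn g i.succ : ℚ) =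
      ∑ i : Fin m, (extremalColumn h i.succ : ℚ) := by
    rw [Finset.mul_sum]
    exact Finset.sum_congr rfl fun i _ => h0 _
  have hlt : ∀ (j : Fin m) (i : Fin j), Fin.castLE j.2.le i < j := fun j i => i.2
  rcases g with _ | ⟨b, i⟩ | ⟨j, i⟩ <;> rcases h with _ | ⟨c, k⟩ | ⟨l, k⟩
  · rfl
  · simpa [extremalColumn] using h0 k.succ
  · have := h0 l.succ
    simp [extremalColumn, (hlt l k).ne'] at this
  · have h1 := h0 i.succ
    have h2 := h0 0
    simp [extremalColumn] at h1 h2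
    simp [h1] at h2
  · have h1 := h0 k.succ
    have h2 := h0 0
    by_cases hik : k = i
    · subst hik
      simp [extremalColumn] at h1 h2
      rw [h1, one_mul] at h2
      have : b = c := Fin.ext (by exact_mod_cast h2)
      rw [this]
    · simp [extremalColumn, hik] at h1
  · have h1 := h0 l.succ
    simp [extremalColumn, Pi.single_apply, Finset.sum_sub_distrib, (hlt l k).ne'] at h1 hs
    simp [hs] at h1
  · have h1 := h0 j.succ
    have h2 := h0 0
    simp [extremalColumn, (hlt j i).ne'] at h1 h2
  · simp [extremalColumn, Pi.single_apply, Finset.sum_sub_distrib] at hs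
  · have h1 := h0 l.succ
    have h2 := h0 (Fin.castLE l.2.le k).succ
    simp only [extremalColumn, Fin.cons_succ, Pi.sub_apply, Pi.single_apply, (hlt l k).ne,
      (hlt l k).ne', if_true, if_false] at h1 h2
    have hji := hlt j i
    have hlk := hlt l k
    obtain ⟨x, hx⟩ : ∃ x, x = Fin.castLE j.2.le i := ⟨_, rfl⟩
    obtain ⟨y, hy⟩ : ∃ y, y = Fin.castLE l.2.le k := ⟨_, rfl⟩
    rw [← hx] at h1 h2 hji
    rw [← hy] at h2 hlk
    have hlj : l = j ∧ y = x := by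
      by_cases hlj : l = j <;> by_cases hyx : y = x <;> by_cases hlx : l = x <;>
        by_cases hyj : y = j <;> simp only [hlj, hyx, hlx, hyj, if_true, if_false] at h1 h2 <;>
        first
        | exact ⟨hlj, hyx⟩
        | (exfalso; omega)
        | (exfalso; push_cast at h1 h2; linarith)
    obtain ⟨rfl, hyx⟩ := hlj
    have hval : (Fin.castLE l.2.le i).val = (Fin.castLE l.2.le k).val :=
      congrArg Fin.val (hx.symm.trans (hyx.symm.trans hy))
    have hik : i = k := Fin.ext hval
    rw [hik]

/-- Matrices attaining the column number. -/
theorem exists_extremal_matrix (m : ℕ) :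
    ∃ A : Matrix (Fin (m + 1)) (Fin ((m + 1 + 1).choose 2 + 2 * (m + 1 - 1))) ℤ,
      (A.map (fun z : ℤ => (z : ℚ))).rank = m + 1 ∧ DeltaModular A 3 ∧
        ∀ i j, i ≠ j → ¬ IntParallel (fun k => A k i) (fun k => A k j) := by
  let e : Fin ((m + 1 + 1).choose 2 + 2 * (m + 1 - 1)) ≃ ExtremalIndex m :=
    (Fintype.equivFinOfCardEq (card_extremalIndex m)).symm
  refine ⟨Matrix.of fun i j => extremalColumn (e j) i, ?_, ?_, ?_⟩
  · have h : Set.range (Matrix.col ((Matrix.of fun i j => extremalColumn (e j) i).map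
        fun z : ℤ => (z : ℚ))) =
        Set.range fun (g : ExtremalIndex m) (k : Fin (m + 1)) => (extremalColumn g k : ℚ) :=
      e.surjective.range_comp fun (g : ExtremalIndex m) (k : Fin (m + 1)) =>
        (extremalColumn g k : ℚ)
    rw [Matrix.rank_eq_finrank_span_cols, h, span_extremalColumn, finrank_top, finrank_fin_fun]
  · exact fun f _ => abs_det_extremal_le (e ∘ f)
  · intro i j hij h
    refine h ((LinearIndependent.pair_iff' (extremalColumn_ne_zero (e i))).2 fun a ha => ?_)
    exact hij (e.injective (eq_of_smul_extremalColumn ha))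

end ModularForms

theorem column_number_three_modular :
    ∃ r₀ : ℤ, ∀ r : ℕ, r₀ ≤ (r : ℤ) →
      ((∀ (n : ℕ) (A : Matrix (Fin r) (Fin n) ℤ),
          (A.map (fun z : ℤ => (z : ℚ))).rank = r →
          DeltaModular A 3 →
          (∀ i j : Fin n, i ≠ j →
            ¬ IntParallel (fun k => A k i) (fun k => A k j)) →
          n ≤ (r + 1).choose 2 + 2 * (r - 1)) ∧
        (∃ A : Matrix (Fin r) (Fin ((r + 1).choose 2 + 2 * (r - 1))) ℤ,
          (A.map (fun z : ℤ => (z : ℚ))).rank = r ∧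
          DeltaModular A 3 ∧
          (∀ i j, i ≠ j →
            ¬ IntParallel (fun k => A k i) (fun k => A k j)))) := by
  obtain ⟨r₀, h⟩ := ModularForms.exists_column_bound
  refine ⟨r₀ + 1, fun r hr => ⟨h r (by omega), ?_⟩⟩
  obtain ⟨m, rfl⟩ : ∃ m, r = m + 1 := ⟨r - 1, by omega⟩
  exact ModularForms.exists_extremal_matrix m
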